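/- Let G = G(Γ,S) be a connected cubic (3-regular) non-bipartite Cayley graph on a finite group Γ of even order. Then G is 2-extendable if and only if G has girth at least 4 and G is not isomorphic to Z_{4n}(1,4n−1,2n) for any n ≥ 2 and not isomorphic to Z_{4n+2}(2,4n,2n+1) for any n ≥ 2. -/

import Mathlib

open SimpleGraph

/-- A simple graph is vertex-transitive if any vertex can be mapped to any other
by a graph automorphism. -/
def IsVertexTransitive {V : Type*} (G : SimpleGraph V) : Prop :=
  ∀ x y : V, ∃ φ : G ≃g G, φ x = y

/-- A graph `G` with at least `2*n+2` vertices is `n`-extendable if it has a matching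
of size `n` and every matching of size `n` extends to a perfect matching. -/
def IsNExtendable {V : Type*} [Fintype V] (G : SimpleGraph V) (n : ℕ) : Prop :=
  2 * n + 2 ≤ Fintype.card V ∧
    (∃ M : G.Subgraph, M.IsMatching ∧ M.edgeSet.ncard = n) ∧
    ∀ M : G.Subgraph, M.IsMatching → M.edgeSet.ncard = n →
      ∃ P : G.Subgraph, P.IsPerfectMatching ∧ M.edgeSet ⊆ P.edgeSet

/-- The Cayley graph of a group `Γ` with respect to an inverse-closed connecting set `S`:
distinct `x, y` are adjacent iff `x * y⁻¹ ∈ S`. -/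
def cayleyGraph (Γ : Type*) [Group Γ] (S : Set Γ) (hS : ∀ s ∈ S, s⁻¹ ∈ S) :
    SimpleGraph Γ where
  Adj x y := x ≠ y ∧ x * y⁻¹ ∈ S
  symm := by
    constructor
    rintro x y ⟨hxy, hs⟩
    exact ⟨hxy.symm, by simpa [mul_inv_rev] using hS _ hs⟩
  loopless := ⟨fun x h => h.1 rfl⟩

/-- The circulant graph on `ZMod m` with connection set `{a, b, c}` (as residues). -/
def circThree (m : ℕ) (a b c : ℕ) : SimpleGraph (ZMod m) :=
  SimpleGraph.circulantGraph {(a : ZMod m), (b : ZMod m), (c : ZMod m)}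

open SimpleGraph

set_option linter.unusedSectionVars false

section Core
variable {Γ : Type*} [Group Γ] [Fintype Γ] [DecidableEq Γ]

/-- number of boundary arcs of `A` coloured `s` -/
def bd (s : Γ) (A : Finset Γ) : ℕ := (A.filter (fun x => s * x ∉ A)).card

/-- size of the edge boundary of `A` -/
def dd (S A : Finset Γ) : ℕ := ∑ s ∈ S, bd s A

/-- right translate -/
def tr (A : Finset Γ) (g : Γ) : Finset Γ := A.map (Equiv.mulRight g).toEmbedding

/-- standing assumptions on the connection set -/
structure Cub (S : Finset Γ) : Prop where
  card : S.card = 3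
  inv : ∀ s ∈ S, s⁻¹ ∈ S
  one : (1 : Γ) ∉ S
  gen : Subgroup.closure (S : Set Γ) = ⊤

def TriFree (S : Finset Γ) : Prop := ∀ s ∈ S, ∀ t ∈ S, s * t ∉ S

theorem mem_tr {A : Finset Γ} {g x : Γ} : x ∈ tr A g ↔ x * g⁻¹ ∈ A := by
  simp only [tr, Finset.mem_map_equiv]
  simp

theorem card_tr (A : Finset Γ) (g : Γ) : (tr A g).card = A.card := by simp [tr]

theorem bd_tr (s : Γ) (A : Finset Γ) (g : Γ) : bd s (tr A g) = bd s A := by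
  unfold bd
  have : (tr A g).filter (fun x => s * x ∉ tr A g) = tr (A.filter (fun x => s * x ∉ A)) g := by
    ext x
    simp [mem_tr, mul_assoc]
  rw [this, card_tr]

theorem dd_tr (S A : Finset Γ) (g : Γ) : dd S (tr A g) = dd S A := by
  simp [dd, bd_tr]

theorem bd_add (s : Γ) (A : Finset Γ) :
    (A.filter (fun x => s * x ∈ A)).card + bd s A = A.card := by
  unfold bd
  exact Finset.card_filter_add_card_filter_not _

theorem bd_compl (s : Γ) (A : Finset Γ) : bd s Aᶜ = bd s A := by
  have h1 := bd_add s A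
  have h2 : (Finset.univ.filter (fun x => s * x ∈ A)).card = A.card := by
    have : Finset.univ.filter (fun x => s * x ∈ A) = A.map (Equiv.mulLeft s⁻¹).toEmbedding := by
      ext x
      simp [Finset.mem_map_equiv]
    rw [this, Finset.card_map]
  have h3 : (Finset.univ.filter (fun x => s * x ∈ A)).card
      = (A.filter (fun x => s * x ∈ A)).card + bd s Aᶜ := by
    unfold bd
    rw [← Finset.card_union_of_disjoint]
    · congr 1
      ext x
      simp only [Finset.mem_filter, Finset.mem_univ, true_and, Finset.mem_union,
        Finset.mem_compl, not_not]
      tauto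
    · rw [Finset.disjoint_left]
      intro x
      simp only [Finset.mem_filter, Finset.mem_compl]
      tauto
  omega

theorem dd_compl (S A : Finset Γ) : dd S Aᶜ = dd S A := by
  simp [dd, bd_compl]

theorem bd_submod (s : Γ) (A B : Finset Γ) :
    bd s (A ∩ B) + bd s (A ∪ B) ≤ bd s A + bd s B := by
  have key : ∀ C : Finset Γ, C ⊆ A ∪ B →
      bd s C = ∑ x ∈ A ∪ B, if x ∈ C ∧ s * x ∉ C then 1 else 0 := by
    intro C hC
    rw [bd, Finset.card_eq_sum_ones, ← Finset.sum_filter]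
    congr 1
    ext x
    simp only [Finset.mem_filter]
    constructor
    · rintro ⟨h1, h2⟩
      exact ⟨hC h1, h1, h2⟩
    · rintro ⟨_, h1, h2⟩
      exact ⟨h1, h2⟩
  rw [key (A ∩ B) (fun x hx => Finset.mem_union_left _ (Finset.mem_of_mem_inter_left hx)),
    key (A ∪ B) (fun x hx => hx), key A Finset.subset_union_left,
    key B Finset.subset_union_right, ← Finset.sum_add_distrib, ← Finset.sum_add_distrib]
  apply Finset.sum_le_sum
  intro x _
  simp only [Finset.mem_inter, Finset.mem_union]
  by_cases h1 : x ∈ A <;> by_cases h2 : x ∈ B <;> by_cases h3 : s * x ∈ A <;>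
    by_cases h4 : s * x ∈ B <;> simp [h1, h2, h3, h4]

theorem dd_submod (S A B : Finset Γ) :
    dd S (A ∩ B) + dd S (A ∪ B) ≤ dd S A + dd S B := by
  unfold dd
  rw [← Finset.sum_add_distrib, ← Finset.sum_add_distrib]
  exact Finset.sum_le_sum fun s _ => bd_submod s A B

theorem dd_posimod (S A B : Finset Γ) :
    dd S (A \ B) + dd S (B \ A) ≤ dd S A + dd S B := by
  have h := dd_submod S A Bᶜ
  rw [dd_compl S B] at h
  have h1 : A ∩ Bᶜ = A \ B := by ext; simp
  have h2 : dd S (A ∪ Bᶜ) = dd S (B \ A) := by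
    rw [← dd_compl]
    congr 1
    ext; simp; tauto
  rw [h1, h2] at h
  exact h

theorem dd_add_in (S A : Finset Γ) :
    (∑ s ∈ S, (A.filter (fun x => s * x ∈ A)).card) + dd S A = S.card * A.card := by
  unfold dd
  rw [← Finset.sum_add_distrib, Finset.sum_congr rfl (fun s _ => bd_add s A)]
  simp

theorem in_even {S : Finset Γ} (hS : Cub S) (A : Finset Γ) :
    Even (∑ s ∈ S, (A.filter (fun x => s * x ∈ A)).card) := by
  have h0 : (∑ s ∈ S, (A.filter (fun x => s * x ∈ A)).card)
      = ((S ×ˢ A).filter (fun p => p.1 * p.2 ∈ A)).card := by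
    rw [Finset.card_filter, Finset.sum_product]
    apply Finset.sum_congr rfl
    intro s _
    rw [Finset.card_filter]
  rw [h0, ← ZMod.natCast_eq_zero_iff_even, Finset.card_eq_sum_ones, Nat.cast_sum]
  refine Finset.sum_involution (fun p _ => (p.1⁻¹, p.1 * p.2)) ?_ ?_ ?_ ?_
  · intro p _
    decide
  · rintro ⟨s, x⟩ hp _ h
    simp only [Finset.mem_filter, Finset.mem_product] at hp
    simp only [Prod.mk.injEq] at h
    have : s = 1 := by simpa using h.2
    exact hS.one (this ▸ hp.1.1)
  · rintro ⟨s, x⟩ hp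
    simp only [Finset.mem_filter, Finset.mem_product] at hp ⊢
    exact ⟨⟨hS.inv _ hp.1.1, hp.2⟩, by simpa using hp.1.2⟩
  · rintro ⟨s, x⟩ _
    simp

theorem dd_parity {S : Finset Γ} (hS : Cub S) (A : Finset Γ) :
    dd S A % 2 = A.card % 2 := by
  have h1 := dd_add_in S A
  obtain ⟨k, hk⟩ := in_even hS A
  rw [hS.card] at h1
  omega

theorem dd_eq_sum (S A : Finset Γ) :
    dd S A = ∑ x ∈ A, (S.filter (fun s => s * x ∉ A)).card := by
  unfold dd bd
  simp only [Finset.card_filter]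
  exact Finset.sum_comm

theorem closed_univ {S : Finset Γ} (hS : Cub S) {A : Finset Γ} (hne : A.Nonempty)
    (hcl : ∀ s ∈ S, ∀ x ∈ A, s * x ∈ A) : A = Finset.univ := by
  obtain ⟨a, ha⟩ := hne
  have key : ∀ g : Γ, ∀ x ∈ A, g * x ∈ A := by
    intro g
    have hg : g ∈ Subgroup.closure (S : Set Γ) := by rw [hS.gen]; trivial
    induction hg using Subgroup.closure_induction'' with
    | one => intro x hx; simpa using hx
    | mem s hs => exact fun x hx => hcl s hs x hx
    | inv_mem s hs => exact fun x hx => hcl s⁻¹ (hS.inv s hs) x hx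
    | mul u v _ _ hu hv => intro x hx; rw [mul_assoc]; exact hu _ (hv x hx)
  ext x
  simp only [Finset.mem_univ, iff_true]
  have := key (x * a⁻¹) a ha
  simpa using this

end Core

open SimpleGraph
set_option linter.unusedSectionVars false
set_option linter.unusedSimpArgs false
section CycPart
variable {Γ : Type*} [Group Γ] [Fintype Γ] [DecidableEq Γ]

theorem exists_lex_min {P : Finset Γ → Prop} (f : Finset Γ → ℕ) (h : ∃ A, P A) :
    ∃ A, P A ∧ ∀ B, P B → f A < f B ∨ (f A = f B ∧ A.card ≤ B.card) := by
  obtain ⟨A0, h0⟩ := h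
  let m : Finset Γ → ℕ ×ₗ ℕ := fun A => toLex (f A, A.card)
  obtain ⟨A, hA, hmin⟩ := (InvImage.wf m (wellFounded_lt (α := ℕ ×ₗ ℕ))).has_min {A | P A} ⟨A0, h0⟩
  refine ⟨A, hA, fun B hB => ?_⟩
  have := hmin B hB
  simp only [InvImage, m, Prod.Lex.toLex_lt_toLex] at this
  omega

/-- `A` contains a nonempty subset with at most as many boundary edges as vertices -/
def CycS (S A : Finset Γ) : Prop := ∃ B ⊆ A, B.Nonempty ∧ dd S B ≤ B.card

theorem CycS.mono {S A B : Finset Γ} (h : CycS S A) (hAB : A ⊆ B) : CycS S B := by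
  obtain ⟨C, h1, h2⟩ := h
  exact ⟨C, h1.trans hAB, h2⟩

theorem CycS.nonempty {S A : Finset Γ} (h : CycS S A) : A.Nonempty := by
  obtain ⟨C, h1, h2, _⟩ := h
  exact h2.mono h1

theorem not_cyc {S : Finset Γ} (hS : Cub S) {A : Finset Γ} (h : ¬ CycS S A) (hne : A.Nonempty) :
    A.card + 2 ≤ dd S A := by
  have h1 : ¬ dd S A ≤ A.card := fun h2 => h ⟨A, subset_rfl, hne, h2⟩
  have := dd_parity hS A
  omega

theorem block_all_or_none {A : Finset Γ}
    (hblk : ∀ g, (A ∩ tr A g).Nonempty → tr A g = A) {s x : Γ} (hx : x ∈ A) (hsx : s * x ∈ A) :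
    ∀ y ∈ A, s * y ∈ A := by
  intro y hy
  have h1 : tr A (x⁻¹ * y) = A := by
    apply hblk
    refine ⟨y, ?_⟩
    simp [mem_tr, hy, hx]
  rw [← h1, mem_tr]
  simpa [mul_assoc] using hsx

theorem CycS.tr {S A : Finset Γ} (h : CycS S A) (g : Γ) : CycS S (tr A g) := by
  obtain ⟨B, h1, h2, h3⟩ := h
  refine ⟨_root_.tr B g, ?_, ?_, ?_⟩
  · intro x hx
    rw [mem_tr] at *
    exact h1 hx
  · obtain ⟨b, hb⟩ := h2
    exact ⟨b * g, by simpa [mem_tr] using hb⟩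
  · rw [dd_tr, card_tr]; exact h3

theorem tr_compl (A : Finset Γ) (g : Γ) : tr Aᶜ g = (tr A g)ᶜ := by
  ext x; simp [mem_tr]

theorem cyc_cut {S : Finset Γ} (hS : Cub S) {κ₀ q : ℕ} (hκ : κ₀ ≤ 5) (hq : κ₀ < q)
    (hg : ∀ A, CycS S A → q ≤ A.card) (A : Finset Γ) (h1 : CycS S A) (h2 : CycS S Aᶜ) :
    κ₀ < dd S A := by
  by_contra hcon
  push Not at hcon
  obtain ⟨A, ⟨hA, hAc, hd⟩, hmin⟩ :=
    exists_lex_min (P := fun A => CycS S A ∧ CycS S Aᶜ ∧ dd S A ≤ κ₀) (dd S) ⟨A, h1, h2, hcon⟩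
  have hN := Finset.card_add_card_compl A
  have hhalf : A.card ≤ Aᶜ.card := by
    have := hmin Aᶜ ⟨hAc, by simpa using hA, by rw [dd_compl]; exact hd⟩
    rw [dd_compl] at this
    omega
  have hqA := hg A hA
  have hblk : ∀ g, (A ∩ tr A g).Nonempty → tr A g = A := by
    intro g hne
    by_contra hneq
    set B := tr A g with hB
    have hBc : CycS S Bᶜ := by rw [hB, ← tr_compl]; exact hAc.tr g
    have hBcy : CycS S B := hA.tr g
    have hcB : B.card = A.card := card_tr A g
    have hdB : dd S B = dd S A := dd_tr S A g
    have e1 := Finset.card_inter_add_card_sdiff A B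
    have e2 := Finset.card_inter_add_card_sdiff B A
    rw [Finset.inter_comm] at e2
    have e3 := Finset.card_union_add_card_inter A B
    have e4 := Finset.card_add_card_compl (A ∪ B)
    have hpos : 0 < (A ∩ B).card := hne.card_pos
    have hsne : (A \ B).Nonempty := by
      rw [Finset.sdiff_nonempty]
      intro hsub
      exact hneq (Finset.eq_of_subset_of_card_le hsub hcB.le).symm
    have hspos := hsne.card_pos
    have hsne' : (B \ A).Nonempty := by rw [← Finset.card_pos]; omega
    have sm := dd_submod S A B
    have pm := dd_posimod S A B
    have hune : ((A ∪ B)ᶜ).Nonempty := by rw [← Finset.card_pos]; omega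
    have hcapc : CycS S (A ∩ B)ᶜ := hAc.mono (Finset.compl_subset_compl.2 Finset.inter_subset_left)
    have hAdc : CycS S (A \ B)ᶜ := hAc.mono (Finset.compl_subset_compl.2 Finset.sdiff_subset)
    have hBdc : CycS S (B \ A)ᶜ := hBc.mono (Finset.compl_subset_compl.2 Finset.sdiff_subset)
    have hun : CycS S (A ∪ B) := hA.mono Finset.subset_union_left
    have hcomp : dd S (A ∪ B) < dd S A → ((A ∪ B)ᶜ).card + 2 ≤ dd S (A ∪ B) := by
      intro hlt
      rw [← dd_compl]
      apply not_cyc hS _ hune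
      intro hc
      have := hmin (A ∪ B) ⟨hun, hc, by omega⟩
      omega
    have a1 : ¬ CycS S (A ∩ B) := by
      intro hc
      have hq' := hg _ hc
      have hlt : dd S A < dd S (A ∩ B) := by
        by_contra hle
        have := hmin (A ∩ B) ⟨hc, hcapc, by omega⟩
        omega
      have := hcomp (by omega)
      omega
    have a2 : ¬ CycS S (A \ B) := by
      intro hc
      have hq' := hg _ hc
      have hlt : dd S A < dd S (A \ B) := by
        by_contra hle
        have := hmin (A \ B) ⟨hc, hAdc, by omega⟩
        omega
      have : (B \ A).card + 2 ≤ dd S (B \ A) := by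
        apply not_cyc hS _ hsne'
        intro hc'
        have := hmin (B \ A) ⟨hc', hBdc, by omega⟩
        omega
      omega
    have a3 : ¬ CycS S (B \ A) := by
      intro hc
      have hq' := hg _ hc
      have hlt : dd S A < dd S (B \ A) := by
        by_contra hle
        have := hmin (B \ A) ⟨hc, hBdc, by omega⟩
        omega
      have := not_cyc hS a2 hsne
      omega
    have b1 := not_cyc hS a1 hne
    have b2 := not_cyc hS a2 hsne
    have b3 := not_cyc hS a3 hsne'
    have par := dd_parity hS A
    by_cases hlt : dd S (A ∪ B) < dd S A
    · have := hcomp hlt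
      omega
    · omega
  by_cases hall : ∀ s ∈ S, ∃ x ∈ A, s * x ∈ A
  · have := closed_univ hS hA.nonempty (fun s hs => by
      obtain ⟨x, hx, hsx⟩ := hall s hs
      exact block_all_or_none hblk hx hsx)
    have h3 := hAc.nonempty
    simp [this] at h3
  · push Not at hall
    obtain ⟨s, hs, hsA⟩ := hall
    have h3 : bd s A = A.card := by
      unfold bd
      rw [Finset.filter_true_of_mem hsA]
    have h4 : bd s A ≤ dd S A := Finset.single_le_sum (f := fun s => bd s A) (fun _ _ => Nat.zero_le _) hs
    omega

/-- in-degree of `x` into `B` -/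
theorem indeg_add (S B : Finset Γ) (x : Γ) :
    (S.filter (fun s => s * x ∈ B)).card + (S.filter (fun s => s * x ∉ B)).card = S.card :=
  Finset.card_filter_add_card_filter_not _

/-- removing a vertex -/
theorem dd_erase {S : Finset Γ} (hS : Cub S) {B : Finset Γ} {x : Γ} (hx : x ∈ B) :
    dd S (B.erase x) + (S.filter (fun s => s * x ∉ B)).card
      = dd S B + (S.filter (fun s => s * x ∈ B)).card := by
  have key : ∀ s ∈ S, bd s (B.erase x) + (if s * x ∉ B then 1 else 0)
      = bd s B + (if s⁻¹ * x ∈ B then 1 else 0) := by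
    intro s hs
    have hs1 : s * x ≠ x := by
      intro h
      have : s = 1 := by simpa using h
      exact hS.one (this ▸ hs)
    have hs2 : s⁻¹ * x ≠ x := by
      intro h
      have : s = 1 := by simpa using h
      exact hS.one (this ▸ hs)
    have e1 : bd s (B.erase x) = (((B.erase x).filter (fun y => s * y ∉ B))).card
        + (if s⁻¹ * x ∈ B then 1 else 0) := by
      unfold bd
      have : (B.erase x).filter (fun y => s * y ∉ B.erase x)
        = (B.erase x).filter (fun y => s * y ∉ B) ∪ (if s⁻¹ * x ∈ B then {s⁻¹ * x} else ∅) := by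
        ext y
        have hy : s * y = x ↔ y = s⁻¹ * x := by
          constructor
          · rintro rfl; simp
          · rintro rfl; simp
        split_ifs with h
        · simp only [Finset.mem_filter, Finset.mem_erase, Finset.mem_union, Finset.mem_singleton]
          constructor
          · rintro ⟨⟨h1, h2⟩, h3⟩
            by_cases h4 : s * y = x
            · right; exact hy.1 h4
            · left; exact ⟨⟨h1, h2⟩, fun h5 => h3 ⟨h4, h5⟩⟩
          · rintro (⟨⟨h1, h2⟩, h3⟩ | rfl)
            · exact ⟨⟨h1, h2⟩, fun h5 => h3 h5.2⟩
            · exact ⟨⟨hs2, h⟩, fun h5 => h5.1 (by simp)⟩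
        · simp only [Finset.mem_filter, Finset.mem_erase, Finset.union_empty]
          constructor
          · rintro ⟨⟨h1, h2⟩, h3⟩
            refine ⟨⟨h1, h2⟩, fun h5 => h3 ⟨fun h6 => h ?_, h5⟩⟩
            rw [← hy.1 h6]; exact h2
          · rintro ⟨⟨h1, h2⟩, h3⟩
            exact ⟨⟨h1, h2⟩, fun h5 => h3 h5.2⟩
      rw [this, Finset.card_union_of_disjoint]
      · split_ifs <;> simp
      · split_ifs with h
        · simp [hx]
        · simp
    have e2 : bd s B = (((B.erase x).filter (fun y => s * y ∉ B))).card
        + (if s * x ∉ B then 1 else 0) := by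
      unfold bd
      conv_lhs => rw [← Finset.insert_erase hx]
      rw [Finset.filter_insert]
      rw [Finset.insert_erase hx]
      split_ifs with h
      · simp
      · rw [Finset.card_insert_of_notMem (by simp)]
    omega
  have h1 := Finset.sum_congr rfl key
  rw [Finset.sum_add_distrib, Finset.sum_add_distrib] at h1
  have h2 : ∑ s ∈ S, (if s⁻¹ * x ∈ B then 1 else 0) = (S.filter (fun s => s * x ∈ B)).card := by
    rw [Finset.card_filter]
    exact Finset.sum_nbij' (fun s => s⁻¹) (fun s => s⁻¹) hS.inv hS.inv (by simp) (by simp) (by simp)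
  rw [h2, ← Finset.card_filter] at h1
  exact h1

/-- a cyclic set contains a subset of min degree two -/
theorem CycS.core {S A : Finset Γ} (hS : Cub S) (h : CycS S A) :
    ∃ B ⊆ A, B.Nonempty ∧ ∀ x ∈ B, 2 ≤ (S.filter (fun s => s * x ∈ B)).card := by
  obtain ⟨B, ⟨hBA, hne, hd⟩, hmin⟩ := exists_lex_min
    (P := fun B => B ⊆ A ∧ B.Nonempty ∧ dd S B ≤ B.card) (fun _ => 0) h
  refine ⟨B, hBA, hne, fun x hx => ?_⟩
  by_contra hlt
  have h1 := indeg_add S B x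
  rw [hS.card] at h1
  have h2 := dd_erase hS hx
  have h3 := Finset.card_erase_of_mem hx
  have h4 := hne.card_pos
  by_cases he : (B.erase x).Nonempty
  · have := hmin (B.erase x) ⟨(Finset.erase_subset _ _).trans hBA, he, by omega⟩
    omega
  · rw [Finset.not_nonempty_iff_eq_empty] at he
    have h5 : dd S (B.erase x) = 0 := by rw [he]; simp [dd, bd]
    have h6 : B.card = 1 := by rw [he] at h3; simp at h3; omega
    have hin : (S.filter (fun s => s * x ∈ B)).card = 0 := by
      rw [Finset.card_eq_zero, Finset.filter_eq_empty_iff]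
      intro s hs hsx
      obtain ⟨y, hy⟩ := Finset.card_eq_one.1 h6
      rw [hy] at hx hsx
      simp at hx hsx
      subst hx
      have : s = 1 := by simpa using hsx
      exact hS.one (this ▸ hs)
    omega

/-- no nontrivial four-cycles -/
def No4 (S : Finset Γ) : Prop :=
  ∀ s₁ ∈ S, ∀ s₂ ∈ S, ∀ s₃ ∈ S, ∀ s₄ ∈ S, s₁ * s₂ = s₃ * s₄ → s₁ * s₂ ≠ 1 → s₂ = s₄

/-- no five-cycles : a path of length two and a path of length three between same ends -/
def No5 (S : Finset Γ) : Prop :=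
  ∀ s₁ ∈ S, ∀ s₂ ∈ S, ∀ s₃ ∈ S, ∀ s₄ ∈ S, ∀ s₅ ∈ S, s₁ * s₂ = s₃ * s₄ * s₅ → False

theorem two_nbrs {S B : Finset Γ} {x : Γ} (h : 2 ≤ (S.filter (fun s => s * x ∈ B)).card) :
    ∃ s ∈ S, ∃ t ∈ S, s ≠ t ∧ s * x ∈ B ∧ t * x ∈ B := by
  obtain ⟨s, hs, t, ht, hst⟩ := Finset.one_lt_card.1 h
  simp only [Finset.mem_filter] at hs ht
  exact ⟨s, hs.1, t, ht.1, hst, hs.2, ht.2⟩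

theorem other_nbr {S B : Finset Γ} {x : Γ} (h : 2 ≤ (S.filter (fun s => s * x ∈ B)).card) (u : Γ) :
    ∃ s ∈ S, s ≠ u ∧ s * x ∈ B := by
  obtain ⟨s, hs, t, ht, hst, h1, h2⟩ := two_nbrs h
  by_cases hu : s = u
  · exact ⟨t, ht, fun h => hst (hu.trans h.symm), h2⟩
  · exact ⟨s, hs, hu, h1⟩

theorem cyc_card4 {S : Finset Γ} (hS : Cub S) (ht : TriFree S) (A : Finset Γ) (h : CycS S A) :
    4 ≤ A.card := by
  obtain ⟨B, hBA, ⟨x, hx⟩, hB⟩ := h.core hS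
  obtain ⟨s, hs, t, ht', hst, h1, h2⟩ := two_nbrs (hB x hx)
  obtain ⟨u, hu, hus, h3⟩ := other_nbr (hB _ h1) s⁻¹
  have hsub : ({x, s * x, t * x, u * (s * x)} : Finset Γ) ⊆ B := by
    intro y hy
    simp at hy
    rcases hy with rfl | rfl | rfl | rfl <;> assumption
  have hne1 : ∀ s ∈ S, s ≠ 1 := fun s hs h => hS.one (h ▸ hs)
  have hc : ({x, s * x, t * x, u * (s * x)} : Finset Γ).card = 4 := by
    rw [Finset.card_insert_of_notMem, Finset.card_insert_of_notMem, Finset.card_pair]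
    · intro h
      rw [← mul_assoc] at h
      exact ht u hu s hs (by rw [← mul_right_cancel h]; exact ht')
    · simp only [Finset.mem_insert, Finset.mem_singleton, mul_left_inj, not_or]
      refine ⟨hst, fun h => hne1 u hu (by simpa using h)⟩
    · simp only [Finset.mem_insert, Finset.mem_singleton, not_or]
      refine ⟨fun h => hne1 s hs (by simpa using h), fun h => hne1 t ht' (by simpa using h), fun h => hus ?_⟩
      rw [← mul_assoc] at h
      exact eq_inv_of_mul_eq_one_left (by simpa using h.symm)
  calc 4 = _ := hc.symm
    _ ≤ B.card := Finset.card_le_card hsub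
    _ ≤ A.card := Finset.card_le_card hBA

theorem cyc_card6 {S : Finset Γ} (hS : Cub S) (ht : TriFree S) (h4 : No4 S) (h5 : No5 S)
    (A : Finset Γ) (h : CycS S A) : 6 ≤ A.card := by
  obtain ⟨B, hBA, ⟨x, hx⟩, hB⟩ := h.core hS
  obtain ⟨s, hs, t, ht', hst, h1, h2⟩ := two_nbrs (hB x hx)
  obtain ⟨u, hu, hus, h3⟩ := other_nbr (hB _ h1) s⁻¹
  obtain ⟨v, hv, hvt, h6⟩ := other_nbr (hB _ h2) t⁻¹
  obtain ⟨w, hw, hwu, h7⟩ := other_nbr (hB _ h3) u⁻¹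
  have hne1 : ∀ s ∈ S, s ≠ 1 := fun s hs h => hS.one (h ▸ hs)
  have hsub : ({x, s * x, t * x, u * (s * x), v * (t * x), w * (u * (s * x))} : Finset Γ) ⊆ B := by
    intro y hy
    simp at hy
    rcases hy with rfl | rfl | rfl | rfl | rfl | rfl <;> assumption
  have hus1 : u * s ≠ 1 := fun h => hus (eq_inv_of_mul_eq_one_left h)
  have hvt1 : v * t ≠ 1 := fun h => hvt (eq_inv_of_mul_eq_one_left h)
  have hwu1 : w * u ≠ 1 := fun h => hwu (eq_inv_of_mul_eq_one_left h)
  have c1 : ∀ p q : Γ, p * x = q * x → p = q := fun p q h => mul_right_cancel h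
  have d1 : u * s ≠ t := fun h => ht u hu s hs (h ▸ ht')
  have d2 : v * t ≠ s := fun h => ht v hv t ht' (h ▸ hs)
  have d3 : u * s ≠ v * t := fun h => hst (h4 u hu s hs v hv t ht' h hus1)
  have d4 : w * u * s ≠ v * t := fun h => h5 v hv t ht' w hw u hu s hs h.symm
  have d5 : w * u * s ≠ t := by
    intro h
    have : w * u = t * s⁻¹ := by rw [← h]; group
    have := h4 w hw u hu t ht' _ (hS.inv s hs) this hwu1
    exact hus this
  have d6 : w * u * s ≠ 1 := by
    intro h
    have : w * u = s⁻¹ := eq_inv_of_mul_eq_one_left h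
    exact ht w hw u hu (this ▸ hS.inv s hs)
  have hc : ({x, s * x, t * x, u * (s * x), v * (t * x), w * (u * (s * x))} : Finset Γ).card = 6 := by
    rw [Finset.card_insert_of_notMem, Finset.card_insert_of_notMem, Finset.card_insert_of_notMem,
      Finset.card_insert_of_notMem, Finset.card_pair]
    · simp only [← mul_assoc]
      exact fun h => d4 (c1 _ _ h).symm
    · simp only [← mul_assoc, Finset.mem_insert, Finset.mem_singleton, mul_left_inj, not_or]
      exact ⟨d3, fun h => hne1 w hw (by
        simpa using h)⟩
    · simp only [← mul_assoc, Finset.mem_insert, Finset.mem_singleton, mul_left_inj, not_or]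
      exact ⟨d1.symm, fun h => hne1 v hv (by simpa using h), d5.symm⟩
    · simp only [← mul_assoc, Finset.mem_insert, Finset.mem_singleton, mul_left_inj, not_or]
      exact ⟨hst, fun h => hne1 u hu (by simpa using h), d2.symm, fun h => hwu1 (by simpa using h)⟩
    · simp only [← mul_assoc, Finset.mem_insert, Finset.mem_singleton, mul_left_inj, not_or,
        right_eq_mul]
      exact ⟨hne1 s hs, hne1 t ht', hus1, hvt1, d6⟩
  calc 6 = _ := hc.symm
    _ ≤ B.card := Finset.card_le_card hsub
    _ ≤ A.card := Finset.card_le_card hBA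

/-- Lemma 3 -/
theorem lemma3 {S : Finset Γ} (hS : Cub S) (ht : TriFree S) (A : Finset Γ) (h : dd S A ≤ 3) :
    A = ∅ ∨ A.card + 2 ≤ dd S A ∨ Aᶜ = ∅ ∨ Aᶜ.card + 2 ≤ dd S A := by
  by_cases h1 : CycS S A
  · by_cases h2 : CycS S Aᶜ
    · have := cyc_cut (κ₀ := 3) (q := 4) hS (by norm_num) (by norm_num) (cyc_card4 hS ht) A h1 h2
      omega
    · rcases Finset.eq_empty_or_nonempty Aᶜ with h3 | h3
      · simp [h3]
      · have := not_cyc hS h2 h3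
        rw [dd_compl] at this
        simp [this]
  · rcases Finset.eq_empty_or_nonempty A with h3 | h3
    · simp [h3]
    · have := not_cyc hS h1 h3
      simp [this]
end CycPart

open SimpleGraph
set_option linter.unusedSectionVars false
set_option linter.unusedSimpArgs false
section BlockPart
open scoped Classical in
theorem in_even' {Γ : Type*} [Group Γ] [Fintype Γ] [DecidableEq Γ] {S : Finset Γ}
    (hinv : ∀ s ∈ S, s⁻¹ ∈ S) (hone : (1 : Γ) ∉ S) (A : Finset Γ) :
    Even (∑ s ∈ S, (A.filter (fun x => s * x ∈ A)).card) := by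
  have h0 : (∑ s ∈ S, (A.filter (fun x => s * x ∈ A)).card)
      = ((S ×ˢ A).filter (fun p => p.1 * p.2 ∈ A)).card := by
    rw [Finset.card_filter, Finset.sum_product]
    apply Finset.sum_congr rfl
    intro s _
    rw [Finset.card_filter]
  rw [h0, ← ZMod.natCast_eq_zero_iff_even, Finset.card_eq_sum_ones, Nat.cast_sum]
  refine Finset.sum_involution (fun p _ => (p.1⁻¹, p.1 * p.2)) ?_ ?_ ?_ ?_
  · intro p _
    decide
  · rintro ⟨s, x⟩ hp _ h
    simp only [Finset.mem_filter, Finset.mem_product] at hp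
    simp only [Prod.mk.injEq] at h
    have : s = 1 := by simpa using h.2
    exact hone (this ▸ hp.1.1)
  · rintro ⟨s, x⟩ hp
    simp only [Finset.mem_filter, Finset.mem_product] at hp ⊢
    exact ⟨⟨hinv _ hp.1.1, hp.2⟩, by simpa using hp.1.2⟩
  · rintro ⟨s, x⟩ _
    simp

variable {Γ : Type*} [Group Γ] [Fintype Γ] [DecidableEq Γ]

structure FreeBlk (S : Finset Γ) (K : Subgroup Γ) (c : Γ) (q : ℕ) : Prop where
  cS : c ∈ S
  c2 : c * c = 1
  card : Nat.card K = q
  q45 : q = 4 ∨ q = 5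
  gen : K = Subgroup.closure {s | s ∈ S ∧ s ≠ c}
  free : ∀ k ∈ K, c * k * c ∈ K → k = 1

/-- `K`-invariant sets -/
def KInv (K : Subgroup Γ) (A : Finset Γ) : Prop := ∀ k ∈ K, ∀ x ∈ A, k * x ∈ A

def blk (K : Subgroup Γ) (x : Γ) : Γ ⧸ K := (x⁻¹ : Γ)

theorem blk_eq {K : Subgroup Γ} {x y : Γ} : blk K x = blk K y ↔ x * y⁻¹ ∈ K := by
  unfold blk
  rw [QuotientGroup.eq]
  simp

theorem blk_mul {K : Subgroup Γ} {k x : Γ} (hk : k ∈ K) : blk K (k * x) = blk K x := by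
  rw [blk_eq]; simpa using hk

open scoped Classical in
noncomputable def fb (K : Subgroup Γ) (β : Γ ⧸ K) : Finset Γ := Finset.univ.filter (fun x => blk K x = β)

theorem mem_fb {K : Subgroup Γ} {β : Γ ⧸ K} {x : Γ} : x ∈ fb K β ↔ blk K x = β := by
  simp [fb]

theorem blk_surj {K : Subgroup Γ} (β : Γ ⧸ K) : ∃ x, blk K x = β := by
  obtain ⟨x, rfl⟩ := QuotientGroup.mk_surjective β
  exact ⟨x⁻¹, by simp [blk]⟩

theorem card_fb {K : Subgroup Γ} (β : Γ ⧸ K) : (fb K β).card = Nat.card K := by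
  classical
  obtain ⟨x, rfl⟩ := blk_surj β
  have h1 : fb K (blk K x) = (Finset.univ.filter (· ∈ K)).map (Equiv.mulRight x).toEmbedding := by
    ext y
    rw [mem_fb, blk_eq, Finset.mem_map_equiv]
    simp
  rw [h1, Finset.card_map, Nat.card_eq_fintype_card, Fintype.card_subtype]

theorem KInv.tr {K : Subgroup Γ} {A : Finset Γ} (h : KInv K A) (g : Γ) : KInv K (tr A g) := by
  intro k hk x hx
  rw [mem_tr] at *
  rw [mul_assoc]; exact h k hk _ hx

theorem KInv.compl {K : Subgroup Γ} {A : Finset Γ} (h : KInv K A) : KInv K Aᶜ := by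
  intro k hk x hx
  rw [Finset.mem_compl] at *
  intro h1
  exact hx (by simpa using h k⁻¹ (K.inv_mem hk) _ h1)

theorem KInv.inter {K : Subgroup Γ} {A B : Finset Γ} (h : KInv K A) (h' : KInv K B) :
    KInv K (A ∩ B) := by
  intro k hk x hx
  rw [Finset.mem_inter] at *
  exact ⟨h k hk x hx.1, h' k hk x hx.2⟩

theorem KInv.sdiff {K : Subgroup Γ} {A B : Finset Γ} (h : KInv K A) (h' : KInv K B) :
    KInv K (A \ B) := by
  rw [Finset.sdiff_eq_inter_compl]
  exact h.inter h'.compl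

theorem KInv.union {K : Subgroup Γ} {A B : Finset Γ} (h : KInv K A) (h' : KInv K B) :
    KInv K (A ∪ B) := by
  intro k hk x hx
  rw [Finset.mem_union] at *
  rcases hx with hx | hx
  · exact Or.inl (h k hk x hx)
  · exact Or.inr (h' k hk x hx)

theorem KInv.fb_sub {K : Subgroup Γ} {A : Finset Γ} (h : KInv K A) {x : Γ} (hx : x ∈ A) :
    fb K (blk K x) ⊆ A := by
  intro y hy
  rw [mem_fb, blk_eq] at hy
  simpa using h _ hy x hx

theorem KInv.eq_fb {K : Subgroup Γ} {A : Finset Γ} (h : KInv K A) (hne : A.Nonempty)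
    (hc : A.card ≤ Nat.card K) : ∃ β, A = fb K β := by
  obtain ⟨x, hx⟩ := hne
  exact ⟨blk K x, (Finset.eq_of_subset_of_card_le (h.fb_sub hx) (by rw [card_fb]; exact hc)).symm⟩

namespace FreeBlk
variable {S : Finset Γ} {K : Subgroup Γ} {c : Γ} {q : ℕ}

theorem sub (F : FreeBlk S K c q) {s : Γ} (hs : s ∈ S) (hsc : s ≠ c) : s ∈ K := by
  rw [F.gen]; exact Subgroup.subset_closure ⟨hs, hsc⟩

theorem cK (F : FreeBlk S K c q) (hS : Cub S) : c ∉ K := by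
  intro h
  have := F.free c h (by rw [F.c2]; simpa using h)
  exact hS.one (this ▸ F.cS)

theorem dd_inv (F : FreeBlk S K c q) {A : Finset Γ} (hA : KInv K A) : dd S A = bd c A := by
  unfold dd
  rw [Finset.sum_eq_single c]
  · intro s hs hsc
    unfold bd
    rw [Finset.card_eq_zero, Finset.filter_eq_empty_iff]
    intro x hx
    simpa using hA s (F.sub hs hsc) x hx
  · intro h; exact absurd F.cS h

theorem blk_c_ne (F : FreeBlk S K c q) (hS : Cub S) (x : Γ) : blk K (c * x) ≠ blk K x := by
  intro h
  rw [blk_eq] at h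
  exact F.cK hS (by simpa using h)

theorem c_inj (F : FreeBlk S K c q) {x y : Γ} (h1 : blk K x = blk K y)
    (h2 : blk K (c * x) = blk K (c * y)) : x = y := by
  rw [blk_eq] at h1 h2
  have hc : c⁻¹ = c := inv_eq_of_mul_eq_one_left F.c2
  have := F.free _ h1 (by
    have e : c * x * (c * y)⁻¹ = c * (x * y⁻¹) * c := by
      rw [mul_inv_rev, hc]; group
    rw [← e]; exact h2)
  exact mul_inv_eq_one.1 this

theorem dd_fb (F : FreeBlk S K c q) (hS : Cub S) {A : Finset Γ} (hA : KInv K A) (hne : A.Nonempty)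
    (hc : A.card ≤ q) : dd S A = q ∧ A.card = q := by
  obtain ⟨β, rfl⟩ := hA.eq_fb hne (by rw [F.card]; exact hc)
  rw [F.dd_inv hA, card_fb, F.card]
  refine ⟨?_, rfl⟩
  unfold bd
  rw [Finset.filter_true_of_mem, card_fb, F.card]
  intro x hx h
  rw [mem_fb] at hx h
  exact F.blk_c_ne hS x (h.trans hx.symm)

/-- few `c`-edges inside the union of two blocks -/
theorem two_blocks (F : FreeBlk S K c q) (hS : Cub S) {A : Finset Γ} {β γ : Γ ⧸ K}
    (hA : ∀ x ∈ A, blk K x = β ∨ blk K x = γ) : (A.filter (fun x => c * x ∈ A)).card ≤ 2 := by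
  classical
  calc (A.filter (fun x => c * x ∈ A)).card ≤ ({β, γ} : Finset (Γ ⧸ K)).card := by
        apply Finset.card_le_card_of_injOn (blk K)
        · intro x hx
          simp only [Finset.coe_filter, Set.mem_ofPred_eq] at hx
          simpa using hA x hx.1
        · intro x hx y hy hxy
          simp only [Finset.coe_filter, Set.mem_ofPred_eq] at hx hy
          have a1 := hA _ hx.1
          have a2 := hA _ hx.2
          have a3 := hA _ hy.1
          have a4 := hA _ hy.2
          have b1 := F.blk_c_ne hS x
          have b2 := F.blk_c_ne hS y
          apply F.c_inj hxy
          rcases a1 with a1 | a1 <;> rcases a2 with a2 | a2 <;> rcases a3 with a3 | a3 <;>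
            rcases a4 with a4 | a4 <;> simp_all
    _ ≤ 2 := Finset.card_le_two

theorem lemmaF (F : FreeBlk S K c q) (hS : Cub S) (A : Finset Γ) (hA : KInv K A)
    (hd : dd S A ≤ q) : A.card ≤ q ∨ Aᶜ.card ≤ q := by
  by_contra hcon
  push Not at hcon
  obtain ⟨A, ⟨hA, hd, hA1, hA2⟩, hmin⟩ :=
    exists_lex_min (P := fun A => KInv K A ∧ dd S A ≤ q ∧ q < A.card ∧ q < Aᶜ.card)
      (dd S) ⟨A, hA, hd, hcon⟩
  have hN := Finset.card_add_card_compl A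
  have hq := F.q45
  have hhalf : A.card ≤ Aᶜ.card := by
    have := hmin Aᶜ ⟨hA.compl, by rw [dd_compl]; exact hd, hA2, by simpa using hA1⟩
    rw [dd_compl] at this
    omega
  have hblk : ∀ g, (A ∩ _root_.tr A g).Nonempty → _root_.tr A g = A := by
    intro g hne
    by_contra hneq
    set B := _root_.tr A g with hB
    have hBK : KInv K B := hA.tr g
    have hcB : B.card = A.card := card_tr A g
    have hdB : dd S B = dd S A := dd_tr S A g
    have e1 := Finset.card_inter_add_card_sdiff A B
    have e2 := Finset.card_inter_add_card_sdiff B A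
    rw [Finset.inter_comm] at e2
    have e3 := Finset.card_union_add_card_inter A B
    have e4 := Finset.card_add_card_compl (A ∪ B)
    have e5 := Finset.card_add_card_compl (A ∩ B)
    have e6 := Finset.card_add_card_compl (A \ B)
    have e7 := Finset.card_add_card_compl (B \ A)
    have hpos : 0 < (A ∩ B).card := hne.card_pos
    have hsne : (A \ B).Nonempty := by
      rw [Finset.sdiff_nonempty]
      intro hsub
      exact hneq (Finset.eq_of_subset_of_card_le hsub hcB.le).symm
    have hspos := hsne.card_pos
    have sm := dd_submod S A B
    have pm := dd_posimod S A B
    have hune : ((A ∪ B)ᶜ).Nonempty := by rw [← Finset.card_pos]; omega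
    have a1 : (A ∩ B).card ≤ q := by
      by_contra hc
      have hlt : dd S A < dd S (A ∩ B) := by
        by_contra hle
        have := hmin (A ∩ B) ⟨hA.inter hBK, by omega, by omega, by omega⟩
        omega
      by_cases hu : (A ∪ B)ᶜ.card ≤ q
      · have := F.dd_fb hS (hA.union hBK).compl hune hu
        rw [dd_compl] at this
        omega
      · have := hmin (A ∪ B) ⟨hA.union hBK, by omega, by omega, by omega⟩
        omega
    have a2 : (A \ B).card ≤ q := by
      by_contra hc
      have hlt : dd S A < dd S (A \ B) := by
        by_contra hle
        have := hmin (A \ B) ⟨hA.sdiff hBK, by omega, by omega, by omega⟩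
        omega
      have := hmin (B \ A) ⟨hBK.sdiff hA, by omega, by omega, by omega⟩
      omega
    obtain ⟨β, hβ⟩ := (hA.inter hBK).eq_fb hne (by rw [F.card]; exact a1)
    obtain ⟨γ, hγ⟩ := (hA.sdiff hBK).eq_fb hsne (by rw [F.card]; exact a2)
    have h2 := F.two_blocks hS (A := A) (β := β) (γ := γ) (by
      intro x hx
      by_cases hxB : x ∈ B
      · left; rw [← mem_fb, ← hβ]; simp [hx, hxB]
      · right; rw [← mem_fb, ← hγ]; simp [hx, hxB])
    have h3 := bd_add c A
    have c1 := congrArg Finset.card hβ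
    have c2 := congrArg Finset.card hγ
    rw [card_fb, F.card] at c1 c2
    rw [F.dd_inv hA] at hd
    omega
  by_cases hall : ∃ x ∈ A, c * x ∈ A
  · have hne : A.Nonempty := by rw [← Finset.card_pos]; omega
    have := closed_univ hS hne (fun s hs => by
      by_cases hsc : s = c
      · subst hsc
        obtain ⟨x, hx, hsx⟩ := hall
        exact block_all_or_none hblk hx hsx
      · exact hA s (F.sub hs hsc))
    simp [this] at hA2
  · push Not at hall
    have h3 : bd c A = A.card := by
      unfold bd
      rw [Finset.filter_true_of_mem hall]
    rw [F.dd_inv hA] at hd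
    omega

/-- partial blocks contribute at least two in-block boundary arcs -/
theorem partial_two (F : FreeBlk S K c q) (hS : Cub S) {P : Finset Γ} {x y : Γ} (hx : x ∈ P)
    (hy : y ∉ P) (hxy : blk K x = blk K y) : 2 ≤ dd (S.erase c) P := by
  have hcinv : c⁻¹ = c := inv_eq_of_mul_eq_one_left F.c2
  have hinv : ∀ s ∈ S.erase c, s⁻¹ ∈ S.erase c := by
    intro s hs
    rw [Finset.mem_erase] at *
    refine ⟨fun h => hs.1 ?_, hS.inv s hs.2⟩
    rw [← hcinv, ← h, inv_inv]
  have h1 := in_even' hinv (fun h => hS.one (Finset.mem_of_mem_erase h)) P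
  have h2 := dd_add_in (S.erase c) P
  rw [Finset.card_erase_of_mem F.cS, hS.card] at h2
  have h3 : dd (S.erase c) P ≠ 0 := by
    intro h0
    have hcl : ∀ s ∈ S.erase c, ∀ x ∈ P, s * x ∈ P := by
      intro s hs x hx
      unfold dd at h0
      rw [Finset.sum_eq_zero_iff] at h0
      have := h0 s hs
      unfold bd at this
      rw [Finset.card_eq_zero, Finset.filter_eq_empty_iff] at this
      simpa using this hx
    have key : ∀ g ∈ K, ∀ x ∈ P, g * x ∈ P := by
      intro g hg
      rw [F.gen] at hg
      induction hg using Subgroup.closure_induction'' with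
      | one => intro x hx; simpa using hx
      | mem s hs => exact fun x hx => hcl s (Finset.mem_erase.2 ⟨hs.2, hs.1⟩) x hx
      | inv_mem s hs => exact fun x hx => hcl s⁻¹ (hinv s (Finset.mem_erase.2 ⟨hs.2, hs.1⟩)) x hx
      | mul u v _ _ hu hv => intro x hx; rw [mul_assoc]; exact hu _ (hv x hx)
    rw [eq_comm, blk_eq] at hxy
    have := key _ hxy x hx
    simp at this
    exact hy this
  obtain ⟨k, hk⟩ := h1
  omega

open scoped Classical in
noncomputable def parts (K : Subgroup Γ) (A : Finset Γ) : Finset (Γ ⧸ K) :=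
  Finset.univ.filter (fun β => (∃ x ∈ A, blk K x = β) ∧ ∃ y, y ∉ A ∧ blk K y = β)

theorem mem_parts {A : Finset Γ} {β : Γ ⧸ K} :
    β ∈ parts K A ↔ (∃ x ∈ A, blk K x = β) ∧ ∃ y, y ∉ A ∧ blk K y = β := by
  simp [parts]

theorem parts_compl (A : Finset Γ) : parts K Aᶜ = parts K A := by
  ext β
  rw [mem_parts, mem_parts]
  simp
  tauto

theorem parts_bound (F : FreeBlk S K c q) (hS : Cub S) (A : Finset Γ) :
    bd c A + 2 * (parts K A).card ≤ dd S A := by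
  classical
  have h1 : dd S A = bd c A + dd (S.erase c) A := by
    unfold dd
    rw [Finset.add_sum_erase S (fun s => bd s A) F.cS]
  have h2 : dd (S.erase c) A = ∑ β : Γ ⧸ K, dd (S.erase c) (A ∩ fb K β) := by
    unfold dd
    rw [Finset.sum_comm]
    apply Finset.sum_congr rfl
    intro s hs
    rw [Finset.mem_erase] at hs
    unfold bd
    rw [Finset.card_eq_sum_card_fiberwise (f := blk K) (t := Finset.univ) (by simp)]
    apply Finset.sum_congr rfl
    intro β _
    congr 1
    ext x
    simp only [Finset.mem_filter, Finset.mem_inter, mem_fb, blk_mul (F.sub hs.2 hs.1)]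
    tauto
  have h3 : ∑ β ∈ parts K A, dd (S.erase c) (A ∩ fb K β) ≤ ∑ β : Γ ⧸ K, dd (S.erase c) (A ∩ fb K β) :=
    Finset.sum_le_sum_of_subset (Finset.subset_univ _)
  have h4 : (parts K A).card * 2 ≤ ∑ β ∈ parts K A, dd (S.erase c) (A ∩ fb K β) := by
    rw [← smul_eq_mul]
    apply Finset.card_nsmul_le_sum
    intro β hβ
    obtain ⟨⟨x, hx, hxβ⟩, y, hy, hyβ⟩ := mem_parts.1 hβ
    exact F.partial_two hS (x := x) (y := y) (by simp [mem_fb, hx, hxβ]) (by simp [hy]) (hxβ.trans hyβ.symm)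
  omega

theorem bd_perturb (s : Γ) (A B : Finset Γ) : bd s B ≤ bd s A + (B \ A).card + (A \ B).card := by
  unfold bd
  have h : B.filter (fun x => s * x ∉ B) ⊆ A.filter (fun x => s * x ∉ A) ∪ (B \ A) ∪
      (A \ B).map (Equiv.mulLeft s⁻¹).toEmbedding := by
    intro x
    simp only [Finset.mem_filter, Finset.mem_union, Finset.mem_sdiff, Finset.mem_map_equiv]
    simp
    tauto
  calc _ ≤ _ := Finset.card_le_card h
    _ ≤ _ := (Finset.card_union_le _ _).trans (by
      rw [Finset.card_map]
      gcongr
      exact Finset.card_union_le _ _)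

theorem lemmaG_aux (F : FreeBlk S K c q) (hS : Cub S) {A A' : Finset Γ} (hd : dd S A = 5)
    (hc : bd c A = 1 ∨ bd c A = 3) (hA' : KInv K A') (hcard : A'.card ≤ q)
    (hsm : ∀ β ∈ parts K A, ((A \ A') ∩ fb K β).card + ((A' \ A) ∩ fb K β).card ≤ 2)
    (heq : ∀ β, β ∉ parts K A → (A \ A') ∩ fb K β = ∅ ∧ (A' \ A) ∩ fb K β = ∅) : A.card ≤ 5 := by
  classical
  have hpb := F.parts_bound hS A
  have par := dd_parity hS A
  have hq := F.q45
  have hAA : (A \ A').card ≤ 2 * (parts K A).card := by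
    rw [Finset.card_eq_sum_card_fiberwise (f := blk K) (t := parts K A)]
    · rw [mul_comm, ← smul_eq_mul]
      apply Finset.sum_le_card_nsmul
      intro β hβ
      have h1 := hsm β hβ
      have h2 : (A \ A').filter (fun x => blk K x = β) = (A \ A') ∩ fb K β := by
        ext x; simp [mem_fb]
      rw [h2]; omega
    · intro x hx
      by_contra h
      have := (heq _ h).1
      have h3 : x ∈ (A \ A') ∩ fb K (blk K x) := Finset.mem_inter.2 ⟨hx, mem_fb.2 rfl⟩
      rw [this] at h3
      simp at h3
  rcases Finset.eq_empty_or_nonempty A' with he | hne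
  · rw [he] at hAA
    simp at hAA
    omega
  obtain ⟨β, hβ⟩ := hA'.eq_fb hne (by rw [F.card]; exact hcard)
  have hfb : (fb K β).card = q := by rw [card_fb, F.card]
  -- vertices outside
  have hout : (A \ A').card ≤ 2 * ((parts K A).erase β).card := by
    rw [Finset.card_eq_sum_card_fiberwise (f := blk K) (t := (parts K A).erase β)]
    · rw [mul_comm, ← smul_eq_mul]
      apply Finset.sum_le_card_nsmul
      intro γ hγ
      have h1 := hsm γ (Finset.mem_of_mem_erase hγ)
      have h2 : (A \ A').filter (fun x => blk K x = γ) = (A \ A') ∩ fb K γ := by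
        ext x; simp [mem_fb]
      rw [h2]; omega
    · intro x hx
      rw [Finset.mem_coe, Finset.mem_erase]
      have hx' := hx
      rw [Finset.mem_coe, Finset.mem_sdiff, hβ, mem_fb] at hx'
      refine ⟨hx'.2, ?_⟩
      by_contra h
      have := (heq _ h).1
      have h3 : x ∈ (A \ A') ∩ fb K (blk K x) := Finset.mem_inter.2 ⟨hx, mem_fb.2 rfl⟩
      rw [this] at h3
      simp at h3
  have hin : ((A ∩ A').filter (fun x => c * x ∈ A)).card ≤ ((parts K A).erase β).card := by
    apply Finset.card_le_card_of_injOn (fun x => blk K (c * x))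
    · intro x hx
      rw [Finset.mem_coe, Finset.mem_filter, Finset.mem_inter, hβ, mem_fb] at hx
      rw [Finset.mem_coe, Finset.mem_erase]
      have hne' : blk K (c * x) ≠ β := by
        rw [← hx.1.2]; exact F.blk_c_ne hS x
      refine ⟨hne', ?_⟩
      by_contra h
      have := (heq _ h).1
      have h3 : c * x ∈ (A \ A') ∩ fb K (blk K (c * x)) := by
        rw [Finset.mem_inter, Finset.mem_sdiff, hβ, mem_fb, mem_fb]
        exact ⟨⟨hx.2, hne'⟩, rfl⟩
      rw [this] at h3
      simp at h3
    · intro x hx y hy hxy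
      rw [Finset.mem_coe, Finset.mem_filter, Finset.mem_inter, hβ, mem_fb] at hx hy
      exact F.c_inj (hx.1.2.trans hy.1.2.symm) hxy
  have hbd : (A ∩ A').card ≤ bd c A + ((A ∩ A').filter (fun x => c * x ∈ A)).card := by
    have h1 : (A ∩ A').card = ((A ∩ A').filter (fun x => c * x ∈ A)).card
        + ((A ∩ A').filter (fun x => c * x ∉ A)).card :=
      (Finset.card_filter_add_card_filter_not _).symm
    have h2 : ((A ∩ A').filter (fun x => c * x ∉ A)).card ≤ bd c A := by
      unfold bd
      apply Finset.card_le_card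
      intro x
      simp only [Finset.mem_filter, Finset.mem_inter]
      tauto
    omega
  have hsplit := Finset.card_inter_add_card_sdiff A A'
  have hinter_card : (A ∩ A').card + (A' \ A).card = q := by
    rw [Finset.inter_comm, Finset.card_inter_add_card_sdiff, hβ, hfb]
  by_cases hβP : β ∈ parts K A
  · have he := Finset.card_erase_of_mem hβP
    omega
  · have he := Finset.erase_eq_of_notMem hβP
    rw [he] at hin hout
    have h3 := (heq β hβP).2
    rw [← hβ] at h3
    have h4 : (A' \ A).card = 0 := by
      rw [Finset.card_eq_zero, ← h3]
      ext x; simp; tauto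
    omega

theorem lemmaG (F : FreeBlk S K c q) (hS : Cub S) {A : Finset Γ} (hd : dd S A = 5)
    (hc : bd c A = 1 ∨ bd c A = 3) : A.card ≤ 5 ∨ Aᶜ.card ≤ 5 := by
  classical
  have hpb := F.parts_bound hS A
  have hq := F.q45
  let A' : Finset Γ := Finset.univ.filter (fun x => q < 2 * (A ∩ fb K (blk K x)).card)
  have hA' : KInv K A' := by
    intro k hk x hx
    simp only [A', Finset.mem_filter, Finset.mem_univ, true_and, blk_mul hk] at *
    exact hx
  have hfib : ∀ β : Γ ⧸ K, ((A \ A') ∩ fb K β).card + ((A' \ A) ∩ fb K β).card ≤ 2 ∧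
      (β ∉ parts K A → (A \ A') ∩ fb K β = ∅ ∧ (A' \ A) ∩ fb K β = ∅) := by
    intro β
    have hfb : (fb K β).card = q := by rw [card_fb, F.card]
    have hsp := Finset.card_inter_add_card_sdiff (fb K β) A
    rw [Finset.inter_comm] at hsp
    by_cases hb : q < 2 * (A ∩ fb K β).card
    · have e1 : (A \ A') ∩ fb K β = ∅ := by
        ext x
        simp only [A', Finset.mem_inter, Finset.mem_sdiff, Finset.mem_filter, Finset.mem_univ,
          true_and, mem_fb, Finset.notMem_empty, iff_false]
        rintro ⟨⟨_, h1⟩, rfl⟩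
        exact h1 hb
      have e2 : (A' \ A) ∩ fb K β = fb K β \ A := by
        ext x
        simp only [A', Finset.mem_inter, Finset.mem_sdiff, Finset.mem_filter, Finset.mem_univ,
          true_and, mem_fb]
        constructor
        · rintro ⟨⟨_, h1⟩, rfl⟩
          exact ⟨rfl, h1⟩
        · rintro ⟨rfl, h1⟩
          exact ⟨⟨hb, h1⟩, rfl⟩
      rw [e1, e2]
      refine ⟨by simp; omega, fun hβ => ⟨rfl, ?_⟩⟩
      rw [mem_parts] at hβ
      push Not at hβ
      have hpos : 0 < (A ∩ fb K β).card := by omega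
      obtain ⟨x, hx⟩ := Finset.card_pos.1 hpos
      rw [Finset.mem_inter, mem_fb] at hx
      rw [Finset.sdiff_eq_empty_iff_subset]
      intro y hy
      by_contra hyA
      exact hβ ⟨x, hx.1, hx.2⟩ y hyA (mem_fb.1 hy)
    · have e1 : (A' \ A) ∩ fb K β = ∅ := by
        ext x
        simp only [A', Finset.mem_inter, Finset.mem_sdiff, Finset.mem_filter, Finset.mem_univ,
          true_and, mem_fb, Finset.notMem_empty, iff_false]
        rintro ⟨⟨h1, _⟩, rfl⟩
        exact hb h1
      have e2 : (A \ A') ∩ fb K β = A ∩ fb K β := by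
        ext x
        simp only [A', Finset.mem_inter, Finset.mem_sdiff, Finset.mem_filter, Finset.mem_univ,
          true_and, mem_fb]
        constructor
        · rintro ⟨⟨h1, _⟩, rfl⟩
          exact ⟨h1, rfl⟩
        · rintro ⟨h1, rfl⟩
          exact ⟨⟨h1, hb⟩, rfl⟩
      rw [e1, e2]
      refine ⟨by simp; omega, fun hβ => ⟨?_, rfl⟩⟩
      rw [mem_parts] at hβ
      push Not at hβ
      have hpos : 0 < (fb K β \ A).card := by omega
      obtain ⟨y, hy⟩ := Finset.card_pos.1 hpos
      rw [Finset.mem_sdiff, mem_fb] at hy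
      rw [← Finset.not_nonempty_iff_eq_empty]
      rintro ⟨x, hx⟩
      rw [Finset.mem_inter, mem_fb] at hx
      exact hβ ⟨x, hx.1, hx.2⟩ y hy.2 hy.1
  have hsym : (A \ A').card + (A' \ A).card ≤ 2 * (parts K A).card := by
    rw [Finset.card_eq_sum_card_fiberwise (f := blk K) (s := A \ A') (t := Finset.univ) (by simp),
      Finset.card_eq_sum_card_fiberwise (f := blk K) (s := A' \ A) (t := Finset.univ) (by simp),
      ← Finset.sum_add_distrib]
    have e : ∀ β, ((A \ A').filter (fun x => blk K x = β)).card
        + ((A' \ A).filter (fun x => blk K x = β)).card ≤ if β ∈ parts K A then 2 else 0 := by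
      intro β
      have h1 : (A \ A').filter (fun x => blk K x = β) = (A \ A') ∩ fb K β := by
        ext x; simp [mem_fb]
      have h2 : (A' \ A).filter (fun x => blk K x = β) = (A' \ A) ∩ fb K β := by
        ext x; simp [mem_fb]
      rw [h1, h2]
      split_ifs with h
      · exact (hfib β).1
      · rw [((hfib β).2 h).1, ((hfib β).2 h).2]; simp
    calc _ ≤ ∑ β, if β ∈ parts K A then 2 else 0 := Finset.sum_le_sum fun β _ => e β
      _ = _ := by rw [Finset.sum_ite_mem]; simp [mul_comm]
  have hper := bd_perturb c A A'
  have hdd := F.dd_inv hA'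
  have hA'd : A'.card % q = 0 := by
    rw [Finset.card_eq_sum_card_fiberwise (f := blk K) (t := Finset.univ) (by simp),
      Finset.sum_nat_mod]
    rw [Finset.sum_eq_zero]
    · simp
    · intro β _
      by_cases hb : q < 2 * (A ∩ fb K β).card
      · have : A'.filter (fun x => blk K x = β) = fb K β := by
          ext x
          simp only [A', Finset.mem_filter, Finset.mem_univ, true_and, mem_fb]
          constructor
          · rintro ⟨_, h⟩; exact h
          · rintro rfl; exact ⟨hb, rfl⟩
        rw [this, card_fb, F.card]; simp
      · have : A'.filter (fun x => blk K x = β) = ∅ := by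
          ext x
          simp only [A', Finset.mem_filter, Finset.mem_univ, true_and, Finset.notMem_empty, iff_false]
          rintro ⟨h, rfl⟩; exact hb h
        rw [this]; simp
  have par := dd_parity hS A'
  have hle : dd S A' ≤ q := by
    rcases hq with rfl | rfl
    · have : A'.card % 2 = 0 := by omega
      omega
    · omega
  rcases F.lemmaF hS A' hA' hle with h | h
  · left
    exact F.lemmaG_aux hS hd hc hA' h (fun β _ => (hfib β).1) (fun β hβ => (hfib β).2 hβ)
  · right
    have s1 : Aᶜ \ A'ᶜ = A' \ A := by ext x; simp; tauto
    have s2 : A'ᶜ \ Aᶜ = A \ A' := by ext x; simp; tauto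
    refine F.lemmaG_aux (A' := A'ᶜ) hS (by rw [dd_compl]; exact hd) (by rw [bd_compl]; exact hc) hA'.compl h
      (fun β _ => ?_) (fun β hβ => ?_)
    · rw [s1, s2, add_comm]; exact (hfib β).1
    · rw [s1, s2]
      rw [parts_compl] at hβ
      exact ((hfib β).2 hβ).symm
end FreeBlk
end BlockPart

open SimpleGraph
set_option linter.unusedSectionVars false
set_option linter.unusedSimpArgs false
section CasePart
variable {Γ : Type*} [Group Γ] [Fintype Γ] [DecidableEq Γ]

/-- near-bipartite obstruction -/
def CaseB (S : Finset Γ) : Prop :=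
  ∃ Y : Finset Γ, (∀ y ∈ Y, ∀ s ∈ S, s * y ∉ Y) ∧ Fintype.card Γ = 2 * Y.card + 2

structure CaseA (S X Y C : Finset Γ) : Prop where
  xy : Disjoint X Y
  xc : Disjoint X C
  yc : Disjoint Y C
  cover : ∀ x, x ∈ X ∨ x ∈ Y ∨ x ∈ C
  nb : ∀ y ∈ Y, ∀ s ∈ S, s * y ∈ X
  card : X.card = Y.card + 3
  ddC : dd S C = 5

/-- two disjoint edges in `X` -/
def TwoEdges (S X : Finset Γ) : Prop :=
  ∃ p r s t : Γ, s ∈ S ∧ t ∈ S ∧ p ∈ X ∧ s * p ∈ X ∧ r ∈ X ∧ t * r ∈ X ∧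
    p ≠ r ∧ p ≠ t * r ∧ s * p ≠ r ∧ s * p ≠ t * r

theorem Cub.ne_one {S : Finset Γ} (hS : Cub S) {s : Γ} (hs : s ∈ S) : s ≠ 1 :=
  fun h => hS.one (h ▸ hs)

theorem TwoEdges.card {S X : Finset Γ} (hS : Cub S) (h : TwoEdges S X) :
    4 ≤ X.card ∧ 4 ≤ ∑ s ∈ S, (X.filter (fun x => s * x ∈ X)).card := by
  obtain ⟨p, r, s, t, hs, ht, h1, h2, h3, h4, n1, n2, n3, n4⟩ := h
  have hsp : p ≠ s * p := fun h => hS.ne_one hs (by simpa using h)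
  have htr : r ≠ t * r := fun h => hS.ne_one ht (by simpa using h)
  have hc : ({p, s * p, r, t * r} : Finset Γ).card = 4 := by
    rw [Finset.card_insert_of_notMem, Finset.card_insert_of_notMem, Finset.card_pair htr]
    · simp [n3, n4]
    · simp only [Finset.mem_insert, Finset.mem_singleton, not_or]
      exact ⟨hsp, n1, n2⟩
  have hsub : ({p, s * p, r, t * r} : Finset Γ) ⊆ X := by
    intro y hy
    simp at hy
    rcases hy with rfl | rfl | rfl | rfl <;> assumption
  refine ⟨hc ▸ Finset.card_le_card hsub, ?_⟩
  have e : (∑ s ∈ S, (X.filter (fun x => s * x ∈ X)).card)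
      = ∑ x ∈ X, (S.filter (fun s => s * x ∈ X)).card := by
    simp only [Finset.card_filter]
    exact Finset.sum_comm
  rw [e]
  calc 4 = ∑ x ∈ ({p, s * p, r, t * r} : Finset Γ), 1 := by simp [hc]
    _ ≤ ∑ x ∈ ({p, s * p, r, t * r} : Finset Γ), (S.filter (fun s => s * x ∈ X)).card := by
        apply Finset.sum_le_sum
        intro x hx
        rw [Nat.one_le_iff_ne_zero, ← Nat.pos_iff_ne_zero, Finset.card_pos]
        simp at hx
        rcases hx with rfl | rfl | rfl | rfl
        · exact ⟨s, by simp [hs, h2]⟩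
        · exact ⟨s⁻¹, by simp [hS.inv s hs, h1]⟩
        · exact ⟨t, by simp [ht, h4]⟩
        · exact ⟨t⁻¹, by simp [hS.inv t ht, h3]⟩
    _ ≤ _ := Finset.sum_le_sum_of_subset hsub

theorem tutte_cases {S X : Finset Γ} (hS : Cub S) (ht : TriFree S) (heven : Even (Fintype.card Γ))
    (hX : TwoEdges S X) (𝒦 : Finset (Finset Γ))
    (hdis : ∀ A ∈ 𝒦, ∀ B ∈ 𝒦, A ≠ B → Disjoint A B) (hodd : ∀ A ∈ 𝒦, Odd A.card)
    (hAX : ∀ A ∈ 𝒦, Disjoint A X) (hcl : ∀ A ∈ 𝒦, ∀ x ∈ A, ∀ s ∈ S, s * x ∈ A ∨ s * x ∈ X)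
    (hcard : X.card ≤ 𝒦.card + 2) : CaseB S ∨ ∃ Y C, CaseA S X Y C := by
  obtain ⟨hX4, hXin⟩ := hX.card hS
  have hXd := dd_add_in S X
  rw [hS.card] at hXd
  set U := 𝒦.biUnion id with hU
  have hpd : (𝒦 : Set (Finset Γ)).PairwiseDisjoint id := fun A hA B hB h => hdis A hA B hB h
  have hUX : Disjoint U X := by
    rw [hU, Finset.disjoint_biUnion_left]
    exact hAX
  set R := Xᶜ \ U with hR
  have harcs : ∑ x ∈ Xᶜ, (S.filter (fun s => s * x ∈ X)).card = dd S X := by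
    rw [← dd_compl, dd_eq_sum]
    simp
  have hUsub : U ⊆ Xᶜ := by
    intro x hx
    rw [Finset.mem_compl]
    exact Finset.disjoint_left.1 hUX hx
  have hsplit : ∑ x ∈ R, (S.filter (fun s => s * x ∈ X)).card
      + ∑ x ∈ U, (S.filter (fun s => s * x ∈ X)).card = dd S X := by
    rw [← harcs, hR, Finset.sum_sdiff hUsub]
  have hddA : ∀ A ∈ 𝒦, ∑ x ∈ A, (S.filter (fun s => s * x ∈ X)).card = dd S A := by
    intro A hA
    rw [dd_eq_sum]
    apply Finset.sum_congr rfl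
    intro x hx
    congr 1
    apply Finset.filter_congr
    intro s hs
    constructor
    · intro h h'
      exact Finset.disjoint_left.1 (hAX A hA) h' h
    · intro h
      exact (hcl A hA x hx s hs).resolve_left h
  have hddU : ∑ x ∈ U, (S.filter (fun s => s * x ∈ X)).card = ∑ A ∈ 𝒦, dd S A := by
    rw [hU, Finset.sum_biUnion hpd]
    exact Finset.sum_congr rfl hddA
  have hddR : ∑ x ∈ R, (S.filter (fun s => s * x ∈ X)).card = dd S R := by
    rw [dd_eq_sum]
    apply Finset.sum_congr rfl
    intro x hx
    congr 1
    apply Finset.filter_congr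
    intro s hs
    simp only [hR, Finset.mem_sdiff, Finset.mem_compl] at hx ⊢
    constructor
    · intro h h'
      exact h'.1 h
    · intro h
      by_contra hn
      apply h
      refine ⟨hn, fun hm => ?_⟩
      rw [hU, Finset.mem_biUnion] at hm
      obtain ⟨A, hA, hm⟩ := hm
      have := hcl A hA _ hm s⁻¹ (hS.inv s hs)
      simp at this
      rcases this with h1 | h1
      · exact hx.2 (by rw [hU, Finset.mem_biUnion]; exact ⟨A, hA, h1⟩)
      · exact hx.1 h1
  have hbig : ∀ A : Finset Γ, Disjoint A X → 4 ≤ Aᶜ.card := by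
    intro A hA
    refine hX4.trans (Finset.card_le_card ?_)
    intro x hx
    rw [Finset.mem_compl]
    exact Finset.disjoint_right.1 hA hx
  have hlow : ∀ A ∈ 𝒦, 3 + (if A.card ≠ 1 then 2 else 0) ≤ dd S A := by
    intro A hA
    have hodd' := hodd A hA
    rw [Nat.odd_iff] at hodd'
    have par := dd_parity hS A
    have hb := hbig A (hAX A hA)
    by_cases h3 : dd S A ≤ 3
    · rcases lemma3 hS ht A h3 with h | h | h | h
      · rw [h] at hodd'; simp at hodd'
      · have : A.card = 1 := by omega
        simp [this]; omega
      · rw [h] at hb; simp at hb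
      · omega
    · split_ifs <;> omega
  set Bg := 𝒦.filter (fun A => A.card ≠ 1) with hBg
  have hsum : 3 * 𝒦.card + 2 * Bg.card ≤ ∑ A ∈ 𝒦, dd S A := by
    refine le_trans (le_of_eq ?_) (Finset.sum_le_sum hlow)
    rw [Finset.sum_add_distrib, ← Finset.sum_filter]
    simp [mul_comm, hBg]
  have hUcard : U.card = ∑ A ∈ 𝒦, A.card := by
    rw [hU, Finset.card_biUnion (t := id) hdis]
    rfl
  have hUpar : U.card % 2 = 𝒦.card % 2 := by
    rw [hUcard, Finset.sum_nat_mod, Finset.sum_congr rfl (fun A hA => Nat.odd_iff.1 (hodd A hA))]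
    simp
  have hRc : R.card + U.card = Xᶜ.card := by
    rw [hR, Finset.card_sdiff_add_card_eq_card hUsub]
  have hXc := Finset.card_add_card_compl X
  have hRpar := dd_parity hS R
  rw [Nat.even_iff] at heven
  have hRX : Disjoint R X := by
    rw [Finset.disjoint_left]
    intro x hx
    simp only [hR, Finset.mem_sdiff, Finset.mem_compl] at hx
    exact hx.1
  have hkc : 𝒦.card + 2 = X.card := by omega
  have hBg1 : Bg.card ≤ 1 := by omega
  have hR0 : R = ∅ := by
    have hb := hbig R hRX
    rcases lemma3 hS ht R (by omega) with h | h | h | h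
    · exact h
    · have : R.card = 0 := by omega
      exact Finset.card_eq_zero.1 this
    · rw [h] at hb; simp at hb
    · omega
  have hXU : ∀ x, x ∈ X ∨ x ∈ U := by
    intro x
    by_contra h
    push Not at h
    have : x ∈ R := by simp [hR, h]
    rw [hR0] at this
    simp at this
  have hsing : ∀ A ∈ 𝒦, A.card = 1 → ∀ y ∈ A, ∀ s ∈ S, s * y ∈ X := by
    intro A hA h1 y hy s hs
    obtain ⟨z, rfl⟩ := Finset.card_eq_one.1 h1
    rcases hcl _ hA y hy s hs with h | h
    · simp at h hy
      subst hy
      exact absurd (by simpa using h) (hS.ne_one hs)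
    · exact h
  rcases Nat.le_one_iff_eq_zero_or_eq_one.1 hBg1 with h0 | h1
  · left
    have hall : ∀ A ∈ 𝒦, A.card = 1 := by
      intro A hA
      by_contra h
      have : A ∈ Bg := by simp [hBg, hA, h]
      rw [Finset.card_eq_zero.1 h0] at this
      simp at this
    refine ⟨U, ?_, ?_⟩
    · intro y hy s hs hsy
      rw [hU, Finset.mem_biUnion] at hy
      obtain ⟨A, hA, hy⟩ := hy
      exact Finset.disjoint_left.1 hUX hsy (hsing A hA (hall A hA) y hy s hs)
    · have : U.card = 𝒦.card := by
        rw [hUcard, Finset.sum_congr rfl hall]; simp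
      rw [hR0] at hRc
      simp at hRc
      omega
  · right
    obtain ⟨C, hC⟩ := Finset.card_eq_one.1 h1
    have hCm : C ∈ Bg := by rw [hC]; simp
    simp only [hBg, Finset.mem_filter] at hCm
    have hall : ∀ A ∈ 𝒦.erase C, A.card = 1 := by
      intro A hA
      rw [Finset.mem_erase] at hA
      by_contra h
      have : A ∈ Bg := by simp [hBg, hA.2, h]
      rw [hC] at this
      simp at this
      exact hA.1 this
    set Y := (𝒦.erase C).biUnion id with hY
    have hYc : Y.card + 1 = 𝒦.card := by
      rw [hY, Finset.card_biUnion (t := id) (fun A hA B hB h => hdis A (Finset.mem_of_mem_erase hA) B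
        (Finset.mem_of_mem_erase hB) h)]
      rw [Finset.sum_congr rfl (fun A hA => (hall A hA : (id A).card = 1))]
      have := Finset.card_erase_of_mem hCm.1
      have : 0 < 𝒦.card := Finset.card_pos.2 ⟨C, hCm.1⟩
      simp
      omega
    refine ⟨Y, C, ?_, (hAX C hCm.1).symm, ?_, ?_, ?_, by omega, ?_⟩
    · rw [hY, Finset.disjoint_biUnion_right]
      intro A hA
      exact (hAX A (Finset.mem_of_mem_erase hA)).symm
    · rw [hY, Finset.disjoint_biUnion_left]
      intro A hA
      rw [Finset.mem_erase] at hA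
      exact hdis A hA.2 C hCm.1 hA.1
    · intro x
      rcases hXU x with h | h
      · exact Or.inl h
      · right
        rw [hU, Finset.mem_biUnion] at h
        obtain ⟨A, hA, hx⟩ := h
        by_cases hAC : A = C
        · subst hAC; exact Or.inr hx
        · left
          rw [hY, Finset.mem_biUnion]
          exact ⟨A, Finset.mem_erase.2 ⟨hAC, hA⟩, hx⟩
    · intro y hy s hs
      rw [hY, Finset.mem_biUnion] at hy
      obtain ⟨A, hA, hy⟩ := hy
      exact hsing A (Finset.mem_of_mem_erase hA) (hall A hA) y hy s hs
    · have h5 := hlow C hCm.1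
      rw [if_pos hCm.2] at h5
      rw [← Finset.add_sum_erase _ _ hCm.1] at hddU
      have h3 : (𝒦.erase C).card * 3 ≤ ∑ A ∈ 𝒦.erase C, dd S A := by
        rw [← smul_eq_mul]
        apply Finset.card_nsmul_le_sum
        intro A hA
        have := hlow A (Finset.mem_of_mem_erase hA)
        omega
      rw [Finset.card_erase_of_mem hCm.1] at h3
      omega

theorem card_left_preimage (s : Γ) (A : Finset Γ) :
    (Finset.univ.filter (fun x => s * x ∈ A)).card = A.card := by
  have : Finset.univ.filter (fun x => s * x ∈ A) = A.map (Equiv.mulLeft s⁻¹).toEmbedding := by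
    ext x
    simp [Finset.mem_map_equiv]
  rw [this, Finset.card_map]

namespace CaseA
variable {S X Y C : Finset Γ}

theorem bd_le (h : CaseA S X Y C) (hS : Cub S) {s : Γ} (hs : s ∈ S) : bd s C ≤ 3 := by
  have h1 := card_left_preimage s X
  have h2 : Y ∪ C.filter (fun x => s * x ∉ C) ⊆ Finset.univ.filter (fun x => s * x ∈ X) := by
    intro x hx
    simp only [Finset.mem_union, Finset.mem_filter, Finset.mem_univ, true_and] at hx ⊢
    rcases hx with hx | hx
    · exact h.nb x hx s hs
    · rcases h.cover (s * x) with h3 | h3 | h3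
      · exact h3
      · have := h.nb _ h3 s⁻¹ (hS.inv s hs)
        simp at this
        exact absurd hx.1 (Finset.disjoint_left.1 h.xc this)
      · exact absurd h3 hx.2
  have h3 := Finset.card_le_card h2
  rw [Finset.card_union_of_disjoint] at h3
  · have := h.card
    unfold bd
    omega
  · exact h.yc.mono_right (Finset.filter_subset _ _)

theorem bd_inv (h : CaseA S X Y C) (hS : Cub S) {c : Γ} (hc : c ∈ S) (hc2 : c * c = 1) :
    bd c C = 1 ∨ bd c C = 3 := by
  have h1 := h.bd_le hS hc
  have hcinv : c⁻¹ = c := inv_eq_of_mul_eq_one_left hc2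
  have h2 := in_even' (S := {c}) (by simp [hcinv]) (by simpa using (hS.ne_one hc).symm) C
  rw [Finset.sum_singleton, Nat.even_iff] at h2
  have h3 := bd_add c C
  have h4 := dd_parity hS C
  rw [h.ddC] at h4
  omega

theorem card_eq (h : CaseA S X Y C) : X.card + Y.card + C.card = Fintype.card Γ := by
  have hu : X ∪ Y ∪ C = Finset.univ := by
    ext x
    have := h.cover x
    simp
    tauto
  rw [← Finset.card_univ, ← hu, Finset.card_union_of_disjoint, Finset.card_union_of_disjoint h.xy]
  rw [Finset.disjoint_union_left]
  exact ⟨h.xc, h.yc⟩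

theorem compl_big (h : CaseA S X Y C) (hS : Cub S) (ht : TriFree S) (hX : TwoEdges S X) :
    7 ≤ Cᶜ.card := by
  have h1 := h.card_eq
  have h2 := Finset.card_add_card_compl C
  have h3 := h.card
  have h4 := (hX.card hS).1
  by_contra hlt
  have hY1 : Y.card = 1 := by omega
  obtain ⟨y, hy⟩ := Finset.card_eq_one.1 hY1
  have hyY : y ∈ Y := by rw [hy]; simp
  obtain ⟨p, r, s, t, hs, ht', g1, g2, g3, g4, n1, n2, n3, n4⟩ := hX
  have hsp : p ≠ s * p := fun h => hS.ne_one hs (by simpa using h)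
  have htr : r ≠ t * r := fun h => hS.ne_one ht' (by simpa using h)
  have hc : ({p, s * p, r, t * r} : Finset Γ).card = 4 := by
    rw [Finset.card_insert_of_notMem, Finset.card_insert_of_notMem, Finset.card_pair htr]
    · simp [n3, n4]
    · simp only [Finset.mem_insert, Finset.mem_singleton, not_or]
      exact ⟨hsp, n1, n2⟩
  have hsub : ({p, s * p, r, t * r} : Finset Γ) ⊆ X := by
    intro y hy
    simp at hy
    rcases hy with rfl | rfl | rfl | rfl <;> assumption
  have hXe : ({p, s * p, r, t * r} : Finset Γ) = X :=
    Finset.eq_of_subset_of_card_le hsub (by omega)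
  -- neighbours of y
  have hNc : (S.image (· * y)).card = 3 := by
    rw [Finset.card_image_of_injective _ (mul_left_injective y), hS.card]
  have hmap : ∀ z, z ∈ S.image (· * y) → z ∈ X := by
    intro z hz
    rw [Finset.mem_image] at hz
    obtain ⟨u, hu, rfl⟩ := hz
    exact h.nb y hyY u hu
  have hedge : ∀ p s, s ∈ S → p ∈ S.image (· * y) → s * p ∈ S.image (· * y) → False := by
    intro p s hs hp hsp
    rw [Finset.mem_image] at hp hsp
    obtain ⟨u, hu, rfl⟩ := hp
    obtain ⟨v, hv, hvy⟩ := hsp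
    rw [← mul_assoc] at hvy
    exact ht s hs u hu (mul_right_cancel hvy ▸ hv)
  have hle : (S.image (· * y)).card ≤ ({0, 1} : Finset ℕ).card := by
    apply Finset.card_le_card_of_injOn (fun z => if z = p ∨ z = s * p then 0 else 1)
    · intro z _
      simp only
      split_ifs <;> simp
    · intro z hz w hw hzw
      rw [Finset.mem_coe] at hz hw
      have hz' := hmap z hz
      have hw' := hmap w hw
      rw [← hXe] at hz' hw'
      simp only [Finset.mem_insert, Finset.mem_singleton] at hz' hw'
      have e1 := hedge p s hs
      have e2 := hedge r t ht'
      have n1' := n1.symm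
      have n2' := n2.symm
      have n3' := n3.symm
      have n4' := n4.symm
      clear hXe hsub hc hNc hmap
      generalize S.image (· * y) = T at *
      generalize s * p = p' at *
      generalize t * r = r' at *
      rcases hz' with hz' | hz' | hz' | hz' <;> rcases hw' with hw' | hw' | hw' | hw' <;>
        rw [hz'] at hz hzw ⊢ <;> rw [hw'] at hw hzw ⊢ <;>
        first
        | exact (e1 hz hw).elim
        | exact (e1 hw hz).elim
        | exact (e2 hz hw).elim
        | exact (e2 hw hz).elim
        | (simp [n1', n2', n3', n4'] at hzw)
  rw [hNc] at hle
  simp at hle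

theorem extend (h : CaseA S X Y C) (hS : Cub S) (C1 : Finset Γ) (h1 : C1 ⊆ C)
    (hind : ∀ y ∈ C1, ∀ s ∈ S, s * y ∉ C1) (hc : 2 * C1.card = C.card + 1) : CaseB S := by
  refine ⟨Y ∪ C1, ?_, ?_⟩
  · intro y hy s hs hsy
    rw [Finset.mem_union] at hy hsy
    have hC1X : ∀ z ∈ C1, z ∉ X := fun z hz hzX => Finset.disjoint_left.1 h.xc hzX (h1 hz)
    have hYX : ∀ z ∈ Y, z ∉ X := fun z hz hzX => Finset.disjoint_left.1 h.xy hzX hz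
    rcases hy with hy | hy
    · have := h.nb y hy s hs
      rcases hsy with hsy | hsy
      · exact hYX _ hsy this
      · exact hC1X _ hsy this
    · rcases hsy with hsy | hsy
      · have := h.nb _ hsy s⁻¹ (hS.inv s hs)
        simp at this
        exact hC1X _ hy this
      · exact hind y hy s hs hsy
  · rw [Finset.card_union_of_disjoint (h.yc.mono_right h1)]
    have := h.card_eq
    have := h.card
    omega

theorem nonadj_pair {S D : Finset Γ} (hS : Cub S) (ht : TriFree S) (hD : 3 ≤ D.card) :
    ∃ x ∈ D, ∃ y ∈ D, x ≠ y ∧ (∀ s ∈ S, s * x ≠ y) ∧ (∀ s ∈ S, s * y ≠ x) := by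
  obtain ⟨x, hx, y, hy, z, hz, hxy, hxz, hyz⟩ := Finset.two_lt_card.1 hD
  have sym : ∀ x y : Γ, (∀ s ∈ S, s * x ≠ y) → ∀ s ∈ S, s * y ≠ x := by
    intro x y h s hs h'
    exact h s⁻¹ (hS.inv s hs) (by rw [← h']; simp)
  by_contra hcon
  push Not at hcon
  have adj : ∀ x ∈ D, ∀ y ∈ D, x ≠ y → ∃ s ∈ S, s * x = y := by
    intro x hx y hy hxy
    by_contra h
    push Not at h
    obtain ⟨s, hs, hsy⟩ := hcon x hx y hy hxy h
    exact sym x y h s hs hsy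
  obtain ⟨s, hs, rfl⟩ := adj x hx y hy hxy
  obtain ⟨t, ht', rfl⟩ := adj (s * x) hy z hz hyz
  obtain ⟨u, hu, huz⟩ := adj x hx _ hz hxz
  rw [← mul_assoc] at huz
  exact ht t ht' s hs (mul_right_cancel huz ▸ hu)

theorem reduce (h : CaseA S X Y C) (hS : Cub S) (ht : TriFree S) (hC : C.card ≤ 5) {c : Γ}
    (hc : c ∈ S) (hc2 : c * c = 1)
    (h5 : ∀ s₁ ∈ S, ∀ s₂ ∈ S, ∀ s₃ ∈ S, ∀ s₄ ∈ S, s₁ * s₂ * c ≠ s₃ * s₄) : CaseB S := by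
  have sym : ∀ x y : Γ, (∀ s ∈ S, s * x ≠ y) → ∀ s ∈ S, s * y ≠ x := by
    intro x y h s hs h'
    exact h s⁻¹ (hS.inv s hs) (by rw [← h']; simp)
  have par := dd_parity hS C
  have hdd := dd_add_in S C
  rw [hS.card] at hdd
  rw [h.ddC] at par hdd
  have hnoself : ∀ x, ∀ s ∈ S, s * x ≠ x := fun x s hs h => hS.ne_one hs (by simpa using h)
  have h35 : C.card = 3 ∨ C.card = 5 := by omega
  rcases h35 with h3 | hC5
  · obtain ⟨x, hx, y, hy, hxy, n1, n2⟩ := nonadj_pair hS ht h3.ge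
    apply h.extend hS {x, y}
    · intro z hz; simp at hz; rcases hz with rfl | rfl <;> assumption
    · intro z hz s hs hsz
      simp at hz hsz
      rcases hz with rfl | rfl <;> rcases hsz with hsz | hsz
      · exact hnoself _ s hs hsz
      · exact n1 s hs hsz
      · exact n2 s hs hsz
      · exact hnoself _ s hs hsz
    · rw [Finset.card_pair hxy, h3]
  · by_contra hB
    have noind : ∀ x ∈ C, ∀ y ∈ C, ∀ z ∈ C, x ≠ y → x ≠ z → y ≠ z → (∀ s ∈ S, s * x ≠ y) →
        (∀ s ∈ S, s * x ≠ z) → (∀ s ∈ S, s * y ≠ z) → False := by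
      intro x hx y hy z hz hxy hxz hyz n1 n2 n3
      apply hB
      apply h.extend hS {x, y, z}
      · intro w hw; simp at hw; rcases hw with rfl | rfl | rfl <;> assumption
      · intro w hw s hs hsw
        have n1' := sym _ _ n1
        have n2' := sym _ _ n2
        have n3' := sym _ _ n3
        simp only [Finset.mem_insert, Finset.mem_singleton] at hw hsw
        rcases hw with rfl | rfl | rfl
        · rcases hsw with e | e | e
          exacts [hnoself _ s hs e, n1 s hs e, n2 s hs e]
        · rcases hsw with e | e | e
          exacts [n1' s hs e, hnoself _ s hs e, n3 s hs e]
        · rcases hsw with e | e | e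
          exacts [n2' s hs e, n3' s hs e, hnoself _ s hs e]
      · rw [Finset.card_eq_three.2 ⟨x, y, z, hxy, hxz, hyz, rfl⟩, hC5]
    have hnb : ∀ x : Γ, ((S.filter (fun s => s * x ∈ C)).image (· * x)).card
        = (S.filter (fun s => s * x ∈ C)).card := fun x =>
      Finset.card_image_of_injective _ (mul_left_injective x)
    have deg : ∀ x ∈ C, (S.filter (fun s => s * x ∈ C)).card = 2 := by
      intro x hx
      have hle : (S.filter (fun s => s * x ∈ C)).card ≤ 3 := by
        rw [← hS.card]; exact Finset.card_filter_le _ _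
      by_contra hne
      by_cases h3 : (S.filter (fun s => s * x ∈ C)).card = 3
      · obtain ⟨s, t, u, hst, hsu, htu, he⟩ := Finset.card_eq_three.1 h3
        have ms : s ∈ S.filter (fun s => s * x ∈ C) := by rw [he]; simp
        have mt : t ∈ S.filter (fun s => s * x ∈ C) := by rw [he]; simp
        have mu : u ∈ S.filter (fun s => s * x ∈ C) := by rw [he]; simp
        rw [Finset.mem_filter] at ms mt mu
        have tri : ∀ s ∈ S, ∀ t ∈ S, ∀ w ∈ S, w * (s * x) ≠ t * x := by
          intro s hs t ht' w hw e
          rw [← mul_assoc] at e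
          exact ht w hw s hs (mul_right_cancel e ▸ ht')
        exact noind _ ms.2 _ mt.2 _ mu.2 (fun e => hst (mul_right_cancel e))
          (fun e => hsu (mul_right_cancel e)) (fun e => htu (mul_right_cancel e))
          (tri s ms.1 t mt.1) (tri s ms.1 u mu.1) (tri t mt.1 u mu.1)
      · set D := (C.erase x) \ (S.filter (fun s => s * x ∈ C)).image (· * x) with hD
        have hDc : 3 ≤ D.card := by
          have := Finset.le_card_sdiff ((S.filter (fun s => s * x ∈ C)).image (· * x)) (C.erase x)
          rw [Finset.card_erase_of_mem hx, hC5, hnb] at this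
          rw [hD]
          omega
        obtain ⟨y, hy, z, hz, hyz, n1, n2⟩ := nonadj_pair hS ht hDc
        have hDm : ∀ y ∈ D, y ∈ C ∧ x ≠ y ∧ ∀ s ∈ S, s * x ≠ y := by
          intro y hy
          rw [hD, Finset.mem_sdiff, Finset.mem_erase, Finset.mem_image] at hy
          refine ⟨hy.1.2, fun e => hy.1.1 e.symm, fun s hs e => hy.2 ⟨s, ?_, e⟩⟩
          rw [Finset.mem_filter]
          exact ⟨hs, e ▸ hy.1.2⟩
        have my := hDm y hy
        have mz := hDm z hz
        exact noind x hx y my.1 z mz.1 my.2.1 mz.2.1 hyz my.2.2 mz.2.2 n1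
    -- an edge labelled `c` inside C
    have hbd := h.bd_le hS hc
    have hadd := bd_add c C
    have hpos : 0 < (C.filter (fun x => c * x ∈ C)).card := by omega
    obtain ⟨x, hx⟩ := Finset.card_pos.1 hpos
    rw [Finset.mem_filter] at hx
    obtain ⟨hx, hcx⟩ := hx
    have hcc : c * (c * x) = x := by rw [← mul_assoc, hc2, one_mul]
    obtain ⟨s, hs, hsc, hsx⟩ := other_nbr (deg _ hcx).ge c
    obtain ⟨t, ht', htc, htx⟩ := other_nbr (deg _ hx).ge c
    have two : ∀ y ∈ C, ∀ s ∈ S, ∀ t ∈ S, s ≠ t → s * y ∈ C → t * y ∈ C →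
        ∀ u ∈ S, u * y ∈ C → u = s ∨ u = t := by
      intro y hy s hs t ht' hst h1 h2 u hu h3
      by_contra hne
      push Not at hne
      have : ({u, s, t} : Finset Γ) ⊆ S.filter (fun s => s * y ∈ C) := by
        intro w hw
        simp at hw
        rw [Finset.mem_filter]
        rcases hw with rfl | rfl | rfl
        exacts [⟨hu, h3⟩, ⟨hs, h1⟩, ⟨ht', h2⟩]
      have := Finset.card_le_card this
      rw [deg y hy, Finset.card_eq_three.2 ⟨u, s, t, hne.1, hne.2, hst, rfl⟩] at this
      omega
    have hrest : ∃ w ∈ C, w ∉ ({x, c * x, s * (c * x), t * x} : Finset Γ) := by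
      by_contra hcon
      push Not at hcon
      have := Finset.card_le_card (show C ⊆ _ from hcon)
      have := this.trans Finset.card_le_four
      omega
    obtain ⟨w, hw, hwn⟩ := hrest
    simp only [Finset.mem_insert, Finset.mem_singleton, not_or] at hwn
    obtain ⟨w1, w2, w3, w4⟩ := hwn
    -- all neighbours of w in C are among the two
    have hwnb : ∀ u ∈ S, u * w ∈ C → u * w = s * (c * x) ∨ u * w = t * x := by
      intro u hu huw
      by_contra hne
      push Not at hne
      have hC' : ({x, c * x, s * (c * x), t * x, w} : Finset Γ) = C := by
        apply Finset.eq_of_subset_of_card_le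
        · intro z hz
          simp at hz
          rcases hz with rfl | rfl | rfl | rfl | rfl <;> assumption
        · rw [hC5]
          rw [Finset.card_insert_of_notMem, Finset.card_insert_of_notMem,
            Finset.card_insert_of_notMem, Finset.card_pair (fun e => w4 e.symm)]
          · simp only [Finset.mem_insert, Finset.mem_singleton, not_or]
            refine ⟨fun e => ?_, fun e => w3 e.symm⟩
            rw [← mul_assoc] at e
            exact ht s hs c hc (mul_right_cancel e ▸ ht')
          · simp only [Finset.mem_insert, Finset.mem_singleton, not_or]
            exact ⟨fun e => hnoself _ s hs e.symm, fun e => htc (mul_right_cancel e).symm,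
              fun e => w2 e.symm⟩
          · simp only [Finset.mem_insert, Finset.mem_singleton, not_or]
            refine ⟨fun e => hnoself _ c hc e.symm, fun e => hsc ?_, fun e => hnoself _ t ht' e.symm,
              fun e => w1 e.symm⟩
            apply mul_right_cancel (b := c * x)
            rw [← e, hcc]
      rw [← hC'] at huw
      simp only [Finset.mem_insert, Finset.mem_singleton] at huw
      have hui : ∀ z, u * w = z → u⁻¹ * z = w := by rintro z rfl; simp
      rcases huw with e | e | e | e | e
      · have e' := hui _ e
        rcases two x hx c hc t ht' htc.symm hcx htx u⁻¹ (hS.inv u hu) (e' ▸ hw) with e2 | e2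
        · rw [e2] at e'; exact w2 e'.symm
        · rw [e2] at e'; exact w4 e'.symm
      · have e' := hui _ e
        rcases two (c * x) hcx c hc s hs hsc.symm (by rw [hcc]; exact hx) hsx u⁻¹ (hS.inv u hu)
          (e' ▸ hw) with e2 | e2
        · rw [e2, hcc] at e'; exact w1 e'.symm
        · rw [e2] at e'; exact w3 e'.symm
      · exact hne.1 e
      · exact hne.2 e
      · exact hnoself _ u hu e
    obtain ⟨u, hu, v, hv, huv, huw, hvw⟩ := two_nbrs (deg w hw).ge
    have fin : ∀ u ∈ S, ∀ v ∈ S, u * w = s * (c * x) → v * w = t * x → False := by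
      intro u hu v hv e1 e2
      have : u⁻¹ * s * c = v⁻¹ * t := by
        apply mul_right_cancel (b := x)
        have a1 : u⁻¹ * (s * (c * x)) = w := by rw [← e1]; simp
        have a2 : v⁻¹ * (t * x) = w := by rw [← e2]; simp
        simp only [mul_assoc]
        rw [a1, a2]
      exact h5 _ (hS.inv u hu) s hs _ (hS.inv v hv) t ht' this
    rcases hwnb u hu huw with e1 | e1 <;> rcases hwnb v hv hvw with e2 | e2
    · exact huv (mul_right_cancel (e1.trans e2.symm))
    · exact fin u hu v hv e1 e2
    · exact fin v hv u hu e2 e1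
    · exact huv (mul_right_cancel (e1.trans e2.symm))

end CaseA

/-- final form of case (a): everything reduces to `CaseB` -/
theorem caseA_to_B {S X Y C : Finset Γ} (h : CaseA S X Y C) (hS : Cub S) (ht : TriFree S)
    (hX : TwoEdges S X) {c : Γ} (hc : c ∈ S) (hc2 : c * c = 1)
    (h5 : ∀ s₁ ∈ S, ∀ s₂ ∈ S, ∀ s₃ ∈ S, ∀ s₄ ∈ S, s₁ * s₂ * c ≠ s₃ * s₄)
    (hcase : (No4 S ∧ No5 S) ∨ ∃ K q, FreeBlk S K c q) : CaseB S := by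
  have hbig := h.compl_big hS ht hX
  apply h.reduce hS ht _ hc hc2 h5
  rcases hcase with ⟨n4, n5⟩ | ⟨K, q, F⟩
  · by_contra hlt
    have h6 := cyc_cut (κ₀ := 5) (q := 6) hS (by norm_num) (by norm_num) (cyc_card6 hS ht n4 n5) C
    have hd := h.ddC
    by_cases h1 : CycS S C
    · by_cases h2 : CycS S Cᶜ
      · have := h6 h1 h2
        omega
      · have := not_cyc hS h2 (by rw [← Finset.card_pos]; omega)
        rw [dd_compl] at this
        omega
    · have := not_cyc hS h1 (by rw [← Finset.card_pos]; omega)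
      omega
  · have := F.lemmaG hS h.ddC (h.bd_inv hS hc hc2)
    omega
end CasePart

open SimpleGraph
set_option linter.unusedSectionVars false
set_option linter.unusedSimpArgs false
section ClassPart
variable {Γ : Type*} [Group Γ] [Fintype Γ] [DecidableEq Γ]

def NonBip (S : Finset Γ) : Prop := ¬ ∃ f : Γ → Bool, ∀ s ∈ S, ∀ x, f (s * x) ≠ f x

theorem nb_lemma {S : Finset Γ} (hS : Cub S) (hnb : NonBip S) (E O : Γ → Prop) (v : Γ) (hv : E v)
    (h1 : ∀ s ∈ S, ∀ x, E x → O (s * x)) (h2 : ∀ s ∈ S, ∀ x, O x → E (s * x)) :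
    ∃ x, E x ∧ O x := by
  classical
  by_contra hcon
  push Not at hcon
  have hu := closed_univ hS (A := Finset.univ.filter (fun x => E x ∨ O x)) ⟨v, by simp [hv]⟩ (by
    intro s hs x hx
    simp only [Finset.mem_filter, Finset.mem_univ, true_and] at *
    rcases hx with hx | hx
    · exact Or.inr (h1 s hs x hx)
    · exact Or.inl (h2 s hs x hx))
  apply hnb
  refine ⟨fun x => decide (E x), fun s hs x h => ?_⟩
  have hx : x ∈ Finset.univ.filter (fun x => E x ∨ O x) := by rw [hu]; simp
  simp only [Finset.mem_filter, Finset.mem_univ, true_and] at hx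
  rw [decide_eq_decide] at h
  rcases hx with hx | hx
  · exact hcon _ (h.2 hx) (h1 s hs x hx)
  · exact hcon x (h.1 (h2 s hs x hx)) hx

theorem lemmaQ {S : Finset Γ} (hS : Cub S) (hnb : NonBip S) {x c z : Γ} (hz : z * z = 1)
    (zx : z * x = x * z) (zc : z * c = c * z) (hx : x * x = 1 ∨ x * x = z) (hc : c * c = 1)
    (hsub : ∀ s ∈ S, s = x ∨ s = z * x ∨ s = c ∨ s = c * x * c) : x * c = c * x := by
  set H := Subgroup.closure ({z, x * c} : Set Γ) with hH
  have zH : z ∈ H := Subgroup.subset_closure (by simp)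
  have xcH : x * c ∈ H := Subgroup.subset_closure (by simp)
  have xxH : x * x ∈ H := by
    rcases hx with h | h <;> rw [h]
    · exact H.one_mem
    · exact zH
  have hci : c⁻¹ = c := inv_eq_of_mul_eq_one_left hc
  have conj : ∀ h ∈ H, x * h * x⁻¹ ∈ H := by
    intro h hh
    have : H ≤ H.comap (MulAut.conj x).toMonoidHom := by
      rw [hH, Subgroup.closure_le]
      intro w hw
      simp only [Set.mem_insert_iff, Set.mem_singleton_iff] at hw
      rw [SetLike.mem_coe, Subgroup.mem_comap]
      simp only [MulEquiv.coe_toMonoidHom, MulAut.conj_apply]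
      rcases hw with rfl | rfl
      · rw [← zx]; simpa using zH
      · have e : x * (x * c) * x⁻¹ = (x * x) * (x * c)⁻¹ := by
          rw [mul_inv_rev, hci]; group
        rw [e]
        exact H.mul_mem xxH (H.inv_mem xcH)
    simpa using this hh
  let E : Γ → Prop := fun g => g ∈ H
  let O : Γ → Prop := fun g => g * x⁻¹ ∈ H
  have xEO : ∀ g, E g → O (x * g) := fun g hg => conj g hg
  have xOE : ∀ g, O g → E (x * g) := by
    intro g hg
    have : x * g = (x * (g * x⁻¹) * x⁻¹) * (x * x) := by group
    show x * g ∈ H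
    rw [this]
    exact H.mul_mem (conj _ hg) xxH
  have zE : ∀ g, E g → E (z * g) := fun g hg => H.mul_mem zH hg
  have zO : ∀ g, O g → O (z * g) := fun g hg => by
    show z * g * x⁻¹ ∈ H
    rw [mul_assoc]; exact H.mul_mem zH hg
  have ce : ∀ g, c * g = x * ((x * x)⁻¹ * (x * c) * g) := by intro g; group
  have cEO : ∀ g, E g → O (c * g) := by
    intro g hg
    rw [ce]
    exact xEO _ (H.mul_mem (H.mul_mem (H.inv_mem xxH) xcH) hg)
  have cOE : ∀ g, O g → E (c * g) := by
    intro g hg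
    rw [ce]
    apply xOE
    show (x * x)⁻¹ * (x * c) * g * x⁻¹ ∈ H
    rw [mul_assoc]
    exact H.mul_mem (H.mul_mem (H.inv_mem xxH) xcH) hg
  obtain ⟨g, hE, hO⟩ := nb_lemma hS hnb E O 1 H.one_mem
    (by
      intro s hs g hg
      rcases hsub s hs with rfl | rfl | rfl | rfl
      · exact xEO g hg
      · rw [mul_assoc]; exact zO _ (xEO g hg)
      · exact cEO g hg
      · rw [mul_assoc, mul_assoc]; exact cEO _ (xOE _ (cEO g hg)))
    (by
      intro s hs g hg
      rcases hsub s hs with rfl | rfl | rfl | rfl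
      · exact xOE g hg
      · rw [mul_assoc]; exact zE _ (xOE g hg)
      · exact cOE g hg
      · rw [mul_assoc, mul_assoc]; exact cOE _ (xEO _ (cOE g hg)))
  have xH : x ∈ H := by
    have : x = (g * x⁻¹)⁻¹ * g := by group
    rw [this]
    exact H.mul_mem (H.inv_mem hO) hE
  have hcom : H ≤ Subgroup.centralizer {x * c} := by
    rw [hH, Subgroup.closure_le]
    intro w hw
    simp only [Set.mem_insert_iff, Set.mem_singleton_iff] at hw
    rw [SetLike.mem_coe, Subgroup.mem_centralizer_singleton_iff]
    rcases hw with rfl | rfl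
    · rw [← mul_assoc, zx, mul_assoc, zc, mul_assoc]
    · rfl
  have := hcom xH
  rw [Subgroup.mem_centralizer_singleton_iff, mul_assoc] at this
  exact mul_left_cancel this

def Ladder (S : Finset Γ) : Prop :=
  (∃ a b, S = {a, b, b⁻¹} ∧ a * a = 1 ∧ b * b ≠ 1 ∧ (a * b = b * a ∨ a * b * a = b⁻¹)) ∨
  (∃ t x y, S = {t, x, y} ∧ t * t = 1 ∧ x * x = 1 ∧ y * y = 1 ∧ t * x = x * t ∧ t * y = y * t)

structure Opp (S : Finset Γ) (K : Subgroup Γ) (z : Γ) : Prop where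
  mem : z ∈ K
  ne : z ≠ 1
  sq : z * z = 1
  all : ∀ k ∈ K, k = 1 ∨ k = z ∨ k ∈ S
  notS : z ∉ S

def No5a (S : Finset Γ) (c : Γ) : Prop :=
  ∀ s₁ ∈ S, ∀ s₂ ∈ S, ∀ s₃ ∈ S, ∀ s₄ ∈ S, s₁ * s₂ * c ≠ s₃ * s₄

theorem two_types {S : Finset Γ} (hS : Cub S) :
    (∃ a b, S = {a, b, b⁻¹} ∧ a * a = 1 ∧ b * b ≠ 1 ∧ a ≠ b ∧ a ≠ b⁻¹) ∨
    (∃ x y w, S = {x, y, w} ∧ x * x = 1 ∧ y * y = 1 ∧ w * w = 1 ∧ x ≠ y ∧ x ≠ w ∧ y ≠ w) := by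
  obtain ⟨p, q, r, hpq, hpr, hqr, he⟩ := Finset.card_eq_three.1 hS.card
  have key : ∀ p q r : Γ, p ≠ q → p ≠ r → q ≠ r → S = {p, q, r} → p * p ≠ 1 →
      ∃ a b, S = {a, b, b⁻¹} ∧ a * a = 1 ∧ b * b ≠ 1 ∧ a ≠ b ∧ a ≠ b⁻¹ := by
    intro p q r hpq hpr hqr he hp
    have hpi : p⁻¹ ∈ S := hS.inv p (by rw [he]; simp)
    have hqi : q⁻¹ ∈ S := hS.inv q (by rw [he]; simp)
    have hri : r⁻¹ ∈ S := hS.inv r (by rw [he]; simp)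
    have sq : ∀ u : Γ, u⁻¹ = u → u * u = 1 := fun u h => by
      nth_rewrite 1 [← h]; simp
    rw [he] at hpi hqi hri
    simp only [Finset.mem_insert, Finset.mem_singleton] at hpi hqi hri
    rcases hpi with h | h | h
    · exact absurd (sq p h) hp
    · refine ⟨r, p, ?_, ?_, hp, hpr.symm, by rw [h]; exact hqr.symm⟩
      · rw [he, h]; ext; simp; tauto
      · apply sq
        rcases hri with h' | h' | h'
        · exact absurd (inv_injective (h'.trans (by rw [← h, inv_inv] : p = q⁻¹))) hqr.symm
        · exact absurd (inv_injective (h'.trans h.symm)) hpr.symm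
        · exact h'
    · refine ⟨q, p, ?_, ?_, hp, hpq.symm, by rw [h]; exact hqr⟩
      · rw [he, h]; ext; simp; tauto
      · apply sq
        rcases hqi with h' | h' | h'
        · exact absurd (inv_injective (h'.trans (by rw [← h, inv_inv] : p = r⁻¹))) hqr
        · exact h'
        · exact absurd (inv_injective (h'.trans h.symm)) hpq.symm
  by_cases h1 : p * p = 1
  · by_cases h2 : q * q = 1
    · by_cases h3 : r * r = 1
      · exact Or.inr ⟨p, q, r, he, h1, h2, h3, hpq, hpr, hqr⟩
      · left
        exact key r p q hpr.symm hqr.symm hpq (by rw [he]; ext; simp; tauto) h3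
    · left
      exact key q p r hpq.symm hqr hpr (by rw [he]; ext; simp; tauto) h2
  · left
    exact key p q r hpq hpr hqr he h1

/-- if no five-relation contains `c` in last position, none contains it at all -/
theorem No5a.rot {S : Finset Γ} (hS : Cub S) {c : Γ} (h : No5a S c) (hc2 : c * c = 1)
    {s₁ s₂ s₃ s₄ s₅ : Γ} (h1 : s₁ ∈ S) (h2 : s₂ ∈ S) (h3 : s₃ ∈ S) (h4 : s₄ ∈ S) (h5 : s₅ ∈ S)
    (he : s₁ * s₂ = s₃ * s₄ * s₅) : s₁ ≠ c ∧ s₂ ≠ c ∧ s₃ ≠ c ∧ s₄ ≠ c ∧ s₅ ≠ c := by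
  have hci : c⁻¹ = c := inv_eq_of_mul_eq_one_left hc2
  have i := hS.inv
  refine ⟨?_, ?_, ?_, ?_, ?_⟩
  · rintro rfl
    refine h _ (i _ h4) _ (i _ h3) _ h5 _ (i _ h2) ?_
    have : s₅ * s₂⁻¹ = s₄⁻¹ * s₃⁻¹ * (s₃ * s₄ * s₅) * s₂⁻¹ := by group
    rw [this, ← he]; group
  · rintro rfl
    refine h _ (i _ h3) _ h1 _ h4 _ h5 ?_
    rw [mul_assoc, he]; group
  · rintro rfl
    refine h _ (i _ h5) _ (i _ h4) _ (i _ h2) _ (i _ h1) ?_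
    have : s₂⁻¹ * s₁⁻¹ = (s₁ * s₂)⁻¹ := by group
    rw [this, he, mul_inv_rev, mul_inv_rev, hci, mul_assoc]
  · rintro rfl
    refine h _ h2 _ (i _ h5) _ (i _ h1) _ h3 ?_
    have : s₂ = s₁⁻¹ * (s₁ * s₂) := by group
    rw [this, he]
    have : s₁⁻¹ * (s₃ * s₄ * s₅) * s₅⁻¹ * s₄ = s₁⁻¹ * s₃ * (s₄ * s₄) := by group
    rw [this, hc2, mul_one]
  · rintro rfl
    exact h _ h3 _ h4 _ h1 _ h2 he.symm

/-- type I facts -/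
structure TI (S : Finset Γ) (a b : Γ) : Prop where
  eq : S = {a, b, b⁻¹}
  a2 : a * a = 1
  b2 : b * b ≠ 1
  nab : a ≠ b
  nab' : a ≠ b⁻¹
  comm : a * b ≠ b * a
  conj : a * b * a ≠ b⁻¹

namespace TI
variable {S : Finset Γ} {a b : Γ}
theorem ma (T : TI S a b) : a ∈ S := by rw [T.eq]; simp
theorem mb (T : TI S a b) : b ∈ S := by rw [T.eq]; simp
theorem mB (T : TI S a b) : b⁻¹ ∈ S := by rw [T.eq]; simp
theorem b3 (T : TI S a b) (ht : TriFree S) : b * b * b ≠ 1 := fun h =>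
  ht b T.mb b T.mb (by rw [eq_inv_of_mul_eq_one_left h]; exact T.mB)
theorem ai (T : TI S a b) : a⁻¹ = a := inv_eq_of_mul_eq_one_left T.a2

theorem sand (T : TI S a b) {x y : Γ} (h : a * x * a = y) : x = a * y * a := by
  rw [← h]
  have : a * (a * x * a) * a = (a * a) * x * (a * a) := by group
  rw [this, T.a2]; simp

theorem not_pow (T : TI S a b) (n : ℤ) : a ≠ b ^ n := by
  intro h
  exact T.comm (by rw [h]; exact ((Commute.refl b).zpow_left n).eq)

theorem csq (T : TI S a b) (ht : TriFree S) : a * b * a ≠ b * b := by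
  intro h
  have h1 := T.sand h
  have h2 : a * (b * b) * a = (a * b * a) * (a * b * a) := by
    have : (a * b * a) * (a * b * a) = a * b * (a * a) * b * a := by group
    rw [this, T.a2]; group
  rw [h2, h] at h1
  apply T.b3 ht
  have : b * b * b = b⁻¹ * (b * b * (b * b)) := by group
  rw [this, ← h1]; simp

theorem csq' (T : TI S a b) (ht : TriFree S) : a * b * a ≠ b⁻¹ * b⁻¹ := by
  intro h
  have h1 := T.sand h
  have h2 : a * (b⁻¹ * b⁻¹) * a = (a * b * a)⁻¹ * (a * b * a)⁻¹ := by
    have : (a * b * a)⁻¹ * (a * b * a)⁻¹ = a⁻¹ * b⁻¹ * (a * a)⁻¹ * b⁻¹ * a⁻¹ := by group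
    rw [this, T.a2, T.ai]; group
  rw [h2, h] at h1
  apply T.b3 ht
  have : b * b * b = b⁻¹ * ((b⁻¹ * b⁻¹)⁻¹ * (b⁻¹ * b⁻¹)⁻¹) := by simp [mul_assoc]
  rw [this, ← h1]; simp

theorem inv_conj (T : TI S a b) {y : Γ} (h : a * b⁻¹ * a = y) : a * b * a = y⁻¹ := by
  rw [← h, mul_inv_rev, mul_inv_rev, T.ai, inv_inv, mul_assoc]

theorem no5a (T : TI S a b) (hS : Cub S) (ht : TriFree S) : No5a S a := by
  intro s₁ h1 s₂ h2 s₃ h3 s₄ h4 h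
  have cancel : ∀ u v : Γ, u * a = v → u = v * a := by
    rintro u v rfl; rw [mul_assoc, T.a2, mul_one]
  have c1 := ht
  by_cases e2 : s₂ = a
  · rw [e2, mul_assoc, T.a2, mul_one] at h
    exact ht _ h3 _ h4 (h ▸ h1)
  by_cases e4 : s₄ = a
  · rw [e4] at h
    have := mul_right_cancel h
    exact ht _ h1 _ h2 (this ▸ h3)
  by_cases e13 : s₁ = s₃
  · rw [e13, mul_assoc] at h
    have := mul_left_cancel h
    exact ht _ h2 _ T.ma (this ▸ h4)
  by_cases e12 : s₁ * s₂ = 1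
  · rw [e12, one_mul] at h
    exact ht _ h3 _ h4 (h ▸ T.ma)
  by_cases e34 : s₃ * s₄ = 1
  · rw [e34] at h
    have := cancel _ _ h
    rw [one_mul] at this
    exact ht _ h1 _ h2 (this ▸ T.ma)
  have swap : ∀ u v w : Γ, u * v * a = a * w → a * w * a = u * v := by
    intro u v w h
    rw [← h, mul_assoc, T.a2, mul_one]
  have p1 : b⁻¹ * b⁻¹ * a ≠ b * b := fun h => T.not_pow 4 (by
    have : a = b * b * (b⁻¹ * b⁻¹ * a) := by group
    rw [this, h, show (4 : ℤ) = ((4 : ℕ) : ℤ) from rfl, zpow_natCast]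
    simp [pow_succ, mul_assoc])
  have p2 : b * b * a ≠ b⁻¹ * b⁻¹ := fun h => T.not_pow (-4) (by
    have : a = b⁻¹ * b⁻¹ * (b * b * a) := by group
    rw [this, h, show (-4 : ℤ) = -((4 : ℕ) : ℤ) from rfl, zpow_neg, zpow_natCast]
    simp [pow_succ, mul_assoc])
  rw [T.eq] at h1 h2 h3 h4
  simp only [Finset.mem_insert, Finset.mem_singleton] at h1 h2 h3 h4
  rcases h2 with rfl | rfl | rfl
  · exact e2 rfl
  all_goals
    rcases h4 with rfl | rfl | rfl
    · exact e4 rfl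
    all_goals
      rcases h1 with rfl | rfl | rfl <;> rcases h3 with rfl | rfl | rfl <;>
        first
        | exact e13 rfl
        | (exact absurd (mul_inv_cancel _) e12)
        | (exact absurd (inv_mul_cancel _) e12)
        | (exact absurd (mul_inv_cancel _) e34)
        | (exact absurd (inv_mul_cancel _) e34)
        | (exact T.csq ht h)
        | (exact T.csq' ht h)
        | (exact T.csq ht (by simpa using T.inv_conj h))
        | (exact T.csq' ht (by simpa using T.inv_conj h))
        | (exact T.csq ht (swap _ _ _ h))
        | (exact T.csq' ht (swap _ _ _ h))
        | (exact T.csq ht (by simpa using T.inv_conj (swap _ _ _ h)))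
        | (exact T.csq' ht (by simpa using T.inv_conj (swap _ _ _ h)))
        | (exact p1 h)
        | (exact p2 h)

theorem no5 (T : TI S a b) (hS : Cub S) (ht : TriFree S) (h5 : b ^ 5 ≠ 1) : No5 S := by
  intro s₁ h1 s₂ h2 s₃ h3 s₄ h4 s₅ h6 h
  obtain ⟨n1, n2, n3, n4, n5⟩ := (T.no5a hS ht).rot hS T.a2 h1 h2 h3 h4 h6 h
  have b1 : b ≠ 1 := hS.ne_one T.mb
  have b3 : b ^ 3 ≠ 1 := by
    have := T.b3 ht
    rwa [pow_succ, pow_two]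
  have hz : ∀ s ∈ S, s ≠ a → ∃ e : ℤ, (e = 1 ∨ e = -1) ∧ s = b ^ e := by
    intro s hs hsa
    rw [T.eq] at hs
    simp only [Finset.mem_insert, Finset.mem_singleton] at hs
    rcases hs with e | e | e
    · exact absurd e hsa
    · exact ⟨1, Or.inl rfl, by simp [e]⟩
    · exact ⟨-1, Or.inr rfl, by simp [e]⟩
  obtain ⟨e1, i1, rfl⟩ := hz _ h1 n1
  obtain ⟨e2, i2, rfl⟩ := hz _ h2 n2
  obtain ⟨e3, i3, rfl⟩ := hz _ h3 n3
  obtain ⟨e4, i4, rfl⟩ := hz _ h4 n4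
  obtain ⟨e5, i5, rfl⟩ := hz _ h6 n5
  rw [← zpow_add, ← zpow_add, ← zpow_add] at h
  have h0 : b ^ (e1 + e2 - (e3 + e4 + e5)) = 1 := by rw [zpow_sub, h, mul_inv_cancel]
  have : e1 + e2 - (e3 + e4 + e5) = 1 ∨ e1 + e2 - (e3 + e4 + e5) = 3 ∨ e1 + e2 - (e3 + e4 + e5) = 5 ∨
    e1 + e2 - (e3 + e4 + e5) = -1 ∨ e1 + e2 - (e3 + e4 + e5) = -3 ∨ e1 + e2 - (e3 + e4 + e5) = -5 := by
    omega
  rcases this with e | e | e | e | e | e <;> rw [e] at h0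
  · exact b1 (by simpa using h0)
  · exact b3 (by exact_mod_cast h0)
  · exact h5 (by exact_mod_cast h0)
  · exact b1 (by simpa using h0)
  · rw [zpow_neg, inv_eq_one] at h0; exact b3 (by exact_mod_cast h0)
  · rw [zpow_neg, inv_eq_one] at h0; exact h5 (by exact_mod_cast h0)

theorem no4 (T : TI S a b) (hS : Cub S) (h4 : b ^ 4 ≠ 1) : No4 S := by
  have comm := T.comm
  have f1 : a * b ≠ b⁻¹ * a := fun h => T.conj (by rw [h, mul_assoc, T.a2, mul_one])
  have f2 : a * b ≠ b⁻¹ * b⁻¹ := fun h => T.not_pow (-3) (by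
    have : a = (a * b) * b⁻¹ := by group
    rw [this, h]; group)
  have f3 : a * b⁻¹ ≠ b * a := fun h => T.conj (by
    have : a * b⁻¹ * a = b := by rw [h, mul_assoc, T.a2, mul_one]
    exact T.inv_conj this)
  have f4 : a * b⁻¹ ≠ b * b := fun h => T.not_pow 3 (by
    have : a = (a * b⁻¹) * b := by group
    rw [this, h, show (3 : ℤ) = ((3 : ℕ) : ℤ) from rfl, zpow_natCast]
    simp [pow_succ, mul_assoc])
  have f5 : a * b⁻¹ ≠ b⁻¹ * a := fun h => T.comm (by
    have : a * b = b * (b⁻¹ * a) * b := by group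
    rw [this, ← h]; group)
  have f6 : b * a ≠ b⁻¹ * b⁻¹ := fun h => T.not_pow (-3) (by
    have : a = b⁻¹ * (b * a) := by group
    rw [this, h]; group)
  have f7 : b⁻¹ * a ≠ b * b := fun h => T.not_pow 3 (by
    have : a = b * (b⁻¹ * a) := by group
    rw [this, h, show (3 : ℤ) = ((3 : ℕ) : ℤ) from rfl, zpow_natCast]
    simp [pow_succ, mul_assoc])
  have f8 : b * b ≠ b⁻¹ * b⁻¹ := fun h => h4 (by
    have : b ^ 4 = (b * b) * (b * b) := by simp [pow_succ, mul_assoc]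
    rw [this]
    nth_rewrite 1 [h]
    group)
  intro s₁ h1 s₂ h2 s₃ h3 s₄ h4 h hne
  by_contra h24
  rw [T.eq] at h1 h2 h3 h4
  simp only [Finset.mem_insert, Finset.mem_singleton] at h1 h2 h3 h4
  have h13 : s₁ ≠ s₃ := fun e => by rw [e] at h; exact h24 (mul_left_cancel h)
  have hne' := h ▸ hne
  rcases h2 with rfl | rfl | rfl <;> rcases h4 with rfl | rfl | rfl <;>
    first
    | exact h24 rfl
    | (rcases h1 with rfl | rfl | rfl <;> rcases h3 with rfl | rfl | rfl <;>
        first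
        | exact h13 rfl
        | exact hne T.a2
        | exact hne' T.a2
        | exact hne (mul_inv_cancel _)
        | exact hne (inv_mul_cancel _)
        | exact hne' (mul_inv_cancel _)
        | exact hne' (inv_mul_cancel _)
        | exact absurd h comm
        | exact absurd h f1
        | exact absurd h f2
        | exact absurd h f3
        | exact absurd h f4
        | exact absurd h f5
        | exact absurd h f6
        | exact absurd h f7
        | exact absurd h f8
        | exact absurd h.symm comm
        | exact absurd h.symm f1
        | exact absurd h.symm f2
        | exact absurd h.symm f3
        | exact absurd h.symm f4
        | exact absurd h.symm f5
        | exact absurd h.symm f6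
        | exact absurd h.symm f7
        | exact absurd h.symm f8)

theorem gen_eq (T : TI S a b) : Subgroup.zpowers b = Subgroup.closure {s | s ∈ S ∧ s ≠ a} := by
  apply le_antisymm
  · rw [Subgroup.zpowers_le]
    exact Subgroup.subset_closure ⟨T.mb, T.nab.symm⟩
  · rw [Subgroup.closure_le]
    rintro s ⟨hs, hsa⟩
    rw [T.eq] at hs
    simp only [Finset.mem_insert, Finset.mem_singleton] at hs
    rcases hs with e | e | e
    · exact absurd e hsa
    · rw [e]; exact Subgroup.mem_zpowers b
    · rw [e]; exact inv_mem (Subgroup.mem_zpowers b)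

theorem conj_pow (T : TI S a b) (x : Γ) (n : ℕ) : a * x ^ n * a = (a * x * a) ^ n := by
  have h := _root_.conj_pow (a := a) (b := x) (i := n)
  rw [T.ai] at h
  exact h.symm

theorem pow_cases (n : ℕ) (hn : 0 < n) (hb : b ^ n = 1) {k : Γ} (hk : k ∈ Subgroup.zpowers b) :
    ∃ i < n, k = b ^ i := by
  obtain ⟨m, rfl⟩ := Subgroup.mem_zpowers_iff.1 hk
  refine ⟨(m % n).toNat, ?_, ?_⟩
  · have := Int.emod_lt_of_pos m (show (0 : ℤ) < n by exact_mod_cast hn)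
    have := Int.emod_nonneg m (show (n : ℤ) ≠ 0 by exact_mod_cast hn.ne')
    omega
  · have h1 := Int.emod_nonneg m (show (n : ℤ) ≠ 0 by exact_mod_cast hn.ne')
    rw [← zpow_natCast, Int.toNat_of_nonneg h1]
    conv_lhs => rw [← Int.emod_add_mul_ediv m n, zpow_add, zpow_mul]
    simp [hb]

theorem free4 (T : TI S a b) (hS : Cub S) (hnb : NonBip S) (h4 : b ^ 4 = 1) :
    FreeBlk S (Subgroup.zpowers b) a 4 ∧ Opp S (Subgroup.zpowers b) (b * b) := by
  have b1 : b ≠ 1 := hS.ne_one T.mb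
  have hb2 : b ^ 2 ≠ 1 := by rw [pow_two]; exact T.b2
  have b3 : b ^ 3 = b⁻¹ := eq_inv_of_mul_eq_one_left (by rw [← pow_succ]; exact h4)
  have hord : orderOf b = 4 := by
    have := orderOf_eq_prime_pow (p := 2) (n := 1) (x := b) (by simpa using hb2) (by simpa using h4)
    simpa using this
  have A1 : a * b * a ∉ Subgroup.zpowers b := by
    intro h
    obtain ⟨i, hi, h⟩ := pow_cases 4 (by norm_num) h4 h
    interval_cases i
    · have := T.sand h
      rw [pow_zero, mul_one, T.a2] at this
      exact b1 this
    · rw [pow_one] at h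
      exact T.comm (by simpa [mul_assoc, T.a2] using congrArg (· * a) h)
    · have := T.conj_pow b 2
      rw [h, ← pow_mul, h4] at this
      have := T.sand this
      rw [mul_one, T.a2] at this
      exact hb2 this
    · rw [b3] at h
      exact T.conj h
  have A2 : a * b ^ 2 * a ∉ Subgroup.zpowers b := by
    intro h
    obtain ⟨i, hi, h⟩ := pow_cases 4 (by norm_num) h4 h
    have hsq : (a * b ^ 2 * a) ^ 2 = 1 := by
      rw [← T.conj_pow, ← pow_mul, h4, mul_one, T.a2]
    interval_cases i
    · have := T.sand h
      rw [pow_zero, mul_one, T.a2] at this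
      exact hb2 this
    · rw [h, pow_one] at hsq
      exact hb2 hsq
    · apply T.comm
      have hzc : b ^ 2 * a = a * b ^ 2 := by
        nth_rewrite 1 [← h]
        rw [mul_assoc, T.a2, mul_one]
      have := lemmaQ hS hnb (x := b) (c := a) (z := b ^ 2) (by rw [← pow_add]; exact h4)
        (by rw [← pow_succ, ← pow_succ']) hzc (Or.inr (pow_two b).symm) T.a2 (by
          intro s hs
          rw [T.eq] at hs
          simp only [Finset.mem_insert, Finset.mem_singleton] at hs
          rw [← pow_succ, b3]
          tauto)
      exact this.symm
    · rw [h, b3, inv_pow, inv_eq_one] at hsq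
      exact hb2 hsq
  refine ⟨⟨T.ma, T.a2, by rw [Nat.card_zpowers, hord], Or.inl rfl, T.gen_eq, ?_⟩,
    ⟨?_, T.b2, ?_, ?_, ?_⟩⟩
  · intro k hk hck
    obtain ⟨i, hi, rfl⟩ := pow_cases 4 (by norm_num) h4 hk
    interval_cases i
    · simp
    · rw [pow_one] at hck; exact absurd hck A1
    · exact absurd hck A2
    · have := inv_mem hck
      rw [b3] at this
      rw [mul_inv_rev, mul_inv_rev, inv_inv, T.ai, ← mul_assoc] at this
      exact absurd this A1
  · exact mul_mem (Subgroup.mem_zpowers b) (Subgroup.mem_zpowers b)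
  · rw [← pow_two, ← pow_two, ← pow_mul]; exact h4
  · intro k hk
    obtain ⟨i, hi, rfl⟩ := pow_cases 4 (by norm_num) h4 hk
    interval_cases i
    · left; simp
    · right; right; simpa using T.mb
    · right; left; rw [pow_two]
    · right; right; rw [b3]; exact T.mB
  · intro h
    rw [T.eq] at h
    simp only [Finset.mem_insert, Finset.mem_singleton] at h
    rcases h with h | h | h
    · exact T.not_pow 2 (by rw [← h, zpow_ofNat, pow_two])
    · exact b1 (by simpa using h)
    · rw [← b3] at h
      apply b1
      have : b ^ 3 = b * b * b := by rw [pow_succ, pow_two]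
      rw [this] at h
      simpa using h

theorem free5 (T : TI S a b) (hS : Cub S) (ht : TriFree S) (h5 : b ^ 5 = 1) :
    FreeBlk S (Subgroup.zpowers b) a 5 := by
  have b1 : b ≠ 1 := hS.ne_one T.mb
  have hord : orderOf b = 5 := orderOf_eq_prime (hp := ⟨by norm_num⟩) h5 b1
  have b4 : b ^ 4 = b⁻¹ := eq_inv_of_mul_eq_one_left (by rw [← pow_succ]; exact h5)
  have b3 : b ^ 3 = b⁻¹ * b⁻¹ := by
    have : b ^ 3 = b ^ 5 * (b⁻¹ * b⁻¹) := by group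
    rw [this, h5, one_mul]
  have A1 : a * b * a ∉ Subgroup.zpowers b := by
    intro h
    obtain ⟨i, hi, h⟩ := pow_cases 5 (by norm_num) h5 h
    interval_cases i
    · have := T.sand h
      rw [pow_zero, mul_one, T.a2] at this
      exact b1 this
    · rw [pow_one] at h
      exact T.comm (by simpa [mul_assoc, T.a2] using congrArg (· * a) h)
    · rw [pow_two] at h
      exact T.csq ht h
    · rw [b3] at h
      exact T.csq' ht h
    · rw [b4] at h
      exact T.conj h
  refine ⟨T.ma, T.a2, by rw [Nat.card_zpowers, hord], Or.inr rfl, T.gen_eq, ?_⟩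
  intro k hk hck
  by_contra hk1
  have : ∃ j : ℕ, k ^ j = b := by
    obtain ⟨i, hi, rfl⟩ := pow_cases 5 (by norm_num) h5 hk
    interval_cases i
    · simp at hk1
    · exact ⟨1, by simp⟩
    · refine ⟨3, ?_⟩
      rw [← pow_mul, show 2 * 3 = 5 + 1 from rfl, pow_succ, h5, one_mul]
    · refine ⟨2, ?_⟩
      rw [← pow_mul, show 3 * 2 = 5 + 1 from rfl, pow_succ, h5, one_mul]
    · refine ⟨4, ?_⟩
      rw [← pow_mul, show 4 * 4 = 5 * 3 + 1 from rfl, pow_succ, pow_mul, h5, one_pow, one_mul]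
  obtain ⟨j, hj⟩ := this
  apply A1
  have := pow_mem hck j
  rwa [← T.conj_pow, hj] at this
end TI
end ClassPart

open SimpleGraph
set_option linter.unusedSectionVars false
set_option linter.unusedSimpArgs false
section ClassPart2
variable {Γ : Type*} [Group Γ] [Fintype Γ] [DecidableEq Γ]

/-- type II: three involutions, not a ladder -/
structure TII (S : Finset Γ) : Prop where
  cub : Cub S
  tri : TriFree S
  nb : NonBip S
  inv2 : ∀ s ∈ S, s * s = 1
  nl : ¬ Ladder S

namespace TII
variable {S : Finset Γ}

theorem eq3 (T : TII S) {p q r : Γ} (hp : p ∈ S) (hq : q ∈ S) (hr : r ∈ S) (hpq : p ≠ q)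
    (hpr : p ≠ r) (hqr : q ≠ r) : S = {p, q, r} := by
  symm
  apply Finset.eq_of_subset_of_card_le
  · intro x hx
    simp only [Finset.mem_insert, Finset.mem_singleton] at hx
    rcases hx with rfl | rfl | rfl <;> assumption
  · rw [T.cub.card, Finset.card_eq_three.2 ⟨p, q, r, hpq, hpr, hqr, rfl⟩]

theorem inv_self (T : TII S) {p : Γ} (hp : p ∈ S) : p⁻¹ = p :=
  inv_eq_of_mul_eq_one_left (T.inv2 p hp)

theorem nlad (T : TII S) {p q r : Γ} (hp : p ∈ S) (hq : q ∈ S) (hr : r ∈ S) (hpq : p ≠ q)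
    (hpr : p ≠ r) (hqr : q ≠ r) (h1 : p * q = q * p) (h2 : p * r = r * p) : False :=
  T.nl (Or.inr ⟨p, q, r, T.eq3 hp hq hr hpq hpr hqr, T.inv2 _ hp, T.inv2 _ hq, T.inv2 _ hr, h1, h2⟩)

theorem cj (T : TII S) {p q r : Γ} (hp : p ∈ S) (hq : q ∈ S) (hr : r ∈ S) (hpq : p ≠ q)
    (hpr : p ≠ r) (hqr : q ≠ r) : p * q * p ≠ r := by
  intro h
  have := lemmaQ T.cub T.nb (x := q) (c := p) (z := 1) (by simp) (by simp) (by simp)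
    (Or.inl (T.inv2 _ hq)) (T.inv2 _ hp) (by
      intro s hs
      rw [T.eq3 hp hq hr hpq hpr hqr] at hs
      simp only [Finset.mem_insert, Finset.mem_singleton] at hs
      rw [h]; tauto)
  rw [← this, mul_assoc, T.inv2 _ hp, mul_one] at h
  exact hqr h

theorem rel5 (T : TII S) {p q r : Γ} (hp : p ∈ S) (hq : q ∈ S) (hr : r ∈ S) (hpq : p ≠ q)
    (hpr : p ≠ r) (hqr : q ≠ r) : p * q * p * q ≠ r := by
  intro h
  have p2 := T.inv2 _ hp
  have q2 := T.inv2 _ hq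
  have h' : q * p * q * p = r := by
    have := congrArg (·⁻¹) h
    simpa [T.inv_self hp, T.inv_self hq, T.inv_self hr, mul_assoc] using this
  refine T.nlad hr hp hq hpr.symm hqr.symm hpq ?_ ?_
  · calc r * p = q * p * q * (p * p) := by rw [← h', mul_assoc]
      _ = (p * p) * (q * p * q) := by rw [p2]; simp
      _ = p * (p * q * p * q) := by group
      _ = p * r := by rw [h]
  · calc r * q = p * q * p * (q * q) := by rw [← h, mul_assoc]
      _ = (q * q) * (p * q * p) := by rw [q2]; simp
      _ = q * (q * p * q * p) := by group
      _ = q * r := by rw [h']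

theorem word5 (T : TII S) {a b c d e : Γ} (ha : a ∈ S) (hb : b ∈ S) (hc : c ∈ S) (hd : d ∈ S)
    (he : e ∈ S) (h : a * b * c * d * e = 1) : False := by
  have ia := T.inv_self ha
  have ib := T.inv_self hb
  have ic := T.inv_self hc
  have id' := T.inv_self hd
  have ie := T.inv_self he
  have rot : ∀ a b c d e : Γ, a * b * c * d * e = 1 → b * c * d * e * a = 1 := by
    intro a b c d e h
    rw [mul_eq_one_comm, ← h]; group
  have last : ∀ a b c d e : Γ, e⁻¹ = e → a * b * c * d * e = 1 → a * b * c * d = e := by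
    intro a b c d e h' h
    rw [← h']; exact eq_inv_of_mul_eq_one_left h
  have r1 : a * b * c * d = e := last _ _ _ _ _ ie h
  have r2 : b * c * d * e = a := last _ _ _ _ _ ia (rot _ _ _ _ _ h)
  have r3 : c * d * e * a = b := last _ _ _ _ _ ib (rot _ _ _ _ _ (rot _ _ _ _ _ h))
  have r4 : d * e * a * b = c :=
    last _ _ _ _ _ ic (rot _ _ _ _ _ (rot _ _ _ _ _ (rot _ _ _ _ _ h)))
  have r5 : e * a * b * c = d :=
    last _ _ _ _ _ id' (rot _ _ _ _ _ (rot _ _ _ _ _ (rot _ _ _ _ _ (rot _ _ _ _ _ h))))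
  have tri3 : ∀ {u v x y z : Γ}, x ∈ S → y ∈ S → z ∈ S → u * u = 1 →
      u * v * x * y = z → u ≠ v := by
    rintro u v x y z hx hy hz hu h rfl
    rw [hu, one_mul] at h
    exact T.tri x hx y hy (h ▸ hz)
  have n1 := tri3 hc hd he (T.inv2 _ ha) r1
  have n2 := tri3 hd he ha (T.inv2 _ hb) r2
  have n3 := tri3 he ha hb (T.inv2 _ hc) r3
  have n4 := tri3 ha hb hc (T.inv2 _ hd) r4
  have n5 := tri3 hb hc hd (T.inv2 _ he) r5
  obtain ⟨p, q, r, hpq, hpr, hqr, hE⟩ := Finset.card_eq_three.1 T.cub.card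
  have key : ∀ u ∈ S, ∀ v ∈ S, ∀ w ∈ S, u ≠ v → u ≠ w → v ≠ w → u * v * u * v ≠ w :=
    fun u hu v hv w hw h1 h2 h3 => T.rel5 hu hv hw h1 h2 h3
  -- pigeonhole
  have three : ∀ u ∈ S, ∀ v ∈ S, ∀ w ∈ S, ∀ x ∈ S, u ≠ v → u ≠ w → v ≠ w → x = u ∨ x = v ∨ x = w := by
    intro u hu v hv w hw x hx h1 h2 h3
    rw [T.eq3 hu hv hw h1 h2 h3] at hx
    simpa using hx
  by_cases ac : a = c
  · subst ac
    by_cases bd : b = d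
    · subst bd
      exact key _ ha _ hb _ he n1 n5.symm n4 r1
    · -- a b a d e, d ≠ b so {a,b,d} all, e ≠ d, e ≠ a so e = b
      have : e = b := by
        rcases three a ha b hb d hd e he n1 n3 bd with h | h | h
        · exact absurd h n5
        · exact h
        · exact absurd h.symm n4
      subst this
      exact key _ he _ ha _ hd n5 (Ne.symm n4) n3 r5
  · -- a b c distinct ; d ∈ {a,b}, e ∈ {b,c}, d ≠ e
    rcases three a ha b hb c hc d hd n1 ac n2 with h | h | h
    · subst h
      rcases three _ hd b hb c hc e he n1 ac n2 with h | h | h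
      · exact absurd h n5
      · subst h
        exact key _ hd _ he _ hc n1 ac n2 r4
      · subst h
        exact key _ he _ hd _ hb n5 n2.symm n1 r3
    · subst h
      rcases three a ha _ hd c hc e he n1 ac n2 with h | h | h
      · exact absurd h n5
      · exact absurd h.symm n4
      · subst h
        exact key _ hd _ he _ ha n4 n1.symm n5 r2
    · exact absurd h.symm n3

theorem no5 (T : TII S) : No5 S := by
  intro s₁ h1 s₂ h2 s₃ h3 s₄ h4 s₅ h5 h
  apply T.word5 h2 h1 h3 h4 h5
  have : s₂ * s₁ = (s₁ * s₂)⁻¹ := by rw [mul_inv_rev, T.inv_self h1, T.inv_self h2]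
  rw [this, h]; group

theorem no5a (T : TII S) {c : Γ} (hc : c ∈ S) : No5a S c := by
  intro s₁ h1 s₂ h2 s₃ h3 s₄ h4 h
  exact T.no5 s₃ h3 s₄ h4 s₁ h1 s₂ h2 c hc h.symm

theorem not_no4 (T : TII S) (h : ¬ No4 S) : ∃ p ∈ S, ∃ q ∈ S, p ≠ q ∧ p * q = q * p := by
  unfold No4 at h
  push Not at h
  obtain ⟨s₁, h1, s₂, h2, s₃, h3, s₄, h4, he, hne, h24⟩ := h
  have h12 : s₁ ≠ s₂ := fun e => hne (by rw [e]; exact T.inv2 _ h2)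
  have h34 : s₃ ≠ s₄ := fun e => hne (by rw [he, e]; exact T.inv2 _ h4)
  have h13 : s₁ ≠ s₃ := fun e => h24 (by rw [e] at he; exact mul_left_cancel he)
  by_cases e1 : s₁ = s₄
  · by_cases e2 : s₂ = s₃
    · exact ⟨s₁, h1, s₂, h2, h12, by rw [he, ← e1, ← e2]⟩
    · exfalso
      refine T.cj h1 h2 h3 h12 h13 e2 ?_
      rw [he, ← e1, mul_assoc, T.inv2 _ h1, mul_one]
  · exfalso
    have e2 : s₂ = s₃ := by
      by_contra e2
      have hm := h4
      rw [T.eq3 h1 h2 h3 h12 h13 e2] at hm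
      simp only [Finset.mem_insert, Finset.mem_singleton] at hm
      rcases hm with h | h | h
      · exact e1 h.symm
      · exact h24 h.symm
      · exact h34 h.symm
    refine T.cj h2 h1 h4 h12.symm h24 e1 ?_
    rw [mul_assoc, he, ← e2, ← mul_assoc, T.inv2 _ h2, one_mul]

theorem free4 (T : TII S) {p q c : Γ} (hp : p ∈ S) (hq : q ∈ S) (hc : c ∈ S) (hpq : p ≠ q)
    (hpc : p ≠ c) (hqc : q ≠ c) (hcm : p * q = q * p) :
    ∃ K z, FreeBlk S K c 4 ∧ Opp S K z := by
  have p2 := T.inv2 _ hp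
  have q2 := T.inv2 _ hq
  have c2 := T.inv2 _ hc
  have p1 := T.cub.ne_one hp
  have q1 := T.cub.ne_one hq
  have hE := T.eq3 hp hq hc hpq hpc hqc
  have z2 : p * q * (p * q) = 1 := by
    have : p * q * (p * q) = p * (q * p) * q := by group
    rw [this, ← hcm]
    have : p * (p * q) * q = (p * p) * (q * q) := by group
    rw [this, p2, q2, one_mul]
  set K := Subgroup.closure {s | s ∈ S ∧ s ≠ c} with hK
  have pK : p ∈ K := Subgroup.subset_closure ⟨hp, hpc⟩
  have qK : q ∈ K := Subgroup.subset_closure ⟨hq, hqc⟩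
  have pmul : ∀ k, (k = 1 ∨ k = p ∨ k = q ∨ k = p * q) → (p * k = 1 ∨ p * k = p ∨ p * k = q ∨ p * k = p * q) := by
    rintro k (rfl | rfl | rfl | rfl)
    · simp
    · left; exact p2
    · simp
    · rw [← mul_assoc, p2]; simp
  have qmul : ∀ k, (k = 1 ∨ k = p ∨ k = q ∨ k = p * q) → (q * k = 1 ∨ q * k = p ∨ q * k = q ∨ q * k = p * q) := by
    rintro k (rfl | rfl | rfl | rfl)
    · simp
    · rw [← hcm]; simp
    · left; exact q2
    · rw [hcm, ← mul_assoc, q2]; simp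
  have all : ∀ k ∈ K, k = 1 ∨ k = p ∨ k = q ∨ k = p * q := by
    have gs : ∀ s, s ∈ S ∧ s ≠ c → s = p ∨ s = q := by
      rintro s ⟨hs, hsc⟩
      rw [hE] at hs
      simp only [Finset.mem_insert, Finset.mem_singleton] at hs
      tauto
    intro k hk
    rw [hK] at hk
    induction hk using Subgroup.closure_induction_left with
    | one => simp
    | mul_left x hx y _ ih =>
      rcases gs x hx with rfl | rfl
      · exact pmul y ih
      · exact qmul y ih
    | inv_mul_cancel x hx y _ ih =>
      rw [T.inv_self hx.1]
      rcases gs x hx with rfl | rfl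
      · exact pmul y ih
      · exact qmul y ih
  have zc : ∀ {u v : Γ}, c * u * c = v → u = c * v * c := by
    rintro u v rfl
    have : c * (c * u * c) * c = (c * c) * u * (c * c) := by group
    rw [this, c2]; simp
  have comm_of : ∀ {u : Γ}, c * u * c = u → u * c = c * u := by
    intro u h
    nth_rewrite 1 [← h]
    rw [mul_assoc, c2, mul_one]
  have cmul : ∀ u v : Γ, c * (u * v) * c = (c * u * c) * (c * v * c) := by
    intro u v
    have : (c * u * c) * (c * v * c) = c * u * (c * c) * v * c := by group
    rw [this, c2]; group
  have one_of : ∀ {u : Γ}, c * u * c = 1 → u = 1 := by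
    intro u h; have := zc h; rwa [mul_one, c2] at this
  have pz : p * q ≠ 1 := by
    intro h
    exact hpq (by rw [← inv_eq_of_mul_eq_one_left h]; exact (T.inv_self hq).symm ▸ rfl)
  have zp : p * q ≠ p := fun h => q1 (by simpa using h)
  have zq : p * q ≠ q := fun h => p1 (by simpa using h)
  refine ⟨K, p * q, ⟨hc, c2, ?_, Or.inl rfl, rfl, ?_⟩, ⟨mul_mem pK qK, pz, z2, ?_, T.tri p hp q hq⟩⟩
  · have : (K : Set Γ) = (({1, p, q, p * q} : Finset Γ) : Set Γ) := by
      ext k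
      simp only [SetLike.mem_coe, Finset.coe_insert, Finset.coe_singleton, Set.mem_insert_iff,
        Set.mem_singleton_iff]
      refine ⟨all k, ?_⟩
      rintro (rfl | rfl | rfl | rfl)
      · exact K.one_mem
      · exact pK
      · exact qK
      · exact mul_mem pK qK
    have h2 : Nat.card K = Nat.card (K : Set Γ) := rfl
    rw [h2, this, Nat.card_coe_set_eq, Set.ncard_coe_finset]
    rw [Finset.card_insert_of_notMem, Finset.card_insert_of_notMem, Finset.card_pair (Ne.symm zq)]
    · simp only [Finset.mem_insert, Finset.mem_singleton, not_or]
      exact ⟨hpq, Ne.symm zp⟩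
    · simp only [Finset.mem_insert, Finset.mem_singleton, not_or]
      exact ⟨Ne.symm p1, Ne.symm q1, Ne.symm pz⟩
  · intro k hk hck
    have P : c * p * c ∉ K := by
      intro h
      rcases all _ h with h | h | h | h
      · exact p1 (one_of h)
      · exact T.nlad hp hq hc hpq hpc hqc hcm (comm_of h)
      · exact T.cj hc hp hq hpc.symm hqc.symm hpq h
      · have : c * q * c = q := by
          have h2 := zc h
          rw [cmul, h] at h2
          have : c * q * c = (p * q)⁻¹ * p := by nth_rewrite 2 [h2]; group
          rw [this, mul_inv_rev, T.inv_self hp, T.inv_self hq, mul_assoc, p2, mul_one]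
        exact T.nlad hq hp hc hpq.symm hqc hpc hcm.symm (comm_of this)
    have Q : c * q * c ∉ K := by
      intro h
      rcases all _ h with h | h | h | h
      · exact q1 (one_of h)
      · exact T.cj hc hq hp hqc.symm hpc.symm hpq.symm h
      · exact T.nlad hq hp hc hpq.symm hqc hpc hcm.symm (comm_of h)
      · have : c * p * c = p := by
          have h2 := zc h
          rw [cmul, h] at h2
          have : c * p * c = q * (p * q)⁻¹ := by nth_rewrite 1 [h2]; group
          rw [this, hcm, mul_inv_rev, T.inv_self hp, T.inv_self hq, hcm, ← mul_assoc, q2, one_mul]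
        exact T.nlad hp hq hc hpq hpc hqc hcm (comm_of this)
    rcases all k hk with rfl | rfl | rfl | rfl
    · rfl
    · exact absurd hck P
    · exact absurd hck Q
    · exfalso
      rcases all _ hck with h | h | h | h
      · exact pz (one_of h)
      · exact P (by rw [← zc h]; exact mul_mem pK qK)
      · exact Q (by rw [← zc h]; exact mul_mem pK qK)
      · have := lemmaQ T.cub T.nb (x := p) (c := c) (z := p * q) z2
          (by rw [mul_assoc, ← hcm]) (comm_of h) (Or.inl p2) c2 (by
            intro s hs
            rw [hE] at hs
            simp only [Finset.mem_insert, Finset.mem_singleton] at hs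
            rw [hcm, mul_assoc, p2, mul_one]
            tauto)
        exact T.nlad hp hq hc hpq hpc hqc hcm this
  · intro k hk
    rcases all k hk with rfl | rfl | rfl | rfl
    · simp
    · right; right; exact hp
    · right; right; exact hq
    · simp
end TII

theorem classify {S : Finset Γ} (hS : Cub S) (ht : TriFree S) (hnb : NonBip S) :
    Ladder S ∨ ∃ c ∈ S, c * c = 1 ∧ No5a S c ∧
      ((No4 S ∧ (No5 S ∨ ∃ K, FreeBlk S K c 5)) ∨ ∃ K z, FreeBlk S K c 4 ∧ Opp S K z) := by
  by_cases hL : Ladder S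
  · exact Or.inl hL
  right
  rcases two_types hS with ⟨a, b, he, a2, b2, hab, hab'⟩ | ⟨x, y, w, he, hx, hy, hw, hxy, hxw, hyw⟩
  · have T : TI S a b := ⟨he, a2, b2, hab, hab',
      fun h => hL (Or.inl ⟨a, b, he, a2, b2, Or.inl h⟩),
      fun h => hL (Or.inl ⟨a, b, he, a2, b2, Or.inr h⟩)⟩
    refine ⟨a, T.ma, a2, T.no5a hS ht, ?_⟩
    by_cases h4 : b ^ 4 = 1
    · right
      exact ⟨_, _, T.free4 hS hnb h4⟩
    · left
      refine ⟨T.no4 hS h4, ?_⟩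
      by_cases h5 : b ^ 5 = 1
      · exact Or.inr ⟨_, T.free5 hS ht h5⟩
      · exact Or.inl (T.no5 hS ht h5)
  · have T : TII S := ⟨hS, ht, hnb, by
      intro s hs
      rw [he] at hs
      simp only [Finset.mem_insert, Finset.mem_singleton] at hs
      rcases hs with rfl | rfl | rfl <;> assumption, hL⟩
    have mx : x ∈ S := by rw [he]; simp
    by_cases h4 : No4 S
    · exact ⟨x, mx, hx, T.no5a mx, Or.inl ⟨h4, Or.inl T.no5⟩⟩
    · obtain ⟨p, hp, q, hq, hpq, hcm⟩ := T.not_no4 h4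
      obtain ⟨c, hc⟩ : ∃ c, c ∈ S \ {p, q} := by
        rw [← Finset.Nonempty, ← Finset.card_pos]
        have := Finset.le_card_sdiff {p, q} S
        have h2 := Finset.card_pair hpq
        have := hS.card
        omega
      simp only [Finset.mem_sdiff, Finset.mem_insert, Finset.mem_singleton, not_or] at hc
      exact ⟨c, hc.1, T.inv2 _ hc.1, T.no5a hc.1, Or.inr
        (T.free4 hp hq hc.1 hpq (Ne.symm hc.2.1) (Ne.symm hc.2.2) hcm)⟩
end ClassPart2

open SimpleGraph
set_option linter.unusedSectionVars false
set_option linter.unusedSimpArgs false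
section CaseBPart
variable {Γ : Type*} [Group Γ] [Fintype Γ] [DecidableEq Γ]

theorem caseB_two {S Y : Finset Γ} (hS : Cub S) (hY : ∀ y ∈ Y, ∀ s ∈ S, s * y ∉ Y)
    (hc : Fintype.card Γ = 2 * Y.card + 2) {s : Γ} (hs : s ∈ S) :
    (Finset.univ.filter (fun x => x ∉ Y ∧ s * x ∉ Y)).card = 2 := by
  have h1 : (Finset.univ.filter (fun x => x ∉ Y ∧ s * x ∈ Y)).card = Y.card := by
    apply Finset.card_bij (fun x _ => s * x)
    · intro x hx; simp only [Finset.mem_filter] at hx; exact hx.2.2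
    · intro x _ y _ h; exact mul_left_cancel h
    · intro y hy
      refine ⟨s⁻¹ * y, ?_, by simp⟩
      simp only [Finset.mem_filter, Finset.mem_univ, true_and]
      exact ⟨hY y hy _ (hS.inv s hs), by simpa using hy⟩
  have h2 := Finset.card_add_card_compl Y
  have h3 : Yᶜ = Finset.univ.filter (fun x => x ∉ Y ∧ s * x ∈ Y) ∪
      Finset.univ.filter (fun x => x ∉ Y ∧ s * x ∉ Y) := by
    ext x; simp; tauto
  rw [h3, Finset.card_union_of_disjoint, h1] at h2
  · omega
  · rw [Finset.disjoint_filter]; tauto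

/-- closed words -/
def CW (S : Finset Γ) (l : List Γ) : Prop := (∀ s ∈ l, s ∈ S) ∧ l.prod = 1

theorem caseB_word {S Y : Finset Γ} (hS : Cub S) (hY : ∀ y ∈ Y, ∀ s ∈ S, s * y ∉ Y)
    (hc : Fintype.card Γ = 2 * Y.card + 2) {l : List Γ} (hl : CW S l) (hodd : Odd l.length) :
    Fintype.card Γ ≤ 2 * l.length := by
  have step : ∀ i (hi : i < l.length), (l.drop i).prod = l[i] * (l.drop (i+1)).prod := by
    intro i hi
    rw [List.drop_eq_getElem_cons hi, List.prod_cons]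
  let B : ℕ → Finset Γ := fun i => Finset.univ.filter
    (fun g => (l.drop i).prod * g ∉ Y ∧ (l.drop (i+1)).prod * g ∉ Y)
  have hB : ∀ i ∈ Finset.range l.length, (B i).card ≤ 2 := by
    intro i hi
    rw [Finset.mem_range] at hi
    rw [← caseB_two hS hY hc (hl.1 _ (List.getElem_mem hi))]
    apply Finset.card_le_card_of_injOn (fun g => (l.drop (i+1)).prod * g)
    · intro g hg
      simp only [B, Finset.coe_filter, Finset.mem_univ, true_and, Set.mem_ofPred_eq] at hg ⊢
      refine ⟨hg.2, ?_⟩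
      rw [← mul_assoc, ← step i hi]; exact hg.1
    · intro x _ y _ h; exact mul_left_cancel h
  have hU : (Finset.univ : Finset Γ) ⊆ (Finset.range l.length).biUnion B := by
    intro g _
    by_contra hcon
    simp only [B, Finset.mem_biUnion, Finset.mem_range, Finset.mem_filter, Finset.mem_univ,
      true_and, not_exists, not_and, not_not] at hcon
    have alt : ∀ i ≤ l.length, ((l.drop i).prod * g ∈ Y ↔ (Even i ↔ g ∈ Y)) := by
      intro i
      induction i with
      | zero => intro _; simp [hl.2]
      | succ i ih =>
        intro hi
        have ih := ih (by omega)
        have h1 := hcon i (by omega)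
        have h2 : (l.drop i).prod * g ∈ Y → (l.drop (i+1)).prod * g ∉ Y := by
          intro h h'
          rw [step i (by omega), mul_assoc] at h
          exact hY _ h' _ (hl.1 _ (List.getElem_mem _)) h
        rw [Nat.even_add_one]
        tauto
    have := alt l.length le_rfl
    rw [List.drop_length] at this
    have hne : ¬ Even l.length := by rwa [Nat.not_even_iff_odd]
    simp at this
    tauto
  calc Fintype.card Γ = (Finset.univ : Finset Γ).card := rfl
    _ ≤ ((Finset.range l.length).biUnion B).card := Finset.card_le_card hU
    _ ≤ ∑ i ∈ Finset.range l.length, (B i).card := Finset.card_biUnion_le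
    _ ≤ ∑ i ∈ Finset.range l.length, 2 := Finset.sum_le_sum hB
    _ = 2 * l.length := by simp [mul_comm]

/-- reachable by a walk of length `k` -/
def Wk (S : Finset Γ) (k : ℕ) (x y : Γ) : Prop :=
  ∃ l : List Γ, l.length = k ∧ (∀ s ∈ l, s ∈ S) ∧ y = l.prod * x

theorem Wk.trans {S : Finset Γ} {k m : ℕ} {x y z : Γ} (h : Wk S k x y) (h' : Wk S m y z) :
    Wk S (k + m) x z := by
  obtain ⟨l, h1, h2, h3⟩ := h
  obtain ⟨l', h1', h2', h3'⟩ := h'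
  refine ⟨l' ++ l, by simp [h1, h1', add_comm], ?_, by rw [h3', h3, List.prod_append, mul_assoc]⟩
  intro s hs
  rcases List.mem_append.1 hs with h | h
  · exact h2' s h
  · exact h2 s h

theorem Wk.one {S : Finset Γ} {s : Γ} (hs : s ∈ S) (x : Γ) : Wk S 1 x (s * x) :=
  ⟨[s], by simp, by simpa using hs, by simp⟩

theorem Wk.zero {S : Finset Γ} (x : Γ) : Wk S 0 x x := ⟨[], by simp, by simp, by simp⟩

theorem Wk.symm {S : Finset Γ} (hS : Cub S) {k : ℕ} {x y : Γ} (h : Wk S k x y) : Wk S k y x := by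
  obtain ⟨l, h1, h2, h3⟩ := h
  refine ⟨(l.map (·⁻¹)).reverse, by simp [h1], ?_, ?_⟩
  · intro s hs
    simp only [List.mem_reverse, List.mem_map] at hs
    obtain ⟨t, ht, rfl⟩ := hs
    exact hS.inv t (h2 t ht)
  · rw [← List.prod_inv_reverse, h3]; simp

theorem exists_odd_word {S : Finset Γ} (hS : Cub S) (hnb : NonBip S) :
    ∃ l, CW S l ∧ Odd l.length := by
  obtain ⟨x, ⟨k, hk, h1⟩, m, hm, h2⟩ := nb_lemma hS hnb (fun x => ∃ k, Even k ∧ Wk S k 1 x)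
    (fun x => ∃ k, Odd k ∧ Wk S k 1 x) 1 ⟨0, by simp, Wk.zero 1⟩
    (by
      rintro s hs x ⟨k, hk, h⟩
      exact ⟨k + 1, hk.add_one, h.trans (Wk.one hs x)⟩)
    (by
      rintro s hs x ⟨k, hk, h⟩
      exact ⟨k + 1, hk.add_one, h.trans (Wk.one hs x)⟩)
  obtain ⟨l, a, b, c⟩ := h1.trans (h2.symm hS)
  exact ⟨l, ⟨b, by simpa using c.symm⟩, by rw [a]; exact hk.add_odd hm⟩

/-- the shortest odd closed word, in a four-cycle-free graph, has length at most `N/2` -/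
theorem short_word {S : Finset Γ} (hS : Cub S) (h4 : No4 S) {l : List Γ} (hl : CW S l)
    (hodd : Odd l.length) (hmin : ∀ l', CW S l' → Odd l'.length → l.length ≤ l'.length) :
    2 * l.length ≤ Fintype.card Γ := by
  set L := l.length with hL
  have hLpos : 0 < L := hodd.pos
  have hmin' : ∀ k x, Odd k → Wk S k x x → L ≤ k := by
    rintro k x hk ⟨l', h1, h2, h3⟩
    rw [← h1]
    exact hmin l' ⟨h2, by simpa using h3.symm⟩ (by rw [h1]; exact hk)
  let p : ℕ → Γ := fun i => (l.drop (i % L)).prod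
  have hper : ∀ i, p (i + L) = p i := fun i => by simp [p]
  have hstep : ∀ i, p (i + 1) * (p i)⁻¹ ∈ S := by
    intro i
    have hi := Nat.mod_lt i hLpos
    have h1 : p i = l[i % L] * (l.drop (i % L + 1)).prod := by
      show (l.drop (i % L)).prod = _
      rw [List.drop_eq_getElem_cons hi, List.prod_cons]
    have h2 : p (i + 1) = (l.drop (i % L + 1)).prod := by
      show (l.drop ((i + 1) % L)).prod = _
      by_cases h : i % L + 1 = L
      · have : (i + 1) % L = 0 := by
          rw [Nat.add_mod]
          rcases Nat.lt_or_ge 1 L with h' | h'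
          · rw [Nat.mod_eq_of_lt h', h, Nat.mod_self]
          · have : L = 1 := by omega
            rw [this]; omega
        rw [this, h, hL, List.drop_length, List.drop_zero, hl.2]; simp
      · have : (i + 1) % L = i % L + 1 := by
          rw [Nat.add_mod, Nat.mod_eq_of_lt (show 1 < L by omega), Nat.mod_eq_of_lt (by omega)]
        rw [this]
    rw [h1, h2, mul_inv_rev]
    simpa using hS.inv _ (hl.1 _ (List.getElem_mem hi))
  have walk : ∀ i d, Wk S d (p i) (p (i + d)) := by
    intro i d
    induction d with
    | zero => exact Wk.zero _
    | succ d ih =>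
      have := ih.trans (Wk.one (hstep (i + d)) _)
      simpa [add_assoc] using this
  have key : ∀ i d k, 0 < d → d < L → Wk S k (p i) (p (i + d)) →
      (Odd (k + d) → L ≤ k + d) ∧ (Even (k + d) → d ≤ k) := by
    intro i d k hd hdL hw
    refine ⟨fun h => hmin' _ _ h (hw.trans ((walk i d).symm hS)), fun h => ?_⟩
    have w2 := walk (i + d) (L - d)
    rw [show i + d + (L - d) = i + L by omega, hper] at w2
    have := hmin' (k + (L - d)) _ (by
      rw [Nat.even_iff] at h
      rw [Nat.odd_iff] at hodd ⊢
      omega) (hw.trans w2)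
    omega
  have hpinj : ∀ i d, 0 < d → d < L → p i ≠ p (i + d) := by
    intro i d hd hdL he
    have := key i d 0 hd hdL (by rw [← he]; exact Wk.zero _)
    rcases Nat.even_or_odd (0 + d) with h | h
    · have := this.2 h; omega
    · have := this.1 h; omega
  have ht : ∀ i, ∃ t ∈ S, t ≠ p (i + 1) * (p i)⁻¹ ∧ t ≠ p (i + L - 1) * (p i)⁻¹ := by
    intro i
    obtain ⟨t, ht⟩ : ∃ t, t ∈ S \ {p (i + 1) * (p i)⁻¹, p (i + L - 1) * (p i)⁻¹} := by
      rw [← Finset.Nonempty, ← Finset.card_pos]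
      have := Finset.le_card_sdiff {p (i + 1) * (p i)⁻¹, p (i + L - 1) * (p i)⁻¹} S
      have h2 : ({p (i + 1) * (p i)⁻¹, p (i + L - 1) * (p i)⁻¹} : Finset Γ).card ≤ 2 :=
        Finset.card_le_two
      have := hS.card
      omega
    simp only [Finset.mem_sdiff, Finset.mem_insert, Finset.mem_singleton, not_or] at ht
    exact ⟨t, ht.1, ht.2⟩
  choose t htS ht1 ht2 using ht
  let n : ℕ → Γ := fun i => t i * p i
  have quad : ∀ i j, n i = n j → p (i + 2) = p j → p i ≠ p j → False := by
    intro i j hn hp hne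
    apply ht1 i
    symm
    have e1 : p (i + 2) * (p (i + 1))⁻¹ * (p (i + 1) * (p i)⁻¹) = (t j)⁻¹ * t i := by
      have : (t j)⁻¹ * t i = (t j)⁻¹ * (t i * p i) * (p i)⁻¹ := by group
      rw [this, show t i * p i = t j * p j from hn, hp]; group
    refine h4 _ (hstep (i + 1)) _ (hstep i) _ (hS.inv _ (htS j)) _ (htS i) e1 ?_
    intro h
    apply hne
    have : p (i + 2) * (p (i + 1))⁻¹ * (p (i + 1) * (p i)⁻¹) = p (i + 2) * (p i)⁻¹ := by group
    rw [this, hp] at h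
    exact (mul_inv_eq_one.1 h).symm
  have hninj : ∀ i d, 0 < d → d < L → n i ≠ n (i + d) := by
    intro i d hd hdL he
    have w : Wk S 2 (p i) (p (i + d)) := by
      have w1 := Wk.one (htS i) (p i)
      have w2 := Wk.one (htS (i + d)) (p (i + d))
      have e : t i * p i = t (i + d) * p (i + d) := he
      rw [e] at w1
      exact w1.trans (w2.symm hS)
    have hk := key i d 2 hd hdL w
    have hne := hpinj i d hd hdL
    rcases Nat.even_or_odd (2 + d) with h | h
    · have h1 := hk.2 h
      have : d = 2 := by rw [Nat.even_iff] at h; omega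
      subst this
      exact quad i (i + 2) he rfl hne
    · have h1 := hk.1 h
      have : d + 2 = L := by rw [Nat.odd_iff] at h hodd; omega
      refine quad (i + d) i he.symm ?_ hne.symm
      rw [add_assoc, this, hper]
  have hdisj : ∀ i < L, ∀ j < L, n i ≠ p j := by
    intro i hi j hj he
    have he : t i * p i = p j := he
    rcases lt_trichotomy i j with h | h | h
    · obtain ⟨d, rfl⟩ : ∃ d, j = i + d := ⟨j - i, by omega⟩
      have hk := key i d 1 (by omega) (by omega) (by rw [← he]; exact Wk.one (htS i) _)
      rcases Nat.even_or_odd (1 + d) with h' | h'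
      · have h1 := hk.2 h'
        have : d = 1 := by omega
        subst this
        exact ht1 i (by rw [← he]; group)
      · have h1 := hk.1 h'
        have : d = L - 1 := by omega
        subst this
        apply ht2 i
        rw [show i + L - 1 = i + (L - 1) by omega, ← he]; group
    · subst h
      exact hS.ne_one (htS i) (by simpa using he)
    · obtain ⟨d, rfl⟩ : ∃ d, i = j + d := ⟨i - j, by omega⟩
      have hk := key j d 1 (by omega) (by omega) (by
        rw [← he]; exact (Wk.one (htS (j + d)) _).symm hS)
      rcases Nat.even_or_odd (1 + d) with h' | h'
      · have h1 := hk.2 h'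
        have : d = 1 := by omega
        subst this
        apply ht2 (j + 1)
        rw [show j + 1 + L - 1 = j + L by omega, hper, ← he]; group
      · have h1 := hk.1 h'
        have : d + 1 = L := by omega
        apply ht1 (j + d)
        rw [add_assoc, this, hper, ← he]; group
  have inj : ∀ f : ℕ → Γ, (∀ i d, 0 < d → d < L → f i ≠ f (i + d)) →
      ((Finset.range L).image f).card = L := by
    intro f hf
    rw [Finset.card_image_of_injOn, Finset.card_range]
    intro i hi j hj hij
    simp only [Finset.coe_range, Set.mem_Iio] at hi hj
    by_contra hne
    rcases lt_or_gt_of_ne hne with h | h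
    · exact hf i (j - i) (by omega) (by omega) (by rw [hij]; congr 1; omega)
    · exact hf j (i - j) (by omega) (by omega) (by rw [← hij]; congr 1; omega)
  have hd : Disjoint ((Finset.range L).image n) ((Finset.range L).image p) := by
    rw [Finset.disjoint_left]
    intro x hx hx'
    simp only [Finset.mem_image, Finset.mem_range] at hx hx'
    obtain ⟨i, hi, rfl⟩ := hx
    obtain ⟨j, hj, h⟩ := hx'
    exact hdisj i hi j hj h.symm
  have := Finset.card_le_univ (((Finset.range L).image n) ∪ ((Finset.range L).image p))
  rw [Finset.card_union_of_disjoint hd, inj n hninj, inj p hpinj] at this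
  omega

/-- sign of left multiplication by an involution -/
theorem sign_inv {a : Γ} (ha : a * a = 1) (ha1 : a ≠ 1) {L : ℕ} (hN : Fintype.card Γ = 2 * L)
    (hodd : Odd L) : Equiv.Perm.sign (MulAction.toPermHom Γ Γ a) = -1 := by
  rw [Equiv.Perm.sign_of_pow_two_eq_one]
  · have : Fintype.card (Function.fixedPoints (MulAction.toPermHom Γ Γ a)) = 0 := by
      rw [Fintype.card_eq_zero_iff]
      refine ⟨fun ⟨x, hx⟩ => ha1 ?_⟩
      have hx : a * x = x := hx
      simpa using hx
    rw [this, Nat.sub_zero, hN, Nat.mul_div_cancel_left _ (by norm_num)]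
    exact hodd.neg_one_pow
  · rw [← map_pow, pow_two, ha, map_one]

theorem caseB_no4 {S : Finset Γ} (hS : Cub S) (hnb : NonBip S) (h4 : No4 S) (hB : CaseB S) :
    False := by
  obtain ⟨Y, hY, hc⟩ := hB
  classical
  have hex : ∃ n, ∃ l, CW S l ∧ Odd l.length ∧ l.length = n := by
    obtain ⟨l, h1, h2⟩ := exists_odd_word hS hnb
    exact ⟨_, l, h1, h2, rfl⟩
  obtain ⟨l, hl, hodd, hlen⟩ := Nat.find_spec hex
  have hmin : ∀ l', CW S l' → Odd l'.length → l.length ≤ l'.length := by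
    intro l' h1 h2
    rw [hlen]
    exact Nat.find_min' hex ⟨l', h1, h2, rfl⟩
  have u1 := caseB_word hS hY hc hl hodd
  have u2 := short_word hS h4 hl hodd hmin
  set L := l.length with hL
  have hN : Fintype.card Γ = 2 * L := by omega
  let φ : Γ →* ℤˣ := (Equiv.Perm.sign (α := Γ)).comp (MulAction.toPermHom Γ Γ)
  have hφ : ∀ a ∈ S, a * a = 1 → φ a = -1 := fun a ha h => sign_inv h (hS.ne_one ha) hN hodd
  have hbip : (∀ s ∈ S, φ s = -1) → False := by
    intro h
    apply hnb
    refine ⟨fun x => decide (φ x = 1), fun s hs x he => ?_⟩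
    rw [decide_eq_decide, map_mul, h s hs] at he
    rcases Int.units_eq_one_or (φ x) with h' | h' <;> rw [h'] at he <;> simp at he <;> revert he <;> decide
  rcases two_types hS with ⟨a, b, he, a2, b2, hab, hab'⟩ | ⟨x, y, w, he, hx, hy, hw, _⟩
  swap
  · apply hbip
    intro s hs
    apply hφ s hs
    rw [he] at hs
    simp only [Finset.mem_insert, Finset.mem_singleton] at hs
    rcases hs with rfl | rfl | rfl <;> assumption
  have ma : a ∈ S := by rw [he]; simp
  have mb : b ∈ S := by rw [he]; simp
  have mB : b⁻¹ ∈ S := by rw [he]; simp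
  have b1 : b ≠ 1 := hS.ne_one mb
  have φa := hφ a ma a2
  have φb : φ b = 1 := by
    rcases Int.units_eq_one_or (φ b) with h | h
    · exact h
    · exfalso
      apply hbip
      intro s hs
      rw [he] at hs
      simp only [Finset.mem_insert, Finset.mem_singleton] at hs
      rcases hs with rfl | rfl | rfl
      · exact φa
      · exact h
      · rw [map_inv, h]; rfl
  -- kernel
  have hker : φ.ker.index = 2 := by
    rw [Subgroup.index_ker]
    have : φ.range = ⊤ := by
      rw [eq_top_iff]
      intro u _
      rcases Int.units_eq_one_or u with h | h
      · exact ⟨1, by rw [h, map_one]⟩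
      · exact ⟨a, by rw [h, φa]⟩
    rw [this]
    simp
  have hkc : Nat.card φ.ker = L := by
    have := φ.ker.card_mul_index
    rw [hker, Nat.card_eq_fintype_card (α := Γ), hN] at this
    omega
  set m := orderOf b with hm
  have hmL : m ∣ L := by
    rw [← hkc]
    exact Subgroup.orderOf_dvd_natCard _ (by rw [MonoidHom.mem_ker]; exact φb)
  have hmodd : Odd m := Odd.of_dvd_nat hodd hmL
  have hmpos := hmodd.pos
  have hbm : b ^ m = 1 := pow_orderOf_eq_one b
  have hLm : L = m := by
    have h1 := caseB_word hS hY hc (l := List.replicate m b)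
      ⟨by intro s hs; rw [List.eq_of_mem_replicate hs]; exact mb, by simp [hbm]⟩ (by simpa using hmodd)
    simp only [List.length_replicate] at h1
    have := Nat.le_of_dvd hodd.pos hmL
    omega
  have hmin2 : ∀ l', CW S l' → Odd l'.length → m ≤ l'.length := by
    intro l' h1 h2; rw [← hLm]; exact hmin l' h1 h2
  have hz : Nat.card (Subgroup.zpowers b) = m := Nat.card_zpowers b
  have hidx : (Subgroup.zpowers b).index = 2 := by
    have := (Subgroup.zpowers b).card_mul_index
    rw [hz, Nat.card_eq_fintype_card (α := Γ), hN, hLm, mul_comm 2] at this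
    exact Nat.eq_of_mul_eq_mul_left hmpos this
  have hnormal : (Subgroup.zpowers b).Normal := Subgroup.normal_of_index_eq_two hidx
  have ai : a⁻¹ = a := inv_eq_of_mul_eq_one_left a2
  have hconj : a * b * a ∈ Subgroup.zpowers b := by
    have := hnormal.conj_mem b (Subgroup.mem_zpowers b) a
    rwa [ai] at this
  obtain ⟨i, hi, hab2⟩ := TI.pow_cases m hmpos hbm hconj
  have hcomm : a * b ≠ b * a := by
    intro h
    have := h4 a ma b mb b mb a ma h (fun h' => hab' (eq_inv_of_mul_eq_one_left h'))
    exact hab this.symm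
  have hconj1 : a * b * a ≠ b⁻¹ := by
    intro h
    have h' : a * b = b⁻¹ * a := by
      rw [← h, mul_assoc (a * b), a2, mul_one]
    have := h4 a ma b mb _ mB a ma h' (fun h' => hab' (eq_inv_of_mul_eq_one_left h'))
    exact hab this.symm
  have i1 : i ≠ 1 := by
    rintro rfl
    rw [pow_one] at hab2
    apply hcomm
    nth_rewrite 2 [← hab2]
    rw [mul_assoc (a * b), a2, mul_one]
  have i2 : i + 1 ≠ m := by
    intro h
    apply hconj1
    rw [hab2]
    apply eq_inv_of_mul_eq_one_left
    rw [← pow_succ, h, hbm]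
  have hwd : ∀ (s : Γ), s ∈ S → ∀ k, a * b * a * s ^ k = 1 → Even k → m ≤ k + 3 := by
    intro s hs k h hk
    have := hmin2 (a :: b :: a :: List.replicate k s) ⟨by
      intro t ht
      simp only [List.mem_cons, List.mem_replicate] at ht
      rcases ht with rfl | rfl | rfl | ⟨_, rfl⟩ <;> assumption, by
      simpa [mul_assoc] using h⟩ (by
        simp only [List.length_cons, List.length_replicate]
        rw [Nat.even_iff] at hk; rw [Nat.odd_iff]; omega)
    simp only [List.length_cons, List.length_replicate] at this
    omega
  have b9 : ∀ e : ℤ, a * b * a = b ^ e → b ^ (e * e) = b := by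
    intro e h
    have hp : a * b ^ e * a = (a * b * a) ^ e := by
      have := conj_zpow (a := a) (b := b) (i := e)
      rw [ai] at this
      exact this.symm
    rw [h, ← zpow_mul, ← h] at hp
    rw [← hp]
    have : a * (a * b * a) * a = (a * a) * b * (a * a) := by group
    rw [this, a2]; simp
  have fin : b ^ (9 : ℤ) = b → False := by
    intro h
    have h8 : b ^ 8 = 1 := by
      have : b ^ 8 * b = 1 * b := by
        rw [← pow_succ, one_mul]
        exact_mod_cast h
      exact mul_right_cancel this
    have hd := orderOf_dvd_of_pow_eq_one h8
    have hcop : Nat.Coprime m 8 := by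
      have : Nat.Coprime m (2 ^ 3) := Nat.Coprime.pow_right _ hmodd.coprime_two_right
      exact this
    have : m = 1 := Nat.Coprime.eq_one_of_dvd hcop hd
    exact b1 (orderOf_eq_one_iff.1 this)
  rcases Nat.even_or_odd i with h | h
  · have h3 := hwd b⁻¹ mB i (by rw [hab2]; simp) h
    have : i + 3 = m := by
      rw [Nat.even_iff] at h; rw [Nat.odd_iff] at hmodd; omega
    apply fin
    apply b9 (-3)
    rw [hab2, zpow_neg]
    apply eq_inv_of_mul_eq_one_left
    rw [show (3 : ℤ) = ((3 : ℕ) : ℤ) from rfl, zpow_natCast, ← pow_add, this, hbm]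
  · have h3 := hwd b mb (m - i) (by rw [hab2, ← pow_add, Nat.add_sub_cancel' hi.le, hbm]) (by
      rw [Nat.even_iff]; rw [Nat.odd_iff] at hmodd h; omega)
    have : i = 3 := by
      rw [Nat.odd_iff] at h; omega
    apply fin
    apply b9 3
    rw [hab2, this, show (3 : ℤ) = ((3 : ℕ) : ℤ) from rfl, zpow_natCast]
end CaseBPart

open SimpleGraph
set_option linter.unusedSectionVars false
set_option linter.unusedSimpArgs false
section CaseBPart2
variable {Γ : Type*} [Group Γ] [Fintype Γ] [DecidableEq Γ]

theorem sum_one_exists {ι : Type*} [Fintype ι] [DecidableEq ι] (f : ι → ℕ) (h : ∀ i, f i ≤ 2)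
    (hs : ∑ i, f i + 1 = 2 * Fintype.card ι) : ∃ i, f i = 1 ∧ ∀ j, j ≠ i → f j = 2 := by
  have h1 : ∑ i, (2 - f i) = 1 := by
    have : ∑ i, (2 - f i) + ∑ i, f i = 2 * Fintype.card ι := by
      rw [← Finset.sum_add_distrib, Finset.sum_congr rfl (fun i _ => Nat.sub_add_cancel (h i))]
      simp [mul_comm]
    omega
  obtain ⟨i, _, hi⟩ := Finset.exists_ne_zero_of_sum_ne_zero (s := Finset.univ) (f := fun i => 2 - f i)
    (by rw [h1]; norm_num)
  rw [← Finset.add_sum_erase _ _ (Finset.mem_univ i)] at h1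
  have h3 := h i
  refine ⟨i, by omega, fun j hj => ?_⟩
  have h2 : ∑ j ∈ Finset.univ.erase i, (2 - f j) = 0 := by omega
  rw [Finset.sum_eq_zero_iff] at h2
  have := h2 j (by simp [hj])
  have := h j
  omega

theorem FreeBlk.big {S : Finset Γ} {K : Subgroup Γ} {c : Γ} (F : FreeBlk S K c 4) (hS : Cub S) :
    20 ≤ Fintype.card Γ := by
  classical
  let KF : Finset Γ := Finset.univ.filter (· ∈ K)
  have hK : KF.card = 4 := by
    rw [← F.card, Nat.card_eq_fintype_card, Fintype.card_subtype]
  have hc : c⁻¹ = c := inv_eq_of_mul_eq_one_left F.c2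
  have h1 : ((KF ×ˢ KF).image (fun p => p.1 * c * p.2)).card = 16 := by
    rw [Finset.card_image_of_injOn, Finset.card_product, hK]
    rintro ⟨k, l⟩ h ⟨k', l'⟩ h' he
    simp only [KF, Finset.coe_product, Finset.coe_filter, Finset.mem_univ, true_and, Set.mem_prod,
      Set.mem_ofPred_eq] at h h' he
    have h2 : k'⁻¹ * k = 1 := by
      apply F.free _ (mul_mem (inv_mem h'.1) h.1)
      have : c * (k'⁻¹ * k) * c = c⁻¹ * k'⁻¹ * (k * c * l) * l⁻¹ := by rw [hc]; group
      rw [this, he]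
      have : c⁻¹ * k'⁻¹ * (k' * c * l') * l⁻¹ = l' * l⁻¹ := by group
      rw [this]
      exact mul_mem h'.2 (inv_mem h.2)
    have h3 : k = k' := (inv_mul_eq_one.1 h2).symm
    subst h3
    rw [mul_left_cancel he]
  have hd : Disjoint KF ((KF ×ˢ KF).image (fun p => p.1 * c * p.2)) := by
    rw [Finset.disjoint_left]
    intro x hx hx'
    simp only [KF, Finset.mem_image, Finset.mem_product, Finset.mem_filter, Finset.mem_univ, true_and,
      Prod.exists] at hx hx'
    obtain ⟨k, l, ⟨h, h'⟩, rfl⟩ := hx'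
    apply F.cK hS
    have : c = k⁻¹ * (k * c * l) * l⁻¹ := by group
    rw [this]
    exact mul_mem (mul_mem (inv_mem h) hx) (inv_mem h')
  have := Finset.card_le_univ (KF ∪ (KF ×ˢ KF).image (fun p => p.1 * c * p.2))
  rw [Finset.card_union_of_disjoint hd, hK, h1] at this
  exact this

theorem card_flip {c : Γ} (c2 : c * c = 1) (A : Finset Γ) :
    (Finset.univ.filter (fun x => ¬ (x ∈ A ↔ c * x ∈ A))).card = 2 * bd c A := by
  have hcc : ∀ x, c * (c * x) = x := fun x => by rw [← mul_assoc, c2, one_mul]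
  have h1 : Finset.univ.filter (fun x => ¬ (x ∈ A ↔ c * x ∈ A)) =
      A.filter (fun x => c * x ∉ A) ∪ (A.filter (fun x => c * x ∉ A)).image (fun x => c * x) := by
    ext x
    simp only [Finset.mem_filter, Finset.mem_univ, true_and, Finset.mem_union, Finset.mem_image]
    constructor
    · intro h
      by_cases hx : x ∈ A
      · left; tauto
      · right; exact ⟨c * x, ⟨by tauto, by rw [hcc]; exact hx⟩, hcc x⟩
    · rintro (h | ⟨y, h, rfl⟩)
      · tauto
      · rw [hcc]; tauto
  rw [h1, Finset.card_union_of_disjoint, Finset.card_image_of_injective _ (mul_right_injective c), bd]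
  · ring
  · rw [Finset.disjoint_left]
    intro x hx hx'
    simp only [Finset.mem_filter, Finset.mem_image] at hx hx'
    obtain ⟨y, hy, rfl⟩ := hx'
    exact hy.2 hx.1

theorem xor_aux (a b p q : Prop) : ¬ (¬ (a ↔ p) ↔ ¬ (b ↔ q)) ↔ ¬ ((a ↔ b) ↔ (p ↔ q)) := by
  by_cases a <;> by_cases b <;> by_cases p <;> by_cases q <;> simp [*]

theorem xor_aux2 (a b : Prop) (h : ¬ (a ↔ b)) : ¬ (¬ a ↔ ¬ b) := by tauto

theorem xor_aux3 (a b : Prop) (h : ¬ (a ↔ b)) : a ∨ b := by tauto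

set_option maxHeartbeats 2000000 in
theorem caseB_free4 {S : Finset Γ} (hS : Cub S) (ht : TriFree S) (hnb : NonBip S) {K : Subgroup Γ}
    {c z : Γ} (F : FreeBlk S K c 4) (O : Opp S K z) (hB : CaseB S) : False := by
  classical
  obtain ⟨Y, hY, hN⟩ := hB
  have hcc : ∀ x, c * (c * x) = x := fun x => by rw [← mul_assoc, F.c2, one_mul]
  have hzz : ∀ x, z * (z * x) = x := fun x => by rw [← mul_assoc, O.sq, one_mul]
  -- two points of `Y` in a block are opposite
  have opp : ∀ y ∈ Y, ∀ y' ∈ Y, blk K y = blk K y' → y = y' ∨ y = z * y' := by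
    intro y hy y' hy' h
    rw [blk_eq] at h
    rcases O.all _ h with h | h | h
    · left; exact mul_inv_eq_one.1 h
    · right; rw [← h]; group
    · exact absurd (by simpa using hy) (hY y' hy' _ h)
  have hq : 4 * Fintype.card (Γ ⧸ K) = Fintype.card Γ := by
    have := Subgroup.card_eq_card_quotient_mul_card_subgroup K
    rw [F.card, Nat.card_eq_fintype_card, Nat.card_eq_fintype_card] at this
    omega
  obtain ⟨β0, hβ0, hβ⟩ := sum_one_exists (fun β : Γ ⧸ K => (Y.filter (fun y => blk K y = β)).card)
    (by
      intro β
      by_contra hcon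
      push Not at hcon
      obtain ⟨x, hx, y, hy, w, hw, hxy, hxw, hyw⟩ := Finset.two_lt_card.1 hcon
      simp only [Finset.mem_filter] at hx hy hw
      rcases opp x hx.1 y hy.1 (hx.2.trans hy.2.symm) with h | h
      · exact hxy h
      · rcases opp x hx.1 w hw.1 (hx.2.trans hw.2.symm) with h' | h'
        · exact hxw h'
        · exact hyw (mul_left_cancel (h.symm.trans h')))
    (by
      rw [← Finset.card_eq_sum_card_fiberwise (fun x _ => Finset.mem_univ _)]
      omega)
  obtain ⟨y0, hy0⟩ := Finset.card_eq_one.1 hβ0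
  have hy0' : ∀ y, (y ∈ Y ∧ blk K y = β0) ↔ y = y0 := by
    intro y
    have := Finset.ext_iff.1 hy0 y
    simpa using this
  obtain ⟨hy0Y, hy0b⟩ := (hy0' y0).2 rfl
  set v0 := z * y0 with hv0
  have hzne : ∀ x, z * x ≠ x := fun x h => O.ne (by simpa using h)
  have hv0b : blk K v0 = β0 := by rw [hv0, blk_mul O.mem, hy0b]
  have hv0Y : v0 ∉ Y := fun h => hzne y0 ((hy0' v0).1 ⟨h, hv0b⟩)
  set Y1 := insert v0 Y with hY1
  have struc : ∀ x, ∃ y, blk K y = blk K x ∧ ∀ w, blk K w = blk K x → (w ∈ Y1 ↔ (w = y ∨ w = z * y)) := by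
    intro x
    by_cases hx : blk K x = β0
    · refine ⟨y0, by rw [hx, hy0b], fun w hw => ?_⟩
      rw [hY1, Finset.mem_insert]
      have := hy0' w
      rw [hw] at this
      tauto
    · obtain ⟨y, y', hne, he⟩ := Finset.card_eq_two.1 (hβ _ hx)
      have he' : ∀ w, (w ∈ Y ∧ blk K w = blk K x) ↔ (w = y ∨ w = y') := by
        intro w
        have := Finset.ext_iff.1 he w
        simpa using this
      have m1 := (he' y).2 (Or.inl rfl)
      have m2 := (he' y').2 (Or.inr rfl)
      have e : y' = z * y := by
        rcases opp y' m2.1 y m1.1 (m2.2.trans m1.2.symm) with h | h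
        · exact absurd h.symm hne
        · exact h
      refine ⟨y, m1.2, fun w hw => ?_⟩
      rw [hY1, Finset.mem_insert, ← e, ← he' w]
      constructor
      · rintro (h | h)
        · exact absurd (by rw [← hw, h, hv0b]) hx
        · exact ⟨h, hw⟩
      · rintro ⟨h, _⟩; exact Or.inr h
  have Pz : ∀ x, z * x ∈ Y1 ↔ x ∈ Y1 := by
    intro x
    obtain ⟨y, h1, h2⟩ := struc x
    rw [h2 x rfl, h2 (z * x) (blk_mul O.mem)]
    constructor
    · rintro (h | h)
      · right; rw [← h, hzz]
      · left; exact mul_left_cancel h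
    · rintro (h | h)
      · right; rw [h]
      · left; rw [h, hzz]
  have Ps : ∀ s ∈ S, s ∈ K → ∀ x, (s * x ∈ Y1 ↔ x ∉ Y1) := by
    intro s hs hsK x
    obtain ⟨y, h1, h2⟩ := struc x
    rw [h2 x rfl, h2 (s * x) (blk_mul hsK)]
    have hxK : x * y⁻¹ ∈ K := blk_eq.1 h1.symm
    constructor
    · rintro h (h' | h')
      · rw [h'] at h
        rcases h with h | h
        · exact hS.ne_one hs (by simpa using h)
        · exact O.notS (mul_right_cancel h ▸ hs)
      · rw [h'] at h
        rcases h with h | h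
        · have : s * z = 1 := by rw [← mul_assoc] at h; simpa using h
          have := eq_inv_of_mul_eq_one_left this
          rw [inv_eq_of_mul_eq_one_left O.sq] at this
          exact O.notS (this ▸ hs)
        · exact hS.ne_one hs (by simpa using h)
    · intro h
      push Not at h
      rcases O.all _ hxK with h' | h' | h'
      · exact absurd (mul_inv_eq_one.1 h') h.1
      · exact absurd (by rw [← h']; group) h.2
      · rcases O.all _ (mul_mem hsK hxK) with h3 | h3 | h3
        · left; rw [← mul_assoc] at h3; exact mul_inv_eq_one.1 h3
        · right; rw [← h3]; group
        · exact absurd h3 (ht s hs _ h')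
  have c1 : ∀ x, c * x ≠ x := fun x h => hS.ne_one F.cS (by simpa using h)
  let Bd : Finset Γ := Finset.univ.filter (fun x => x ∈ Y1 ↔ c * x ∈ Y1)
  have mBd : ∀ x, x ∈ Bd ↔ (x ∈ Y1 ↔ c * x ∈ Y1) := fun x => by simp [Bd]
  let B0 : Finset Γ := Finset.univ.filter (fun x => x ∉ Y ∧ c * x ∉ Y)
  have hB0 : B0.card = 2 := caseB_two hS hY hN F.cS
  have mB0 : ∀ x, x ∈ B0 ↔ (x ∉ Y ∧ c * x ∉ Y) := fun x => by simp [B0]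
  have sub : ∀ x ∈ Bd, x ≠ v0 → x ≠ c * v0 → x ∈ B0 := by
    intro x hx h1 h2
    have h3 : c * x ≠ v0 := fun h => h2 (by rw [← h, hcc])
    rw [mBd, hY1, Finset.mem_insert, Finset.mem_insert] at hx
    rw [mB0]
    have := fun h => hY x h c F.cS
    tauto
  have hv0Bd : v0 ∈ Bd := by
    by_contra hcon
    have hv0Y1 : v0 ∈ Y1 := by simp [hY1]
    have h1 : c * v0 ∉ Y1 := by
      rw [mBd] at hcon; tauto
    have h2 : c * v0 ∉ Y := fun h => h1 (by simp [hY1, h])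
    have h3 : B0 = {v0, c * v0} := by
      symm
      apply Finset.eq_of_subset_of_card_le
      · intro x hx
        simp only [Finset.mem_insert, Finset.mem_singleton] at hx
        rcases hx with rfl | rfl
        · rw [mB0]; exact ⟨hv0Y, h2⟩
        · rw [mB0, hcc]; exact ⟨h2, hv0Y⟩
      · rw [hB0, Finset.card_pair (c1 v0).symm]
    have h4 : ∀ x, x ∉ Bd := by
      intro x hx
      by_cases e1 : x = v0
      · exact hcon (e1 ▸ hx)
      by_cases e2 : x = c * v0
      · rw [e2, mBd, hcc] at hx; tauto
      have := sub x hx e1 e2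
      rw [h3] at this
      simp at this; tauto
    apply hnb
    refine ⟨fun x => decide (x ∈ Y1), fun s hs x h => ?_⟩
    rw [decide_eq_decide] at h
    by_cases e : s = c
    · subst e
      exact h4 x ((mBd x).2 h.symm)
    · have := Ps s hs (F.sub hs e) x
      tauto
  have hcBd : ∀ x, c * x ∈ Bd ↔ x ∈ Bd := by
    intro x; rw [mBd, mBd, hcc]; tauto
  have hBdc : Bd.card ≤ 4 := by
    have : Bd ⊆ B0 ∪ {v0, c * v0} := by
      intro x hx
      by_cases e1 : x = v0
      · simp [e1]
      by_cases e2 : x = c * v0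
      · simp [e2]
      exact Finset.mem_union_left _ (sub x hx e1 e2)
    have := (Finset.card_le_card this).trans (Finset.card_union_le _ _)
    have h2 : ({v0, c * v0} : Finset Γ).card ≤ 2 := Finset.card_le_two
    omega
  let Q : Γ → Prop := fun x => blk K x = blk K v0 ∨ blk K x = blk K (c * v0)
  have main : ∀ g, v0 * g ∈ Bd ∨ Q (v0 * g) ∨ Q (c * (v0 * g)) := by
    intro g
    let A : Finset Γ := Finset.univ.filter (fun x => ¬ (x ∈ Y1 ↔ x * g⁻¹ ∈ Y1))
    have mA : ∀ x, x ∈ A ↔ ¬ (x ∈ Y1 ↔ x * g⁻¹ ∈ Y1) := fun x => by simp [A]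
    have hA : KInv K A := by
      intro k hk x hx
      rw [mA] at *
      rcases O.all k hk with rfl | rfl | h
      · simpa using hx
      · rw [mul_assoc, Pz, Pz]; exact hx
      · rw [mul_assoc, Ps k h hk, Ps k h hk]; exact xor_aux2 _ _ hx
    let E : Finset Γ := Finset.univ.filter (fun x => ¬ (x ∈ A ↔ c * x ∈ A))
    have mE : ∀ x, x ∈ E ↔ ¬ (x ∈ Bd ↔ x * g⁻¹ ∈ Bd) := by
      intro x
      simp only [E, Finset.mem_filter, Finset.mem_univ, true_and]
      rw [mA, mA, mBd, mBd, mul_assoc]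
      exact xor_aux _ _ _ _
    have hEsub : E ⊆ Bd ∪ tr Bd g := by
      intro x hx
      rw [mE] at hx
      rw [Finset.mem_union, mem_tr]; exact xor_aux3 _ _ hx
    have hEc : ∀ x, x ∈ Bd → x * g⁻¹ ∈ Bd → E.card < 8 := by
      intro x h1 h2
      have hx : x ∈ Bd ∪ tr Bd g := Finset.mem_union_left _ h1
      have : E ⊆ (Bd ∪ tr Bd g).erase x := by
        intro y hy
        rw [Finset.mem_erase]
        refine ⟨?_, hEsub hy⟩
        rintro rfl
        rw [mE] at hy; tauto
      have h3 := Finset.card_le_card this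
      rw [Finset.card_erase_of_mem hx] at h3
      have h4 := Finset.card_union_le Bd (tr Bd g)
      rw [card_tr] at h4
      have : 0 < (Bd ∪ tr Bd g).card := Finset.card_pos.2 ⟨x, hx⟩
      omega
    have hE8 : E.card ≤ 8 := by
      have h4 := (Finset.card_le_card hEsub).trans (Finset.card_union_le Bd (tr Bd g))
      rw [card_tr] at h4
      omega
    have hbdA : E.card = 2 * dd S A := by
      rw [F.dd_inv hA]; exact card_flip F.c2 A
    obtain ⟨A', hA', hc', hdd', hE'⟩ : ∃ A', KInv K A' ∧ A'.card ≤ 4 ∧ dd S A' = dd S A ∧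
        ∀ x, x ∈ E → x ∈ A' ∨ c * x ∈ A' := by
      rcases F.lemmaF hS A hA (by omega) with h | h
      · refine ⟨A, hA, h, rfl, fun x hx => ?_⟩
        simp only [E, Finset.mem_filter] at hx; tauto
      · refine ⟨Aᶜ, hA.compl, h, dd_compl _ _, fun x hx => ?_⟩
        simp only [E, Finset.mem_filter] at hx
        rw [Finset.mem_compl, Finset.mem_compl]; tauto
    rcases A'.eq_empty_or_nonempty with h0 | hne
    · left
      have hx : v0 * g ∉ E := by
        intro h
        have := hE' _ h
        simp [h0] at this
      rw [mE, mul_inv_cancel_right] at hx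
      tauto
    · right
      have h8 : E.card = 8 := by
        have := (F.dd_fb hS hA' hne hc').1
        omega
      have e1 : v0 ∈ E := by
        rw [mE]
        intro h
        have := hEc v0 hv0Bd (h.1 hv0Bd)
        omega
      have e2 : v0 * g ∈ E := by
        rw [mE, mul_inv_cancel_right]
        intro h
        have := hEc (v0 * g) (h.2 hv0Bd) (by rw [mul_inv_cancel_right]; exact hv0Bd)
        omega
      obtain ⟨β, rfl⟩ := hA'.eq_fb hne (by rw [F.card]; exact hc')
      have e1 := hE' _ e1
      have e2 := hE' _ e2
      simp only [mem_fb] at e1 e2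
      simp only [Q]
      rcases e1 with e1 | e1 <;> rcases e2 with e2 | e2 <;> rw [← e1] at e2 <;> tauto
  let T : Finset Γ := fb K (blk K v0) ∪ fb K (blk K (c * v0))
  have hT : T.card ≤ 8 := by
    have := Finset.card_union_le (fb K (blk K v0)) (fb K (blk K (c * v0)))
    rw [card_fb, card_fb, F.card] at this
    exact this
  let W : Finset Γ := B0 ∪ (T ∪ T.image (fun x => c * x))
  have hW : W.card ≤ 18 := by
    have h1 := Finset.card_union_le B0 (T ∪ T.image (fun x => c * x))
    have h2 := Finset.card_union_le T (T.image (fun x => c * x))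
    have h3 : (T.image (fun x => c * x)).card ≤ T.card := Finset.card_image_le
    have : W.card ≤ B0.card + (T ∪ T.image (fun x => c * x)).card := h1
    omega
  have hQT : ∀ x, Q x → x ∈ T := by
    intro x hx
    simp only [T, Finset.mem_union, mem_fb]; exact hx
  have hUW : Finset.univ ⊆ W := by
    intro x _
    have := main (v0⁻¹ * x)
    rw [mul_inv_cancel_left] at this
    simp only [W, Finset.mem_union, Finset.mem_image]
    rcases this with h | h | h
    · by_cases e1 : x = v0
      · right; left; rw [e1]; exact hQT _ (Or.inl rfl)
      by_cases e2 : x = c * v0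
      · right; left; rw [e2]; exact hQT _ (Or.inr rfl)
      left; exact sub x h e1 e2
    · right; left; exact hQT _ h
    · right; right; exact ⟨c * x, hQT _ h, hcc x⟩
  have h1 := Finset.card_le_card hUW
  have h2 := F.big hS
  rw [Finset.card_univ] at h1
  omega

end CaseBPart2

open SimpleGraph
set_option linter.unusedSectionVars false
set_option linter.unusedSimpArgs false

theorem tutte_set {V : Type*} [Fintype V] [DecidableEq V] (G : SimpleGraph V)
    (heven : Even (Fintype.card V)) (hno : ¬ ∃ P : G.Subgraph, P.IsPerfectMatching) :
    ∃ (u : Finset V) (𝒦 : Finset (Finset V)),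
      (∀ A ∈ 𝒦, ∀ B ∈ 𝒦, A ≠ B → Disjoint A B) ∧ (∀ A ∈ 𝒦, Odd A.card) ∧
      (∀ A ∈ 𝒦, Disjoint A u) ∧ (∀ A ∈ 𝒦, ∀ x ∈ A, ∀ y, G.Adj x y → y ∈ A ∨ y ∈ u) ∧
      u.card + 2 ≤ 𝒦.card := by
  classical
  rw [SimpleGraph.tutte] at hno
  push Not at hno
  obtain ⟨u, hu⟩ := hno
  unfold SimpleGraph.IsTutteViolator at hu
  set D := ((⊤ : G.Subgraph).deleteVerts u) with hD
  have hpar := SimpleGraph.odd_ncard_oddComponents D.coe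
  have hDv : D.verts = uᶜ := by
    simp [hD, Set.compl_eq_univ_diff]
  have hcard : Nat.card D.verts = Fintype.card V - u.ncard := by
    rw [Nat.card_coe_set_eq, hDv, Set.ncard_compl, Nat.card_eq_fintype_card]
  have hule : u.ncard ≤ Fintype.card V := by
    rw [← Nat.card_eq_fintype_card]; exact Set.ncard_le_card u
  have h2 : u.ncard + 2 ≤ D.coe.oddComponents.ncard := by
    rw [hcard] at hpar
    by_contra hcon
    have e : D.coe.oddComponents.ncard = u.ncard + 1 := by omega
    rw [e] at hpar
    obtain ⟨k, hk⟩ := heven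
    rw [Nat.odd_iff, Nat.odd_iff] at hpar
    omega
  let f : D.coe.ConnectedComponent → Finset V := fun c =>
    Finset.univ.filter (fun v => ∃ h : v ∈ D.verts, D.coe.connectedComponentMk ⟨v, h⟩ = c)
  have mf : ∀ c v, v ∈ f c ↔ ∃ h : v ∈ D.verts, D.coe.connectedComponentMk ⟨v, h⟩ = c := by
    intro c v; simp [f]
  have hfc : ∀ c, (f c).card = c.supp.ncard := by
    intro c
    have : (f c : Set V) = Subtype.val '' c.supp := by
      ext v
      rw [Finset.mem_coe, mf]
      simp [SimpleGraph.ConnectedComponent.mem_supp_iff]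
    rw [← Set.ncard_coe_finset, this, Set.ncard_image_of_injective _ Subtype.val_injective]
  have hinj : Function.Injective f := by
    intro c c' h
    induction c using SimpleGraph.ConnectedComponent.ind with
    | h v =>
      have : (v : V) ∈ f (D.coe.connectedComponentMk v) := (mf _ _).2 ⟨v.2, rfl⟩
      rw [h, mf] at this
      exact this.2
  refine ⟨u.toFinset, D.coe.oddComponents.toFinset.image f, ?_, ?_, ?_, ?_, ?_⟩
  · intro A hA B hB hne
    obtain ⟨c, -, rfl⟩ := Finset.mem_image.1 hA
    obtain ⟨c', -, rfl⟩ := Finset.mem_image.1 hB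
    rw [Finset.disjoint_left]
    intro v hv hv'
    rw [mf] at hv hv'
    apply hne
    obtain ⟨h, rfl⟩ := hv
    obtain ⟨h', e⟩ := hv'
    rw [← e]
  · intro A hA
    obtain ⟨c, hc, rfl⟩ := Finset.mem_image.1 hA
    rw [hfc]
    simpa using hc
  · intro A hA
    obtain ⟨c, hc, rfl⟩ := Finset.mem_image.1 hA
    rw [Finset.disjoint_left]
    intro v hv hv'
    rw [mf] at hv
    obtain ⟨h, -⟩ := hv
    rw [hDv] at h
    exact h (by simpa using hv')
  · intro A hA x hx y hxy
    obtain ⟨c, hc, rfl⟩ := Finset.mem_image.1 hA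
    by_cases hy : y ∈ u
    · right; simpa using hy
    · left
      rw [mf] at hx ⊢
      obtain ⟨h, e⟩ := hx
      have hy' : y ∈ D.verts := by rw [hDv]; exact hy
      refine ⟨hy', ?_⟩
      rw [← e, SimpleGraph.ConnectedComponent.eq]
      apply SimpleGraph.Adj.reachable
      rw [SimpleGraph.Subgraph.coe_adj]
      have hD' : D.Adj y x := by
        rw [hDv] at h
        rw [hD, SimpleGraph.Subgraph.deleteVerts_adj]
        exact ⟨trivial, hy, trivial, h, hxy.symm⟩
      exact hD'
  · rw [Finset.card_image_of_injective _ hinj, ← Set.ncard_eq_toFinset_card', ← Set.ncard_eq_toFinset_card']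
    exact h2

theorem tutte_extract {V : Type*} [Fintype V] [DecidableEq V] (G : SimpleGraph V)
    (heven : Even (Fintype.card V)) (M : G.Subgraph) (hM : M.IsMatching) (h4 : M.verts.ncard = 4)
    (hno : ¬ ∃ P : G.Subgraph, P.IsPerfectMatching ∧ M.edgeSet ⊆ P.edgeSet) :
    ∃ (X : Finset V) (𝒦 : Finset (Finset V)), (∀ v ∈ M.verts, v ∈ X) ∧
      (∀ A ∈ 𝒦, ∀ B ∈ 𝒦, A ≠ B → Disjoint A B) ∧ (∀ A ∈ 𝒦, Odd A.card) ∧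
      (∀ A ∈ 𝒦, Disjoint A X) ∧ (∀ A ∈ 𝒦, ∀ x ∈ A, ∀ y, G.Adj x y → y ∈ A ∨ y ∈ X) ∧
      X.card ≤ 𝒦.card + 2 := by
  classical
  let W := {v : V // v ∉ M.verts}
  let G' : SimpleGraph W := G.comap Subtype.val
  have hWc : Fintype.card W = Fintype.card V - 4 := by
    have e : Fintype.card W = (M.verts)ᶜ.ncard := by
      rw [← Nat.card_eq_fintype_card, ← Nat.card_coe_set_eq]; rfl
    rw [e, Set.ncard_compl, h4, Nat.card_eq_fintype_card]
  have hle : 4 ≤ Fintype.card V := by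
    rw [← Nat.card_eq_fintype_card, ← h4]; exact Set.ncard_le_card _
  obtain ⟨u, 𝒦, h1, h2, h3, h5, h6⟩ := tutte_set G' (by
      rw [hWc]; obtain ⟨k, hk⟩ := heven; exact ⟨k - 2, by omega⟩) (by
      rintro ⟨P, hP⟩
      apply hno
      let Q : G.Subgraph :=
        { verts := Set.univ
          Adj := fun x y => M.Adj x y ∨ ∃ (hx : x ∉ M.verts) (hy : y ∉ M.verts), P.Adj ⟨x, hx⟩ ⟨y, hy⟩
          adj_sub := by
            rintro x y (h | ⟨hx, hy, h⟩)
            · exact M.adj_sub h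
            · exact P.adj_sub h
          edge_vert := fun _ => Set.mem_univ _
          symm := by
            constructor
            rintro x y (h | ⟨hx, hy, h⟩)
            · exact Or.inl h.symm
            · exact Or.inr ⟨hy, hx, h.symm⟩ }
      refine ⟨Q, ?_, ?_⟩
      · rw [SimpleGraph.Subgraph.isPerfectMatching_iff] at hP ⊢
        intro v
        by_cases hv : v ∈ M.verts
        · obtain ⟨w, hw, huw⟩ := hM hv
          refine ⟨w, Or.inl hw, ?_⟩
          rintro y (h | ⟨hx, -, -⟩)
          · exact huw y h
          · exact absurd hv hx
        · obtain ⟨w, hw, huw⟩ := hP ⟨v, hv⟩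
          refine ⟨w, Or.inr ⟨hv, w.2, hw⟩, ?_⟩
          rintro y (h | ⟨hx, hy, h⟩)
          · exact absurd (M.edge_vert h) hv
          · exact congrArg Subtype.val (huw ⟨y, hy⟩ h)
      · intro e
        induction e using Sym2.ind with
        | _ x y =>
          intro h
          exact Or.inl h)
  let emb : W ↪ V := Function.Embedding.subtype _
  refine ⟨M.verts.toFinset ∪ u.map emb, 𝒦.map (Finset.mapEmbedding emb).toEmbedding, ?_, ?_, ?_, ?_, ?_, ?_⟩
  · intro v hv; simp [hv]
  · intro A hA B hB hne
    obtain ⟨A, hA', rfl⟩ := Finset.mem_map.1 hA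
    obtain ⟨B, hB', rfl⟩ := Finset.mem_map.1 hB
    have : A ≠ B := fun h => hne (by rw [h])
    have := h1 A hA' B hB' this
    simpa using this
  · intro A hA
    obtain ⟨A, hA', rfl⟩ := Finset.mem_map.1 hA
    simpa using h2 A hA'
  · intro A hA
    obtain ⟨A, hA', rfl⟩ := Finset.mem_map.1 hA
    rw [Finset.disjoint_union_right]
    constructor
    · rw [Finset.disjoint_left]
      intro v hv hv'
      simp only [RelEmbedding.coe_toEmbedding, Finset.mapEmbedding_apply, Finset.mem_map] at hv
      obtain ⟨w, -, rfl⟩ := hv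
      exact w.2 (Set.mem_toFinset.1 hv')
    · simpa using h3 A hA'
  · intro A hA x hx y hxy
    obtain ⟨A, hA', rfl⟩ := Finset.mem_map.1 hA
    simp only [RelEmbedding.coe_toEmbedding, Finset.mapEmbedding_apply, Finset.mem_map] at hx
    obtain ⟨w, hw, rfl⟩ := hx
    by_cases hy : y ∈ M.verts
    · right; simp [hy]
    · rcases h5 A hA' w hw ⟨y, hy⟩ hxy with h | h
      · left
        simp only [RelEmbedding.coe_toEmbedding, Finset.mapEmbedding_apply, Finset.mem_map]
        exact ⟨⟨y, hy⟩, h, rfl⟩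
      · right
        rw [Finset.mem_union]; right
        rw [Finset.mem_map]
        exact ⟨⟨y, hy⟩, h, rfl⟩
  · have := Finset.card_union_le M.verts.toFinset (u.map emb)
    rw [Finset.card_map, ← Set.ncard_eq_toFinset_card', h4] at this
    rw [Finset.card_map]
    omega

open SimpleGraph
set_option linter.unusedSectionVars false
set_option linter.unusedSimpArgs false

theorem mk_two {V : Type*} {G : SimpleGraph V} {p q r t : V} (h1 : G.Adj p q) (h2 : G.Adj r t)
    (pr : p ≠ r) (pt : p ≠ t) (qr : q ≠ r) (qt : q ≠ t) :
    ∃ M : G.Subgraph, M.IsMatching ∧ M.edgeSet.ncard = 2 ∧ M.edgeSet = {s(p, q), s(r, t)} := by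
  have e : (G.subgraphOfAdj h1 ⊔ G.subgraphOfAdj h2).edgeSet = {s(p, q), s(r, t)} := by
    rw [SimpleGraph.Subgraph.edgeSet_sup, SimpleGraph.edgeSet_subgraphOfAdj,
      SimpleGraph.edgeSet_subgraphOfAdj]; rfl
  refine ⟨G.subgraphOfAdj h1 ⊔ G.subgraphOfAdj h2, ?_, ?_, e⟩
  · apply SimpleGraph.Subgraph.IsMatching.sup (SimpleGraph.Subgraph.IsMatching.subgraphOfAdj h1)
      (SimpleGraph.Subgraph.IsMatching.subgraphOfAdj h2)
    rw [SimpleGraph.support_subgraphOfAdj, SimpleGraph.support_subgraphOfAdj, Set.disjoint_left]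
    intro x hx hx'
    simp only [Set.mem_insert_iff, Set.mem_singleton_iff] at hx hx'
    rcases hx with rfl | rfl <;> tauto
  · rw [e, Set.ncard_pair]
    rw [Ne, Sym2.eq_iff]
    tauto

theorem two_of {V : Type*} [Fintype V] {G : SimpleGraph V} {M : G.Subgraph} (hM : M.IsMatching)
    (h2 : M.edgeSet.ncard = 2) : ∃ p q r t, M.Adj p q ∧ M.Adj r t ∧ p ≠ r ∧ p ≠ t ∧ q ≠ r ∧ q ≠ t ∧
      M.verts.ncard = 4 := by
  obtain ⟨e, f, hne, hef⟩ := Set.ncard_eq_two.1 h2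
  induction e using Sym2.ind with
  | _ p q =>
  induction f using Sym2.ind with
  | _ r t =>
  have h1 : M.Adj p q := by
    rw [← SimpleGraph.Subgraph.mem_edgeSet, hef]; simp
  have h3 : M.Adj r t := by
    rw [← SimpleGraph.Subgraph.mem_edgeSet, hef]; simp
  have ad : ∀ x y, M.Adj x y → s(x, y) = s(p, q) ∨ s(x, y) = s(r, t) := by
    intro x y h
    rw [← SimpleGraph.Subgraph.mem_edgeSet, hef] at h
    simpa using h
  have un : ∀ x y z, M.Adj x y → M.Adj x z → y = z := fun x y z h h' => hM.eq_of_adj_left h h'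
  have pr : p ≠ r := by
    rintro rfl
    exact hne (by rw [un _ _ _ h1 h3])
  have pt : p ≠ t := by
    rintro rfl
    exact hne (by rw [un _ _ _ h1 h3.symm, Sym2.eq_swap])
  have qr : q ≠ r := by
    rintro rfl
    exact hne (by rw [un _ _ _ h1.symm h3, Sym2.eq_swap])
  have qt : q ≠ t := by
    rintro rfl
    exact hne (by rw [un _ _ _ h1.symm h3.symm])
  refine ⟨p, q, r, t, h1, h3, pr, pt, qr, qt, ?_⟩
  have hv : M.verts = {p, q, r, t} := by
    ext x
    simp only [Set.mem_insert_iff, Set.mem_singleton_iff]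
    constructor
    · intro hx
      obtain ⟨y, hy, -⟩ := hM hx
      have := ad x y hy
      rw [Sym2.eq_iff, Sym2.eq_iff] at this
      tauto
    · rintro (rfl | rfl | rfl | rfl)
      · exact M.edge_vert h1
      · exact M.edge_vert h1.symm
      · exact M.edge_vert h3
      · exact M.edge_vert h3.symm
  classical
  have n1 : p ≠ q := h1.ne
  have n2 : r ≠ t := h3.ne
  have : M.verts = (({p, q, r, t} : Finset V) : Set V) := by rw [hv]; simp
  rw [this, Set.ncard_coe_finset]
  rw [Finset.card_insert_of_notMem (by simp; tauto), Finset.card_insert_of_notMem (by simp; tauto),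
    Finset.card_pair n2]

section
variable {Γ : Type*} [Group Γ] [Fintype Γ] [DecidableEq Γ]

theorem cay_adj {S : Set Γ} (hS : ∀ s ∈ S, s⁻¹ ∈ S) (hid : (1 : Γ) ∉ S) {x y : Γ} :
    (cayleyGraph Γ S hS).Adj x y ↔ ∃ s ∈ S, y = s * x := by
  constructor
  · rintro ⟨-, h⟩
    refine ⟨y * x⁻¹, ?_, by group⟩
    have := hS _ h
    simpa using this
  · rintro ⟨s, hs, rfl⟩
    refine ⟨fun h => hid ?_, by simpa using hS s hs⟩
    have : s = 1 := by simpa using h.symm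
    exact this ▸ hs

theorem TriFree.card6 {S : Finset Γ} (hS : Cub S) (ht : TriFree S) : 6 ≤ Fintype.card Γ := by
  obtain ⟨s, hs⟩ : S.Nonempty := Finset.card_pos.1 (by rw [hS.card]; norm_num)
  have h : Disjoint S (S.image (fun t => s * t)) := by
    rw [Finset.disjoint_left]
    intro x hx hx'
    obtain ⟨t, ht', rfl⟩ := Finset.mem_image.1 hx'
    exact ht s hs t ht' hx
  have := Finset.card_le_univ (S ∪ S.image (fun t => s * t))
  rw [Finset.card_union_of_disjoint h, Finset.card_image_of_injective _ (mul_right_injective s),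
    hS.card] at this
  omega

theorem hard_dir {S : Set Γ} (hS : ∀ s ∈ S, s⁻¹ ∈ S) (hid : (1 : Γ) ∉ S) {T : Finset Γ}
    (hT : ∀ s, s ∈ T ↔ s ∈ S) (hC : Cub T) (ht : TriFree T) (hnb : NonBip T)
    (heven : Even (Fintype.card Γ)) (hl : ¬ Ladder T) : IsNExtendable (cayleyGraph Γ S hS) 2 := by
  have adj : ∀ x y, (cayleyGraph Γ S hS).Adj x y ↔ ∃ s ∈ T, y = s * x := by
    intro x y
    rw [cay_adj hS hid]
    simp only [hT]
  refine ⟨ht.card6 hC, ?_, ?_⟩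
  · obtain ⟨s, hs, t, ht', hst⟩ := Finset.one_lt_card.1 (show 1 < T.card by rw [hC.card]; norm_num)
    obtain ⟨w, hw, hwt⟩ : ∃ w ∈ T, w ≠ t⁻¹ := by
      by_contra hcon
      push Not at hcon
      exact hst ((hcon s hs).trans (hcon t ht').symm)
    obtain ⟨M, h1, h2, -⟩ := mk_two (G := cayleyGraph Γ S hS) (p := 1) (q := s) (r := t) (t := w * t)
      ((adj _ _).2 ⟨s, hs, by simp⟩) ((adj _ _).2 ⟨w, hw, rfl⟩)
      (fun h => hC.ne_one ht' h.symm) (fun h => hwt (eq_inv_of_mul_eq_one_left h.symm)) hst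
      (fun h => ht w hw t ht' (h ▸ hs))
    exact ⟨M, h1, h2⟩
  · intro M hM h2
    by_contra hno
    obtain ⟨p, q, r, t, hpq, hrt, pr, pt, qr, qt, h4⟩ := two_of hM h2
    obtain ⟨X, 𝒦, hX, k1, k2, k3, k4, k5⟩ := tutte_extract _ heven M hM h4 hno
    have hTE : TwoEdges T X := by
      obtain ⟨s, hs, rfl⟩ := (adj _ _).1 (M.adj_sub hpq)
      obtain ⟨s', hs', rfl⟩ := (adj _ _).1 (M.adj_sub hrt)
      exact ⟨p, r, s, s', hs, hs', hX _ (M.edge_vert hpq), hX _ (M.edge_vert hpq.symm),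
        hX _ (M.edge_vert hrt), hX _ (M.edge_vert hrt.symm), pr, pt, qr, qt⟩
    have hAB := tutte_cases hC ht heven hTE 𝒦 k1 k2 k3
      (fun A hA x hx s hs => k4 A hA x hx _ ((adj _ _).2 ⟨s, hs, rfl⟩)) k5
    rcases classify hC ht hnb with h | ⟨c, hc, hc2, h5, hcase⟩
    · exact hl h
    have hB : CaseB T := by
      rcases hAB with h | ⟨Y, C, h⟩
      · exact h
      · refine caseA_to_B h hC ht hTE hc hc2 h5 ?_
        rcases hcase with ⟨h4, h | ⟨K, h⟩⟩ | ⟨K, z, h, -⟩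
        · exact Or.inl ⟨h4, h⟩
        · exact Or.inr ⟨K, 5, h⟩
        · exact Or.inr ⟨K, 4, h⟩
    rcases hcase with ⟨h4, -⟩ | ⟨K, z, F, O⟩
    · exact caseB_no4 hC hnb h4 hB
    · exact caseB_free4 hC ht hnb F O hB

end

open SimpleGraph
set_option linter.unusedSectionVars false
set_option linter.unusedSimpArgs false

theorem or_aux6 (p q m : Prop) : ((p ∨ q ∨ m) ∨ q ∨ p ∨ m) ↔ (q ∨ p ∨ m) := by tauto

theorem cyc_iso {V : Type*} [Finite V] {G : SimpleGraph V} (w : Equiv.Perm V) (v : V) (m e b0 m0 : ℕ)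
    (hm : orderOf w = m) (hb : e + b0 = m) (hm0 : 2 * m0 = m)
    (htr : ∀ x, ∃ i : ℤ, x = (w ^ i) v)
    (hadj : ∀ x y, G.Adj x y ↔ y = (w ^ (e : ℤ)) x ∨ x = (w ^ (e : ℤ)) y ∨ y = (w ^ (m0 : ℤ)) x) :
    Nonempty (G ≃g circThree m e b0 m0) := by
  have free : ∀ i : ℤ, (w ^ i) v = v ↔ ((i : ZMod m) = 0) := by
    intro i
    rw [ZMod.intCast_zmod_eq_zero_iff_dvd, ← hm, orderOf_dvd_iff_zpow_eq_one]
    constructor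
    · intro h
      ext x
      obtain ⟨j, rfl⟩ := htr x
      rw [← Equiv.Perm.mul_apply, ← zpow_add, add_comm, zpow_add, Equiv.Perm.mul_apply, h]
      rfl
    · intro h; rw [h]; rfl
  have eqv : ∀ i j : ℤ, (w ^ i) v = (w ^ j) v ↔ (i : ZMod m) = (j : ZMod m) := by
    intro i j
    rw [← sub_eq_zero (a := (i : ZMod m)), ← Int.cast_sub, ← free, sub_eq_neg_add, zpow_add, Equiv.Perm.mul_apply,
      zpow_neg, Equiv.Perm.inv_eq_iff_eq]
  let φ : ZMod m → V := fun k => (w ^ (k.cast : ℤ)) v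
  have hφ : ∀ i : ℤ, φ (i : ZMod m) = (w ^ i) v := by
    intro i
    simp only [φ]
    rw [eqv, ZMod.intCast_zmod_cast]
  have hinj : Function.Injective φ := by
    intro a b h
    obtain ⟨a, rfl⟩ := ZMod.intCast_surjective a
    obtain ⟨b, rfl⟩ := ZMod.intCast_surjective b
    rw [hφ, hφ, eqv] at h
    exact h
  have hsur : Function.Surjective φ := by
    intro x
    obtain ⟨i, rfl⟩ := htr x
    exact ⟨i, hφ i⟩
  have hb' : (b0 : ZMod m) = - (e : ZMod m) := by
    rw [eq_neg_iff_add_eq_zero]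
    have : ((e + b0 : ℕ) : ZMod m) = 0 := by rw [hb]; simp
    push_cast at this
    rw [add_comm]; exact this
  have hm' : - (m0 : ZMod m) = (m0 : ZMod m) := by
    rw [neg_eq_iff_add_eq_zero]
    have : ((2 * m0 : ℕ) : ZMod m) = 0 := by rw [hm0]; simp
    push_cast at this
    rw [← this]; ring
  have key : ∀ a b : ZMod m, G.Adj (φ a) (φ b) ↔ (circThree m e b0 m0).Adj a b := by
    intro a b
    have h1 : G.Adj (φ a) (φ b) ↔ (b = e + a ∨ a = e + b ∨ b = m0 + a) := by
      obtain ⟨a, rfl⟩ := ZMod.intCast_surjective a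
      obtain ⟨b, rfl⟩ := ZMod.intCast_surjective b
      rw [hadj, hφ, hφ, ← Equiv.Perm.mul_apply, ← Equiv.Perm.mul_apply, ← Equiv.Perm.mul_apply,
        ← zpow_add, ← zpow_add, ← zpow_add, eqv, eqv, eqv]
      push_cast
      rfl
    have h2 : (circThree m e b0 m0).Adj a b ↔ a ≠ b ∧ (b = e + a ∨ a = e + b ∨ b = m0 + a) := by
      unfold circThree
      rw [SimpleGraph.circulantGraph_adj]
      simp only [Set.mem_insert_iff, Set.mem_singleton_iff, hb']
      apply and_congr_right
      intro _
      have q1 : a - b = m0 ↔ b - a = m0 := by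
        constructor
        · intro h; rw [← neg_sub, h, hm']
        · intro h; rw [← neg_sub, h, hm']
      have q2 : a - b = -e ↔ b - a = e := by
        rw [← neg_sub, neg_inj]
      have q3 : b - a = -e ↔ a - b = e := by
        rw [← neg_sub, neg_inj]
      rw [q1, q2, q3, sub_eq_iff_eq_add, sub_eq_iff_eq_add, sub_eq_iff_eq_add]
      exact or_aux6 _ _ _
    rw [h2, ← h1]
    constructor
    · intro h
      exact ⟨fun hab => h.ne (by rw [hab]), h⟩
    · exact fun h => h.2
  refine ⟨(RelIso.mk (Equiv.ofBijective φ ⟨hinj, hsur⟩) ?_).symm⟩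
  intro a b
  exact key a b

theorem ladder_abs {V : Type*} [Finite V] {G : SimpleGraph V} (v : V) (r t : Equiv.Perm V)
    (hrt : Commute r t) (ht : t * t = 1)
    (hadj : ∀ x y, G.Adj x y ↔ y = r x ∨ x = r y ∨ y = t x) (hconn : G.Connected)
    (hnb : ¬ ∃ f : V → Bool, ∀ x y, G.Adj x y → f x ≠ f y)
    (htri : ∀ x y z, G.Adj x y → G.Adj y z → ¬ G.Adj x z) :
    ∃ n, 2 ≤ n ∧ (Nonempty (G ≃g circThree (4 * n) 1 (4 * n - 1) (2 * n)) ∨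
      Nonempty (G ≃g circThree (4 * n + 2) 2 (4 * n) (2 * n + 1))) := by
  classical
  have hr1 : ∀ x, r x ≠ x := fun x h => (hadj x (r x)).2 (Or.inl rfl) |>.ne h.symm
  have ht1 : ∀ x, t x ≠ x := fun x h => (hadj x (t x)).2 (Or.inr (Or.inr rfl)) |>.ne h.symm
  have hadj_r : ∀ x, G.Adj x (r x) := fun x => (hadj _ _).2 (Or.inl rfl)
  have hadj_t : ∀ x, G.Adj x (t x) := fun x => (hadj _ _).2 (Or.inr (Or.inr rfl))
  have t2 : t ^ (2 : ℤ) = 1 := by rw [zpow_two]; exact ht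
  -- transitivity
  have mr : ∀ i j : ℤ, r * (r ^ i * t ^ j) = r ^ (i + 1) * t ^ j := by
    intro i j; rw [← mul_assoc, add_comm, zpow_add, zpow_one]
  have mr' : ∀ i j : ℤ, r⁻¹ * (r ^ i * t ^ j) = r ^ (i - 1) * t ^ j := by
    intro i j
    rw [← mul_assoc, sub_eq_neg_add, zpow_add, zpow_neg, zpow_one]
  have mt : ∀ i j : ℤ, t * (r ^ i * t ^ j) = r ^ i * t ^ (j + 1) := by
    intro i j
    have := (hrt.symm.zpow_right i).eq
    rw [← mul_assoc, this, mul_assoc, add_comm, zpow_add, zpow_one]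
  have step : ∀ (i j : ℤ) x y, x = (r ^ i * t ^ j) v → G.Adj x y →
      ∃ i' j' : ℤ, y = (r ^ i' * t ^ j') v ∧ (Even (i + j) ↔ ¬ Even (i' + j')) := by
    rintro i j x y rfl h
    rcases (hadj _ _).1 h with h | h | h
    · refine ⟨i + 1, j, ?_, ?_⟩
      · rw [h, ← mr]; rfl
      · rw [add_right_comm, Int.even_add_one]; tauto
    · refine ⟨i - 1, j, ?_, ?_⟩
      · rw [← mr', Equiv.Perm.mul_apply, h]; simp
      · rw [show i - 1 + j = i + j - 1 by ring, Int.even_sub_one]; tauto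
    · refine ⟨i, j + 1, ?_, ?_⟩
      · rw [h, ← mt]; rfl
      · rw [← add_assoc, Int.even_add_one]; tauto
  have htr : ∀ x, ∃ i j : ℤ, x = (r ^ i * t ^ j) v := by
    intro x
    have hreach : G.Reachable v x := hconn.preconnected v x
    obtain ⟨p⟩ := hreach
    have : ∀ (a b : V) (p : G.Walk a b), (∃ i j : ℤ, a = (r ^ i * t ^ j) v) →
        ∃ i j : ℤ, b = (r ^ i * t ^ j) v := by
      intro a b p
      induction p with
      | nil => exact id
      | cons h p ih =>
        rintro ⟨i, j, hij⟩
        apply ih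
        obtain ⟨i', j', h', -⟩ := step i j _ _ hij h
        exact ⟨i', j', h'⟩
    exact this v x p ⟨0, 0, by simp⟩
  have hodd : ∃ i j : ℤ, r ^ i * t ^ j = 1 ∧ ¬ Even (i + j) := by
    by_contra hcon
    push Not at hcon
    apply hnb
    have wd : ∀ i j i' j' : ℤ, (r ^ i * t ^ j) v = (r ^ i' * t ^ j') v → (Even (i + j) ↔ Even (i' + j')) := by
      intro i j i' j' h
      have hc : ∀ a b a' b' : ℤ, (r ^ a * t ^ b) * (r ^ a' * t ^ b') = r ^ (a + a') * t ^ (b + b') := by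
        intro a b a' b'
        rw [zpow_add, zpow_add]
        have := ((hrt.zpow_left a').zpow_right b).eq
        rw [mul_assoc, ← mul_assoc (t ^ b), ← this]; simp only [mul_assoc]
      have h1 : r ^ (-i' + i) * t ^ (-j' + j) = 1 := by
        have hh : (r ^ (-i' + i) * t ^ (-j' + j)) v = v := by
          rw [← hc, Equiv.Perm.mul_apply, h, ← Equiv.Perm.mul_apply, hc]
          simp
        ext x
        obtain ⟨a, b, rfl⟩ := htr x
        rw [← Equiv.Perm.mul_apply, hc, add_comm _ a, add_comm _ b, ← hc, Equiv.Perm.mul_apply, hh]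
        rfl
      have h2 := hcon _ _ h1
      rw [show -i' + i + (-j' + j) = (i + j) - (i' + j') by ring, Int.even_sub] at h2
      exact h2
    refine ⟨fun x => decide (∃ i j : ℤ, x = (r ^ i * t ^ j) v ∧ Even (i + j)), fun x y h e => ?_⟩
    rw [decide_eq_decide] at e
    obtain ⟨i, j, hij⟩ := htr x
    obtain ⟨i', j', h', hp⟩ := step i j x y hij h
    by_cases ev : Even (i + j)
    · obtain ⟨a, b, hab, hev⟩ := e.1 ⟨i, j, hij, ev⟩
      rw [h'] at hab
      have := wd _ _ _ _ hab
      tauto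
    · obtain ⟨a, b, hab, hev⟩ := e.2 ⟨i', j', h', by tauto⟩
      rw [hij] at hab
      have := wd _ _ _ _ hab
      tauto
  obtain ⟨i, j, hij, hodd⟩ := hodd
  have hfin := isOfFinOrder_of_finite r
  have hpos : 0 < orderOf r := orderOf_pos r
  rcases Int.even_or_odd j with ⟨k, hk⟩ | ⟨k, hk⟩
  · -- prism
    have htj : t ^ j = 1 := by
      rw [hk, ← two_mul, zpow_mul, t2, one_zpow]
    rw [htj, mul_one] at hij
    have hio : Odd i := by
      rw [Int.not_even_iff_odd, hk] at hodd
      obtain ⟨l, hl⟩ := hodd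
      exact ⟨l - k, by omega⟩
    have hdvd := orderOf_dvd_iff_zpow_eq_one.2 hij
    have hro : Odd (orderOf r) := by
      by_contra hcon
      rw [Nat.not_odd_iff_even] at hcon
      obtain ⟨a, ha⟩ := hcon
      obtain ⟨b, hb⟩ := hdvd
      obtain ⟨l, hl⟩ := hio
      have : i = 2 * (a * b) := by rw [hb, ha]; push_cast; ring
      omega
    obtain ⟨n, hn⟩ := hro
    have rn : r ^ ((2 * n + 1 : ℕ) : ℤ) = 1 := by rw [zpow_natCast, ← hn, pow_orderOf_eq_one]
    set w := r ^ ((n + 1 : ℕ) : ℤ) * t with hw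
    have hcw : Commute (r ^ ((n + 1 : ℕ) : ℤ)) t := hrt.zpow_left _
    have w2 : w ^ (2 : ℤ) = r := by
      rw [hw, hcw.mul_zpow, t2, mul_one, ← zpow_mul]
      rw [show (((n + 1 : ℕ) : ℤ) * 2) = ((2 * n + 1 : ℕ) : ℤ) + 1 by push_cast; ring, zpow_add, rn]
      simp
    have wt : w ^ ((2 * n + 1 : ℕ) : ℤ) = t := by
      rw [hw, hcw.mul_zpow, ← zpow_mul, mul_comm (((n + 1 : ℕ) : ℤ)), zpow_mul r, rn, one_zpow, one_mul]
      rw [show ((2 * n + 1 : ℕ) : ℤ) = 2 * (n : ℤ) + 1 by push_cast; ring, zpow_add, zpow_mul, t2]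
      simp
    have hn2 : 2 ≤ n := by
      by_contra hcon
      have : n = 0 ∨ n = 1 := by omega
      rcases this with rfl | rfl
      · have : r = 1 := by simpa using rn
        exact hr1 v (by rw [this]; rfl)
      · have r3 : r (r (r v)) = v := by
          have : (r ^ 3) v = v := by
            have h3 : r ^ 3 = 1 := by
              have := pow_orderOf_eq_one r
              rw [hn] at this
              exact this
            rw [h3]; rfl
          exact this
        exact htri v (r v) (r (r v)) (hadj_r _) (hadj_r _) ((hadj _ _).2 (Or.inr (Or.inl r3.symm)))
    have hwo : orderOf w = 4 * n + 2 := by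
      apply Nat.dvd_antisymm
      · rw [orderOf_dvd_iff_pow_eq_one, ← zpow_natCast,
          show ((4 * n + 2 : ℕ) : ℤ) = 2 * ((2 * n + 1 : ℕ) : ℤ) by push_cast; ring, zpow_mul, w2, rn]
      · have h1 : w ^ ((orderOf w : ℕ) : ℤ) = 1 := by rw [zpow_natCast, pow_orderOf_eq_one]
        have h2 : orderOf r ∣ orderOf w := by
          rw [orderOf_dvd_iff_pow_eq_one, ← zpow_natCast, ← w2, ← zpow_mul, mul_comm, zpow_mul, h1, one_zpow]
        rw [hn] at h2
        obtain ⟨q, hq⟩ := h2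
        have h3 : t ^ q = 1 := by
          rw [← wt, ← zpow_natCast, ← zpow_mul, ← Nat.cast_mul, ← hq, h1]
        have h4 : Even q := by
          by_contra hcon
          obtain ⟨l, hl⟩ := Nat.not_even_iff_odd.1 hcon
          rw [hl, pow_succ, pow_mul, pow_two, ht, one_pow, one_mul] at h3
          exact ht1 v (by rw [h3]; rfl)
        obtain ⟨l, hl⟩ := h4
        exact ⟨l, by rw [hq, hl]; ring⟩
    refine ⟨n, hn2, Or.inr (cyc_iso w v (4 * n + 2) 2 (4 * n) (2 * n + 1) hwo (by ring) (by ring) ?_ ?_)⟩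
    · intro x
      obtain ⟨i, j, rfl⟩ := htr x
      refine ⟨2 * i + ((2 * n + 1 : ℕ) : ℤ) * j, ?_⟩
      rw [zpow_add, zpow_mul, w2, zpow_mul, wt]
    · intro x y
      rw [hadj, wt, show ((2 : ℕ) : ℤ) = 2 from rfl, w2]
  · -- Moebius ladder
    have htj : t ^ j = t := by
      rw [hk, zpow_add, zpow_mul, t2, one_zpow, one_mul, zpow_one]
    rw [htj] at hij
    have hti : t = r ^ (-i) := by rw [zpow_neg]; exact eq_inv_of_mul_eq_one_right hij
    have hie : Even (-i) := by
      rw [Int.not_even_iff_odd, hk] at hodd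
      obtain ⟨l, hl⟩ := hodd
      exact ⟨-(l - k), by omega⟩
    obtain ⟨l, hl⟩ := hie
    rw [hl] at hti
    have h4 : (orderOf r : ℤ) ∣ (l + l) + (l + l) := by
      rw [orderOf_dvd_iff_zpow_eq_one, zpow_add, ← hti, ht]
    have h2 : ¬ (orderOf r : ℤ) ∣ (l + l) := by
      rw [orderOf_dvd_iff_zpow_eq_one, ← hti]
      intro h
      exact ht1 v (by rw [h]; rfl)
    obtain ⟨q, hq⟩ := h4
    have hqo : Odd q := by
      by_contra hcon
      obtain ⟨a, ha⟩ := Int.not_odd_iff_even.1 hcon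
      apply h2
      refine ⟨a, ?_⟩
      rw [ha, mul_add] at hq
      omega
    obtain ⟨a, ha⟩ := hqo
    have hm4 : ∃ n : ℕ, orderOf r = 4 * n := by
      have e1 : (4 : ℤ) ∣ (orderOf r : ℤ) * q := ⟨l, by rw [← hq]; ring⟩
      have e2 : IsCoprime (4 : ℤ) q := by
        rw [ha]
        exact ⟨-a * a + 0 - a, 2 * a + 1, by ring⟩
      have := e2.dvd_of_dvd_mul_right e1
      have : 4 ∣ orderOf r := by exact_mod_cast this
      exact this
    obtain ⟨n, hn⟩ := hm4
    have htn : t = r ^ ((2 * n : ℕ) : ℤ) := by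
      have e : l + l = ((2 * n : ℕ) : ℤ) + (orderOf r : ℤ) * a := by
        rw [ha, hn] at hq
        rw [hn]
        push_cast at hq ⊢
        linarith
      rw [hti, e, zpow_add, zpow_mul r (orderOf r : ℤ), zpow_natCast r (orderOf r), pow_orderOf_eq_one, one_zpow, mul_one]
    have hn2 : 2 ≤ n := by
      by_contra hcon
      have : n = 0 ∨ n = 1 := by omega
      rcases this with rfl | rfl
      · omega
      · have r3 : t v = r (r v) := by
          rw [htn]; rfl
        exact htri v (r v) (r (r v)) (hadj_r _) (hadj_r _) (r3 ▸ hadj_t v)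
    refine ⟨n, hn2, Or.inl (cyc_iso r v (4 * n) 1 (4 * n - 1) (2 * n) hn (by omega) (by ring) ?_ ?_)⟩
    · intro x
      obtain ⟨i, j, rfl⟩ := htr x
      refine ⟨i + ((2 * n : ℕ) : ℤ) * j, ?_⟩
      rw [zpow_add, zpow_mul r ((2 * n : ℕ) : ℤ), ← htn]
    · intro x y
      rw [hadj, ← htn, show ((1 : ℕ) : ℤ) = 1 from rfl, zpow_one]

open SimpleGraph
set_option linter.unusedSectionVars false
set_option linter.unusedSimpArgs false

section
variable {Γ : Type*} [Group Γ] [Fintype Γ] [DecidableEq Γ]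

theorem closed_all {T : Finset Γ} (hC : Cub T) (P : Γ → Prop) {x₀ : Γ} (h0 : P x₀)
    (h : ∀ s ∈ T, ∀ x, P x → P (s * x)) (x : Γ) : P x := by
  classical
  have := closed_univ (A := Finset.univ.filter P) hC ⟨x₀, by simpa using h0⟩
    (by
      intro s hs y hy
      simp only [Finset.mem_filter, Finset.mem_univ, true_and] at hy ⊢
      exact h s hs y hy)
  have hx : x ∈ Finset.univ.filter P := by rw [this]; simp
  simpa using hx

theorem prop4 {p0 p1 p2 p3 : Prop} (h : p0 ∨ p1 ∨ p2 ∨ p3) (h1 : p0 → ¬ p1) (h2 : p0 → ¬ p2)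
    (h3 : p2 → ¬ p3) (h4 : p1 → ¬ p3) : ¬ ((p0 ∨ p3) ↔ (p1 ∨ p2)) := by
  by_cases p0 <;> by_cases p1 <;> by_cases p2 <;> by_cases p3 <;> simp_all

set_option maxHeartbeats 2000000 in
/-- data giving the commuting permutations -/
theorem ladder_perm {T : Finset Γ} (hC : Cub T) (hnb : NonBip T) (hl : Ladder T) :
    ∃ r t : Equiv.Perm Γ, Commute r t ∧ t * t = 1 ∧
      ∀ x y, (∃ s ∈ T, y = s * x) ↔ (y = r x ∨ x = r y ∨ y = t x) := by
  classical
  rcases hl with ⟨a, b, rfl, ha, hb, hab⟩ | ⟨t, a, c, rfl, t2, a2, c2, ta, tc⟩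
  · have key : a * b = b * a → ∃ r t : Equiv.Perm Γ, Commute r t ∧ t * t = 1 ∧
      ∀ x y, (∃ s ∈ ({a, b, b⁻¹} : Finset Γ), y = s * x) ↔ (y = r x ∨ x = r y ∨ y = t x) := by
      intro hc
      refine ⟨Equiv.mulLeft b, Equiv.mulLeft a, ?_, ?_, ?_⟩
      · ext x
        simp only [Equiv.Perm.mul_apply, Equiv.coe_mulLeft]
        rw [← mul_assoc, ← mul_assoc, hc]
      · ext x
        simp only [Equiv.Perm.mul_apply, Equiv.coe_mulLeft]
        rw [← mul_assoc, ha]; simp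
      · intro x y
        simp only [Finset.mem_insert, Finset.mem_singleton, Equiv.coe_mulLeft, exists_eq_or_imp,
          exists_eq_left]
        have : y = b⁻¹ * x ↔ x = b * y := by
          rw [eq_inv_mul_iff_mul_eq]; exact eq_comm
        rw [this]; tauto
    rcases hab with h | h
    · exact key h
    by_cases haH : a ∈ Subgroup.zpowers b
    · apply key
      obtain ⟨k, rfl⟩ := Subgroup.mem_zpowers_iff.1 haH
      exact (Commute.zpow_left (Commute.refl b) k).eq
    have h1 : a * b = b⁻¹ * a := by
      rw [← h, mul_assoc (a * b), ha, mul_one]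
    have h2 : a * b⁻¹ = b * a := by
      rw [mul_inv_eq_iff_eq_mul, mul_assoc, h1, mul_inv_cancel_left]
    set H := Subgroup.zpowers b with hH
    have hbH : b ∈ H := Subgroup.mem_zpowers b
    have m1 : ∀ x, b * x ∈ H ↔ x ∈ H := fun x => Subgroup.mul_mem_cancel_left H hbH
    have m2 : ∀ x, b⁻¹ * x ∈ H ↔ x ∈ H := fun x => Subgroup.mul_mem_cancel_left H (inv_mem hbH)
    have haa : ∀ x, a * (a * x) = x := fun x => by rw [← mul_assoc, ha, one_mul]
    have hall : ∀ x, x ∈ H ∨ a * x ∈ H := by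
      apply closed_all hC (fun x => x ∈ H ∨ a * x ∈ H) (x₀ := 1) (Or.inl (one_mem H))
      intro s hs x hx
      simp only [Finset.mem_insert, Finset.mem_singleton] at hs
      rcases hs with rfl | rfl | rfl
      · rw [haa]; exact hx.symm
      · rw [← mul_assoc, h1, mul_assoc, m1, m2]; exact hx
      · rw [← mul_assoc, h2, mul_assoc, m1, m2]; exact hx
    have hP : ∀ x, a * x ∈ H ↔ x ∉ H := by
      intro x
      constructor
      · intro h3 h4
        exact haH ((Subgroup.mul_mem_cancel_right H h4).1 h3)
      · intro h3; exact (hall x).resolve_left h3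
    let r : Equiv.Perm Γ :=
      { toFun := fun x => if x ∈ H then b * x else b⁻¹ * x
        invFun := fun x => if x ∈ H then b⁻¹ * x else b * x
        left_inv := by
          intro x
          by_cases hx : x ∈ H
          · simp [hx, m1]
          · simp [hx, m2]
        right_inv := by
          intro x
          by_cases hx : x ∈ H
          · simp [hx, m2]
          · simp [hx, m1] }
    have r1 : ∀ x, x ∈ H → r x = b * x := fun x hx => if_pos hx
    have r2 : ∀ x, x ∉ H → r x = b⁻¹ * x := fun x hx => if_neg hx
    have ri1 : ∀ x, x ∈ H → r.symm x = b⁻¹ * x := fun x hx => if_pos hx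
    have ri2 : ∀ x, x ∉ H → r.symm x = b * x := fun x hx => if_neg hx
    refine ⟨r, Equiv.mulLeft a, ?_, ?_, ?_⟩
    · ext x
      simp only [Equiv.Perm.mul_apply, Equiv.coe_mulLeft]
      by_cases hx : x ∈ H
      · have : a * x ∉ H := by rw [hP]; exact not_not.2 hx
        rw [r1 x hx, r2 _ this, ← mul_assoc, ← mul_assoc, h1]
      · have : a * x ∈ H := by rw [hP]; exact hx
        rw [r2 x hx, r1 _ this, ← mul_assoc, ← mul_assoc, h2]
    · ext x
      simp only [Equiv.Perm.mul_apply, Equiv.coe_mulLeft]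
      rw [← mul_assoc, ha]; simp
    · intro x y
      simp only [Finset.mem_insert, Finset.mem_singleton, Equiv.coe_mulLeft, exists_eq_or_imp,
        exists_eq_left]
      have e : x = r y ↔ y = r.symm x := by
        rw [Equiv.eq_symm_apply]; exact eq_comm
      rw [e]
      by_cases hx : x ∈ H
      · rw [r1 x hx, ri1 x hx]; tauto
      · rw [r2 x hx, ri2 x hx]; tauto
  · have haa : ∀ x, a * (a * x) = x := fun x => by rw [← mul_assoc, a2, one_mul]
    have hcc : ∀ x, c * (c * x) = x := fun x => by rw [← mul_assoc, c2, one_mul]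
    have htt : ∀ x, t * (t * x) = x := fun x => by rw [← mul_assoc, t2, one_mul]
    have hta : ∀ x, t * (a * x) = a * (t * x) := fun x => by rw [← mul_assoc, ta, mul_assoc]
    have htc : ∀ x, t * (c * x) = c * (t * x) := fun x => by rw [← mul_assoc, tc, mul_assoc]
    set H := Subgroup.zpowers (a * c) with hH
    have hz : a * c ∈ H := Subgroup.mem_zpowers _
    have mac : ∀ x, a * (c * x) ∈ H ↔ x ∈ H := fun x => by
      rw [← mul_assoc]; exact Subgroup.mul_mem_cancel_left H hz
    have mc : ∀ x, c * x ∈ H ↔ a * x ∈ H := fun x => by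
      rw [← mac (a * x)]
      have hz' : (a * c)⁻¹ = c * a := by
        rw [mul_inv_rev, inv_eq_of_mul_eq_one_left a2, inv_eq_of_mul_eq_one_left c2]
      rw [← Subgroup.mul_mem_cancel_left H (x := (a * c)) (y := c * x) hz]
      constructor
      · intro h
        have h' := (Subgroup.mul_mem_cancel_left H hz).1 h
        have h3 := mul_mem hz (mul_mem hz ((mul_mem (inv_mem hz) h')))
        have e : c * x = (a * c)⁻¹ * (a * x) := by
          rw [hz', mul_assoc, haa]
        rw [e, Subgroup.mul_mem_cancel_left H (inv_mem hz)] at h'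
        exact (mac (a * x)).2 h'
      · intro h
        have h' := (mac (a * x)).1 h
        have e : c * x = (a * c)⁻¹ * (a * x) := by
          rw [hz', mul_assoc, haa]
        rw [e, mul_inv_cancel_left]
        exact h'
    have haH : a ∉ H := by
      intro h
      obtain ⟨k, hk⟩ := Subgroup.mem_zpowers_iff.1 h
      have e1 : a * (a * c) = (a * c) * a := by
        have := (Commute.zpow_left (Commute.refl (a * c)) k).eq
        rw [hk] at this
        exact this
      have e2 : a * c = c * a := by
        rw [mul_assoc] at e1; exact mul_left_cancel e1
      have e3 : (a * c) * (a * c) = 1 := by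
        calc (a * c) * (a * c) = (a * c) * (c * a) := by rw [← e2]
          _ = a * (c * (c * a)) := by rw [mul_assoc]
          _ = 1 := by rw [hcc, a2]
      have e4 : ∀ i : ℤ, (a * c) ^ i = 1 ∨ (a * c) ^ i = a * c := by
        intro i
        have e5 : (a * c) ^ (2 : ℤ) = 1 := by rw [zpow_two, e3]
        rcases Int.even_or_odd i with ⟨j, hj⟩ | ⟨j, hj⟩
        · left; rw [hj, ← two_mul, zpow_mul, e5, one_zpow]
        · right; rw [hj, zpow_add, zpow_mul, e5, one_zpow, one_mul, zpow_one]
      rcases e4 k with h | h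
      · rw [hk] at h
        exact hC.ne_one (by simp : a ∈ _) h
      · rw [hk] at h
        exact hC.ne_one (by simp : c ∈ _) (by simpa using h.symm)
    have hall : ∀ x, x ∈ H ∨ a * x ∈ H ∨ t * x ∈ H ∨ a * (t * x) ∈ H := by
      apply closed_all hC (fun x => x ∈ H ∨ a * x ∈ H ∨ t * x ∈ H ∨ a * (t * x) ∈ H) (x₀ := 1)
        (Or.inl (one_mem H))
      intro s hs x hx
      simp only [Finset.mem_insert, Finset.mem_singleton] at hs
      rcases hs with rfl | rfl | rfl
      · rw [htt]; tauto
      · rw [haa, hta, haa]; tauto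
      · rw [htc, mac, mac, mc, mc]; tauto
    have ex1 : ∀ x, x ∈ H → a * x ∉ H := fun x h h' => haH ((Subgroup.mul_mem_cancel_right H h).1 h')
    have htH : t ∈ H := by
      by_contra htH
      have ex2 : ∀ x, x ∈ H → t * x ∉ H := fun x h h' => htH ((Subgroup.mul_mem_cancel_right H h).1 h')
      apply hnb
      have hf : ∀ x, ¬ ((x ∈ H ∨ a * (t * x) ∈ H) ↔ (a * x ∈ H ∨ t * x ∈ H)) := by
        intro x
        have q1 := hall x
        have q2 := ex1 x
        have q3 := ex2 x
        have q4 := ex1 (t * x)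
        have q5 := ex2 (a * x)
        rw [hta] at q5
        exact prop4 q1 q2 q3 q4 q5
      refine ⟨fun x => decide (x ∈ H ∨ a * (t * x) ∈ H), fun s hs x h => ?_⟩
      rw [decide_eq_decide] at h
      apply hf x
      rw [← h]
      simp only [Finset.mem_insert, Finset.mem_singleton] at hs
      rcases hs with rfl | rfl | rfl
      · rw [htt]; exact or_comm
      · rw [hta, haa]
      · rw [htc, mac, mc]
    have hmt : ∀ x, t * x ∈ H ↔ x ∈ H := fun x => Subgroup.mul_mem_cancel_left H htH
    have hP : ∀ x, a * x ∈ H ↔ x ∉ H := by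
      intro x
      have q1 := hall x
      have q2 := ex1 x
      rw [← hta, hmt, hmt] at q1
      tauto
    have hPc : ∀ x, c * x ∈ H ↔ x ∉ H := fun x => by rw [mc, hP]
    let r : Equiv.Perm Γ :=
      { toFun := fun x => if x ∈ H then c * x else a * x
        invFun := fun x => if x ∈ H then a * x else c * x
        left_inv := by
          intro x
          by_cases hx : x ∈ H
          · simp [hx, hPc, hcc]
          · simp [hx, hP, haa]
        right_inv := by
          intro x
          by_cases hx : x ∈ H
          · simp [hx, hP, haa]
          · simp [hx, hPc, hcc] }
    have r1 : ∀ x, x ∈ H → r x = c * x := fun x hx => if_pos hx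
    have r2 : ∀ x, x ∉ H → r x = a * x := fun x hx => if_neg hx
    have ri1 : ∀ x, x ∈ H → r.symm x = a * x := fun x hx => if_pos hx
    have ri2 : ∀ x, x ∉ H → r.symm x = c * x := fun x hx => if_neg hx
    refine ⟨r, Equiv.mulLeft t, ?_, ?_, ?_⟩
    · ext x
      simp only [Equiv.Perm.mul_apply, Equiv.coe_mulLeft]
      by_cases hx : x ∈ H
      · rw [r1 x hx, r1 _ ((hmt x).2 hx), htc]
      · rw [r2 x hx, r2 _ (fun h => hx ((hmt x).1 h)), hta]
    · ext x
      simp only [Equiv.Perm.mul_apply, Equiv.coe_mulLeft]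
      rw [← mul_assoc, t2]; simp
    · intro x y
      simp only [Finset.mem_insert, Finset.mem_singleton, Equiv.coe_mulLeft, exists_eq_or_imp,
        exists_eq_left]
      have e : x = r y ↔ y = r.symm x := by
        rw [Equiv.eq_symm_apply]; exact eq_comm
      rw [e]
      by_cases hx : x ∈ H
      · rw [r1 x hx, ri1 x hx]; tauto
      · rw [r2 x hx, ri2 x hx]; tauto

theorem ladder_iso {S : Set Γ} (hS : ∀ s ∈ S, s⁻¹ ∈ S) (hid : (1 : Γ) ∉ S) {T : Finset Γ}
    (hT : ∀ s, s ∈ T ↔ s ∈ S) (hC : Cub T) (ht : TriFree T) (hnb : NonBip T)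
    (hconn : (cayleyGraph Γ S hS).Connected) (hl : Ladder T) :
    ∃ n, 2 ≤ n ∧ (Nonempty (cayleyGraph Γ S hS ≃g circThree (4 * n) 1 (4 * n - 1) (2 * n)) ∨
      Nonempty (cayleyGraph Γ S hS ≃g circThree (4 * n + 2) 2 (4 * n) (2 * n + 1))) := by
  have adj : ∀ x y, (cayleyGraph Γ S hS).Adj x y ↔ ∃ s ∈ T, y = s * x := by
    intro x y
    rw [cay_adj hS hid]
    simp only [hT]
  obtain ⟨r, t, h1, h2, h3⟩ := ladder_perm hC hnb hl
  refine ladder_abs 1 r t h1 h2 (fun x y => (adj x y).trans (h3 x y)) hconn ?_ ?_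
  · rintro ⟨f, hf⟩
    exact hnb ⟨f, fun s hs x h => hf _ _ ((adj _ _).2 ⟨s, hs, rfl⟩) h.symm⟩
  · intro x y z hxy hyz hxz
    obtain ⟨s, hs, rfl⟩ := (adj _ _).1 hxy
    obtain ⟨s', hs', rfl⟩ := (adj _ _).1 hyz
    obtain ⟨s'', hs'', e⟩ := (adj _ _).1 hxz
    rw [← mul_assoc] at e
    exact ht s' hs' s hs (mul_right_cancel e ▸ hs'')

end

open SimpleGraph
set_option linter.unusedSectionVars false
set_option linter.unusedSimpArgs false

theorem nbr_eq {V : Type*} [Fintype V] [DecidableEq V] {G : SimpleGraph V} [DecidableRel G.Adj]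
    (hreg : G.IsRegularOfDegree 3) {x p q r : V} (hp : G.Adj x p) (hq : G.Adj x q) (hr : G.Adj x r)
    (pq : p ≠ q) (pr : p ≠ r) (qr : q ≠ r) (y : V) (hy : G.Adj x y) : y = p ∨ y = q ∨ y = r := by
  have h : ({p, q, r} : Finset V) = G.neighborFinset x := by
    apply Finset.eq_of_subset_of_card_le
    · intro z hz
      simp only [Finset.mem_insert, Finset.mem_singleton] at hz
      rw [SimpleGraph.mem_neighborFinset]
      rcases hz with rfl | rfl | rfl <;> assumption
    · rw [SimpleGraph.card_neighborFinset_eq_degree, hreg x,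
        Finset.card_insert_of_notMem (by simp; tauto), Finset.card_pair qr]
  have : y ∈ G.neighborFinset x := by rw [SimpleGraph.mem_neighborFinset]; exact hy
  rw [← h] at this
  simpa using this

theorem ext_no_tri {V : Type*} [Fintype V] [DecidableEq V] {G : SimpleGraph V} [DecidableRel G.Adj]
    (hconn : G.Connected) (hreg : G.IsRegularOfDegree 3) (hext : IsNExtendable G 2) {a b c : V}
    (hab : G.Adj a b) (hbc : G.Adj b c) (hac : G.Adj a c) : False := by
  obtain ⟨hcard, -, hext⟩ := hext
  -- third neighbour of `c`
  obtain ⟨d, hcd, hda, hdb⟩ : ∃ d, G.Adj c d ∧ d ≠ a ∧ d ≠ b := by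
    by_contra hcon
    push Not at hcon
    have : G.neighborFinset c ⊆ {a, b} := by
      intro x hx
      rw [SimpleGraph.mem_neighborFinset] at hx
      simp only [Finset.mem_insert, Finset.mem_singleton]
      by_cases e : x = a
      · exact Or.inl e
      · exact Or.inr (hcon x hx e)
    have := Finset.card_le_card this
    rw [SimpleGraph.card_neighborFinset_eq_degree, hreg c] at this
    have h2 : ({a, b} : Finset V).card ≤ 2 := Finset.card_le_two
    omega
  have hdc : d ≠ c := hcd.ne.symm
  have nc := nbr_eq hreg hac.symm hbc.symm hcd hab.ne hda.symm hdb.symm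
  by_cases hx : ∃ x, G.Adj d x ∧ x ≠ a ∧ x ≠ b ∧ x ≠ c
  · obtain ⟨x, hdx, xa, xb, xc⟩ := hx
    obtain ⟨M, hM, hM2, hMe⟩ := mk_two hab hdx hda.symm xa.symm hdb.symm xb.symm
    obtain ⟨P, hP, hMP⟩ := hext M hM hM2
    have p1 : P.Adj a b := by
      rw [← SimpleGraph.Subgraph.mem_edgeSet]; apply hMP; rw [hMe]; simp
    have p2 : P.Adj d x := by
      rw [← SimpleGraph.Subgraph.mem_edgeSet]; apply hMP; rw [hMe]; simp
    obtain ⟨y, hy, -⟩ := SimpleGraph.Subgraph.isPerfectMatching_iff.1 hP c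
    rcases nc y (P.adj_sub hy) with rfl | rfl | rfl
    · exact hbc.ne (hP.1.eq_of_adj_left p1 hy.symm)
    · exact hac.ne (hP.1.eq_of_adj_left p1.symm hy.symm)
    · exact xc (hP.1.eq_of_adj_left p2 hy.symm)
  · push Not at hx
    have hdN : G.neighborFinset d = {a, b, c} := by
      apply Finset.eq_of_subset_of_card_le
      · intro x h
        rw [SimpleGraph.mem_neighborFinset] at h
        simp only [Finset.mem_insert, Finset.mem_singleton]
        have := hx x h
        tauto
      · rw [SimpleGraph.card_neighborFinset_eq_degree, hreg d]
        exact Finset.card_le_three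
    have da : G.Adj d a := by rw [← SimpleGraph.mem_neighborFinset, hdN]; simp
    have db : G.Adj d b := by rw [← SimpleGraph.mem_neighborFinset, hdN]; simp
    have na := nbr_eq hreg hab hac da.symm hbc.ne hdb.symm hdc.symm
    have nbb := nbr_eq hreg hab.symm hbc db.symm hac.ne hda.symm hdc.symm
    have nd := nbr_eq hreg da db hcd.symm hab.ne hac.ne hbc.ne
    have hall : ∀ (u w : V) (p : G.Walk u w), u ∈ ({a, b, c, d} : Finset V) →
        w ∈ ({a, b, c, d} : Finset V) := by
      intro u w p
      induction p with
      | nil => exact id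
      | cons h p ih =>
        intro hu
        apply ih
        simp only [Finset.mem_insert, Finset.mem_singleton] at hu ⊢
        rcases hu with rfl | rfl | rfl | rfl
        · have := na _ h; tauto
        · have := nbb _ h; tauto
        · have := nc _ h; tauto
        · have := nd _ h; tauto
    have huniv : Finset.univ ⊆ ({a, b, c, d} : Finset V) := by
      intro w _
      obtain ⟨p⟩ := hconn.preconnected a w
      exact hall a w p (by simp)
    have h1 := Finset.card_le_card huniv
    have h2 : ({a, b, c, d} : Finset V).card ≤ 4 := Finset.card_le_four
    rw [Finset.card_univ] at h1
    omega

theorem zmod_zigzag {R : Type*} [CommRing R] (Q : R → R → Prop) (e m0 : R)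
    (sym : ∀ x y, Q x y → Q y x) (un : ∀ x y z, Q x y → Q x z → y = z) (tot : ∀ x, ∃ y, Q x y)
    (loc : ∀ x y, Q x y → y = x + e ∨ y = x - e ∨ y = x + m0)
    (hm : m0 + m0 = 0) (e2 : e + e ≠ 0) (em : m0 + e ≠ 0)
    (q0 : Q 0 e) (q1 : Q (m0 - e) m0) (j : ℕ) :
    Q (2 * j * e) (2 * j * e + e) ∧ Q (m0 + 2 * j * e - e) (m0 + 2 * j * e) := by
  induction j with
  | zero => simpa using ⟨q0, q1⟩
  | succ j ih =>
    obtain ⟨h1, h2⟩ := ih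
    have e1 : (2 * ((j + 1 : ℕ) : R) * e) = 2 * j * e + e + e := by push_cast; ring
    rw [e1]
    have g2 : Q (m0 + (2 * j * e + e + e) - e) (m0 + (2 * j * e + e + e)) := by
      obtain ⟨y, hy⟩ := tot (m0 + (2 * j * e + e + e) - e)
      rcases loc _ _ hy with h | h | h
      · rw [show m0 + (2 * j * e + e + e) - e + e = m0 + (2 * j * e + e + e) by ring] at h
        rw [h] at hy; exact hy
      · rw [show m0 + (2 * j * e + e + e) - e - e = m0 + 2 * j * e by ring] at h
        rw [h] at hy
        have := un _ _ _ (sym _ _ h2) (sym _ _ hy)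
        exact absurd (by linear_combination -this) e2
      · rw [show m0 + (2 * j * e + e + e) - e + m0 = (m0 + m0) + (2 * j * e + e) by ring, hm, zero_add] at h
        rw [h] at hy
        have := un _ _ _ (sym _ _ h1) (sym _ _ hy)
        exact absurd (by linear_combination -this) em
    refine ⟨?_, g2⟩
    obtain ⟨y, hy⟩ := tot (2 * j * e + e + e)
    rcases loc _ _ hy with h | h | h
    · rw [← h]; exact hy
    · rw [show 2 * j * e + e + e - e = 2 * j * e + e by ring] at h
      rw [h] at hy
      have := un _ _ _ (sym _ _ h1) (sym _ _ hy)
      exact absurd (by linear_combination -this) e2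
    · rw [show 2 * j * e + e + e + m0 = m0 + (2 * j * e + e + e) by ring] at h
      rw [h] at hy
      have := un _ _ _ (sym _ _ g2) (sym _ _ hy)
      exact absurd (by linear_combination hm - this) em

theorem ladder_not_ext {V : Type*} [Fintype V] {G : SimpleGraph V} (hext : IsNExtendable G 2)
    (m e b0 m0 n : ℕ) (φ : G ≃g circThree m e b0 m0) (hb : e + b0 = m) (hm : 2 * m0 = m)
    (he : 0 < e) (h1 : 2 * e < m) (h2 : m0 + 2 * e < m)
    (hend : m ∣ m0 + 2 * n * e ∨ m ∣ 2 * n * e + e) : False := by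
  obtain ⟨-, -, hext⟩ := hext
  let ψ : ZMod m → V := fun x => φ.symm x
  have hψ : Function.Injective ψ := φ.symm.injective
  have hψs : Function.Surjective ψ := φ.symm.surjective
  have nz : ∀ k : ℕ, 0 < k → k < m → (k : ZMod m) ≠ 0 := by
    intro k hk hkm h
    rw [ZMod.natCast_eq_zero_iff] at h
    exact Nat.not_dvd_of_pos_of_lt hk hkm h
  have hb' : (b0 : ZMod m) = - (e : ZMod m) := by
    rw [eq_neg_iff_add_eq_zero]
    have : ((e + b0 : ℕ) : ZMod m) = 0 := by rw [hb]; simp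
    push_cast at this
    rw [add_comm]; exact this
  have hm' : (m0 : ZMod m) + m0 = 0 := by
    have : ((2 * m0 : ℕ) : ZMod m) = 0 := by rw [hm]; simp
    push_cast at this
    rw [← this]; ring
  have z1 : (e : ZMod m) ≠ 0 := nz e he (by omega)
  have z2 : (e : ZMod m) + e ≠ 0 := by
    have := nz (2 * e) (by omega) h1
    push_cast at this; rwa [two_mul] at this
  have z3 : (m0 : ZMod m) ≠ 0 := nz m0 (by omega) (by omega)
  have z4 : (m0 : ZMod m) + e ≠ 0 := by
    have := nz (m0 + e) (by omega) (by omega)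
    push_cast at this; exact this
  have z5 : (m0 : ZMod m) + 2 * e ≠ 0 := by
    have := nz (m0 + 2 * e) (by omega) (by omega)
    push_cast at this; exact this
  have adj : ∀ x y : ZMod m, G.Adj (ψ x) (ψ y) ↔ (circThree m e b0 m0).Adj x y := fun x y =>
    φ.symm.map_adj_iff
  have cadj : ∀ x y : ZMod m, (circThree m e b0 m0).Adj x y ↔
      x ≠ y ∧ (x - y = e ∨ x - y = -e ∨ x - y = m0 ∨ y - x = e ∨ y - x = -e ∨ y - x = m0) := by
    intro x y
    unfold circThree
    rw [SimpleGraph.circulantGraph_adj]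
    simp only [Set.mem_insert_iff, Set.mem_singleton_iff, hb', or_assoc]
  have a1 : G.Adj (ψ 0) (ψ e) := by
    rw [adj, cadj]
    exact ⟨z1.symm, by simp⟩
  have a2 : G.Adj (ψ (m0 - e)) (ψ m0) := by
    rw [adj, cadj]
    refine ⟨fun h => z1 ?_, ?_⟩
    · linear_combination -h
    · simp
  obtain ⟨M, hM, hM2, hMe⟩ := mk_two a1 a2
    (fun h => z4 (by have := hψ h; linear_combination hm' + this)) (fun h => z3 (hψ h).symm)
    (fun h => z5 (by have := hψ h; linear_combination hm' + this))
    (fun h => z4 (by have := hψ h; linear_combination hm' + this))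
  obtain ⟨P, hP, hMP⟩ := hext M hM hM2
  have p1 : P.Adj (ψ 0) (ψ e) := by
    rw [← SimpleGraph.Subgraph.mem_edgeSet]; apply hMP; rw [hMe]; simp
  have p2 : P.Adj (ψ (m0 - e)) (ψ m0) := by
    rw [← SimpleGraph.Subgraph.mem_edgeSet]; apply hMP; rw [hMe]; simp
  have un : ∀ x y z : ZMod m, P.Adj (ψ x) (ψ y) → P.Adj (ψ x) (ψ z) → y = z := fun x y z h h' =>
    hψ (hP.1.eq_of_adj_left h h')
  have zz := zmod_zigzag (fun x y => P.Adj (ψ x) (ψ y)) (e : ZMod m) (m0 : ZMod m)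
    (fun x y h => h.symm) un
    (fun x => by
      obtain ⟨y, hy, -⟩ := SimpleGraph.Subgraph.isPerfectMatching_iff.1 hP (ψ x)
      obtain ⟨y, rfl⟩ := hψs y
      exact ⟨y, hy⟩)
    (fun x y h => by
      have h := P.adj_sub h
      rw [adj, cadj] at h
      rcases h.2 with h | h | h | h | h | h
      · right; left; linear_combination -h
      · left; linear_combination -h
      · right; right; linear_combination -hm' - h
      · left; linear_combination h
      · right; left; linear_combination h
      · right; right; linear_combination h) hm' z2 z4 p1 p2 n
  have fin : P.Adj (ψ (-e)) (ψ 0) := by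
    rcases hend with h | h
    · rw [← ZMod.natCast_eq_zero_iff] at h
      push_cast at h
      have := zz.2
      rw [h, zero_sub] at this
      exact this
    · rw [← ZMod.natCast_eq_zero_iff] at h
      push_cast at h
      have := zz.1
      rw [h, eq_neg_of_add_eq_zero_left h] at this
      exact this
  have := un 0 e (-e) p1 fin.symm
  exact z2 (by linear_combination this)

open SimpleGraph
set_option linter.unusedSectionVars false
set_option linter.unusedSimpArgs false

/-- A connected cubic non-bipartite Cayley graph on a finite group of even order is
2-extendable iff its girth is at least 4 and it is not isomorphic to
`Z_{4n}(1,4n-1,2n)` or `Z_{4n+2}(2,4n,2n+1)` for any `n ≥ 2`. -/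
theorem cubic_nonbipartite_cayley_two_extendable_iff (Γ : Type*) [Group Γ] [Fintype Γ]
    (S : Set Γ) (hS : ∀ s ∈ S, s⁻¹ ∈ S) (hid : (1 : Γ) ∉ S)
    (hgen : Subgroup.closure S = ⊤) [DecidableRel (cayleyGraph Γ S hS).Adj]
    (hconn : (cayleyGraph Γ S hS).Connected)
    (hcubic : (cayleyGraph Γ S hS).IsRegularOfDegree 3)
    (hnb : ¬ (cayleyGraph Γ S hS).Colorable 2) (heven : Even (Fintype.card Γ)) :
    IsNExtendable (cayleyGraph Γ S hS) 2 ↔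
      (4 ≤ (cayleyGraph Γ S hS).girth ∧
        (∀ n : ℕ, 2 ≤ n →
          ¬ Nonempty (cayleyGraph Γ S hS ≃g circThree (4 * n) 1 (4 * n - 1) (2 * n))) ∧
        (∀ n : ℕ, 2 ≤ n →
          ¬ Nonempty (cayleyGraph Γ S hS ≃g circThree (4 * n + 2) 2 (4 * n) (2 * n + 1)))) := by
  classical
  let T : Finset Γ := S.toFinset
  have hT : ∀ s, s ∈ T ↔ s ∈ S := fun s => Set.mem_toFinset
  have adj : ∀ x y, (cayleyGraph Γ S hS).Adj x y ↔ ∃ s ∈ S, y = s * x := fun x y => cay_adj hS hid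
  have hC : Cub T := by
    refine ⟨?_, ?_, ?_, ?_⟩
    · rw [← hcubic 1, ← SimpleGraph.card_neighborFinset_eq_degree]
      congr 1
      ext y
      rw [SimpleGraph.mem_neighborFinset, adj, hT]
      constructor
      · intro h; exact ⟨y, h, by simp⟩
      · rintro ⟨s, hs, rfl⟩; simpa using hs
    · intro s hs; rw [hT] at *; exact hS s hs
    · rw [hT]; exact hid
    · rw [← hgen]; congr 1; ext s; exact hT s
  have hNB : NonBip T := by
    rintro ⟨f, hf⟩
    apply hnb
    have col : (cayleyGraph Γ S hS).Coloring Bool := SimpleGraph.Coloring.mk f (by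
      intro x y h
      obtain ⟨s, hs, rfl⟩ := (adj x y).1 h
      exact (hf s ((hT s).2 hs) x).symm)
    exact col.colorable
  have hac : ¬ (cayleyGraph Γ S hS).IsAcyclic := fun h => hnb h.colorable_two
  constructor
  · intro hext
    refine ⟨?_, ?_, ?_⟩
    · by_contra hcon
      have h3 := SimpleGraph.three_le_girth hac
      obtain ⟨a, w, hw, hl⟩ := SimpleGraph.exists_girth_eq_length.2 hac
      obtain ⟨s, hs⟩ := SimpleGraph.is3Clique_iff_exists_cycle_length_three.2 ⟨a, w, hw, by omega⟩
      obtain ⟨a, b, c, h1, h2, h3, -⟩ := SimpleGraph.is3Clique_iff.1 hs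
      exact ext_no_tri hconn hcubic hext h1 h3 h2
    · rintro n hn ⟨φ⟩
      exact ladder_not_ext hext (4 * n) 1 (4 * n - 1) (2 * n) n φ (by omega) (by ring) (by omega)
        (by omega) (by omega) (Or.inl ⟨1, by ring⟩)
    · rintro n hn ⟨φ⟩
      exact ladder_not_ext hext (4 * n + 2) 2 (4 * n) (2 * n + 1) n φ (by ring) (by ring) (by omega)
        (by omega) (by omega) (Or.inr ⟨1, by ring⟩)
  · rintro ⟨hg, hm, hp⟩
    have ht : TriFree T := by
      intro s hs t ht hst
      rw [hT] at hs ht hst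
      have hclq : (cayleyGraph Γ S hS).IsNClique 3 {1, t, s * t} := by
        rw [SimpleGraph.is3Clique_triple_iff, adj, adj, adj]
        exact ⟨⟨t, ht, by simp⟩, ⟨s * t, hst, by simp⟩, ⟨s, hs, rfl⟩⟩
      obtain ⟨u, w, hw, hl⟩ := SimpleGraph.is3Clique_iff_exists_cycle_length_three.1 ⟨_, hclq⟩
      have := SimpleGraph.girth_le_length hw
      omega
    apply hard_dir hS hid hT hC ht hNB heven
    intro hl
    obtain ⟨n, hn, h | h⟩ := ladder_iso hS hid hT hC ht hNB hconn hl
    · exact hm n hn h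
    · exact hp n hn h
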